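/- Fix δ ≥ 0, a symbol a of order 0, bumps β, β₀, and α ∈ (−1,1)∖{0}. For r₁, r₂ > 0 and θ₁, θ₂ ∈ [0,2π) define K_D^1(r₁,r₂;θ₁−θ₂) = ∫₀^∞ e^{i d_s} (1+d_s)^{−3/2−δ} a(d_s) e^{−|α|s} ds, K_D^2(r₁,r₂;θ₁−θ₂) = ∫₀^∞ e^{i d_s} (1+d_s)^{−3/2−δ} a(d_s) · [(e^{−s} − cos(θ₁−θ₂+π)) sinh(αs)] / [cosh s − cos(θ₁−θ₂+π)] ds, K_D^3(r₁,r₂;θ₁−θ₂) = ∫₀^∞ e^{i d_s} (1+d_s)^{−3/2−δ} a(d_s) · [sin(θ₁−θ₂+π) cosh(αs)] / [cosh s − cos(θ₁−θ₂+π)] ds. For j ≥ 1 set K_D^{ℓ,j} = β(2^{−j}(r₁+r₂)) K_D^ℓ and K_D^{ℓ,0} = β₀(r₁+r₂) K_D^ℓ, and let T_D^{ℓ,j} f(r₁,θ₁) = ∫₀^∞ ∫₀^{2π} K_D^{ℓ,j}(r₁,r₂;θ₁−θ₂) f(r₂,θ₂) dθ₂ r₂ dr₂. Then for ℓ = 1,2,3: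 (i) there is C, independent of j, with ‖T_D^{ℓ,j} f‖_{L²(ℝ²)} ≤ C 2^{−jδ} ‖f‖_{L²(ℝ²)} for all j ≥ 0; (ii) for every p ≥ 6 there is C, independent of j, with ‖T_D^{ℓ,j} f‖_{L^p(ℝ²)} ≤ C 2^{j(δ_c(p,2)−δ)} ‖f‖_{L^p(ℝ²)} for all j ≥ 0; (iii) for every p with 4 ≤ p < 6 and every ε′ ∈ (0,1) there is C = C(ε′), independent of j, with ‖T_D^{ℓ,j} f‖_{L^p(ℝ²)} ≤ C 2^{j(δ_c(p,2)−δ)} 2^{jε′} ‖f‖_{L^p(ℝ²)} for all j ≥ 0. -/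

import Mathlib

open MeasureTheory Real Set
open scoped ENNReal NNReal

noncomputable section

/-- `d_s(r₁, r₂) = √(r₁² + r₂² + 2 r₁ r₂ cosh s)`. -/
def dS (r₁ r₂ s : ℝ) : ℝ := Real.sqrt (r₁ ^ 2 + r₂ ^ 2 + 2 * r₁ * r₂ * Real.cosh s)

/-- A symbol of order `0` on `(0, ∞)`. -/
def IsSymbol0 (a : ℝ → ℂ) : Prop :=
  ContDiffOn ℝ (⊤ : ℕ∞) a (Set.Ioi 0) ∧ (∃ M : ℝ, ∀ r > (0 : ℝ), ‖a r‖ ≤ M) ∧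
    ∀ N : ℕ, ∃ C : ℝ, ∀ r > (0 : ℝ),
      ‖iteratedDerivWithin N a (Set.Ioi 0) r‖ ≤ C * r ^ (-(N : ℝ))

/-- The `L^p(ℝ²)` norm of a function written in polar coordinates. -/
def polarLp (p : ℝ) (g : ℝ → ℝ → ℂ) : ℝ≥0∞ :=
  (∫⁻ r in Set.Ioi (0 : ℝ),
      (∫⁻ θ in Set.Ico (0 : ℝ) (2 * Real.pi), (‖g r θ‖₊ : ℝ≥0∞) ^ p) *
        ENNReal.ofReal r) ^ (1 / p)

/-- The critical Bochner–Riesz exponent `δ_c(p, 2)` in dimension `2`. -/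
def deltaC (p : ℝ) : ℝ := max 0 (2 * |1 / 2 - 1 / p| - 1 / 2)

/-- The three weights appearing in `K_D^1, K_D^2, K_D^3`, as functions of `s`
(`φ = θ₁ - θ₂`). -/
def wD (α φ s : ℝ) : Fin 3 → ℝ :=
  ![Real.exp (-(|α|) * s),
    ((Real.exp (-s) - Real.cos (φ + Real.pi)) * Real.sinh (α * s)) /
      (Real.cosh s - Real.cos (φ + Real.pi)),
    Real.sin (φ + Real.pi) * Real.cosh (α * s) /
      (Real.cosh s - Real.cos (φ + Real.pi))]

/-- The kernels `K_D^ℓ`, `ℓ = 1, 2, 3`. -/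
def KD (δ α : ℝ) (a : ℝ → ℂ) (ℓ : Fin 3) (r₁ r₂ φ : ℝ) : ℂ :=
  ∫ s in Set.Ioi (0 : ℝ),
    Complex.exp (Complex.I * (dS r₁ r₂ s : ℂ)) *
      (((1 + dS r₁ r₂ s) ^ (-(3 / 2 + δ)) : ℝ) : ℂ) *
      a (dS r₁ r₂ s) * ((wD α φ s ℓ : ℝ) : ℂ)

/-- The dyadic pieces `K_D^{ℓ,j}`: cutoff `β(2^{-j}(r₁+r₂))` for `j ≥ 1`,
and `β₀(r₁+r₂)` for `j = 0`. -/
def KDj (δ α : ℝ) (a : ℝ → ℂ) (β β₀ : ℝ → ℝ) (ℓ : Fin 3) (j : ℕ) (r₁ r₂ φ : ℝ) : ℂ :=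
  ((if j = 0 then β₀ (r₁ + r₂) else β ((2 : ℝ) ^ (-(j : ℝ)) * (r₁ + r₂)) : ℝ) : ℂ) *
    KD δ α a ℓ r₁ r₂ φ

/-- The operators `T_D^{ℓ,j}`. -/
def TD (δ α : ℝ) (a : ℝ → ℂ) (β β₀ : ℝ → ℝ) (ℓ : Fin 3) (j : ℕ)
    (f : ℝ → ℝ → ℂ) (r₁ θ₁ : ℝ) : ℂ :=
  ∫ r₂ in Set.Ioi (0 : ℝ),
    (∫ θ₂ in Set.Ico (0 : ℝ) (2 * Real.pi),
      KDj δ α a β β₀ ℓ j r₁ r₂ (θ₁ - θ₂) * f r₂ θ₂) * (r₂ : ℂ)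


section
lemma holder_nonmeas {Y : Type*} [MeasurableSpace Y] (ν : Measure Y) (k f : Y → ℂ)
    (hk : Measurable k) (hkf : AEStronglyMeasurable (fun y => k y * f y) ν)
    {p q : ℝ} (hpq : p.HolderConjugate q) :
    ∫⁻ y, ‖k y * f y‖ₑ ∂ν ≤ (∫⁻ y, ‖k y‖ₑ ^ q ∂ν) ^ (1 / q) * (∫⁻ y, ‖f y‖ₑ ^ p ∂ν) ^ (1 / p) := by
  have hg : AEMeasurable (fun y => ‖k y * f y‖ₑ / ‖k y‖ₑ) ν := hkf.enorm.div hk.enorm.aemeasurable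
  have h1 : ∀ y, ‖k y * f y‖ₑ ≤ ((fun y => ‖k y‖ₑ) * (fun y => ‖k y * f y‖ₑ / ‖k y‖ₑ)) y := by
    intro y
    simp only [Pi.mul_apply]
    by_cases h : k y = 0
    · simp [h]
    · rw [ENNReal.mul_div_cancel (by simpa using h) (by simp)]
  have h2 : ∀ y, ‖k y * f y‖ₑ / ‖k y‖ₑ ≤ ‖f y‖ₑ := by
    intro y
    by_cases h : k y = 0
    · simp [h]
    · rw [enorm_mul, mul_comm, ENNReal.mul_div_cancel_right (by simpa using h) (by simp)]
  calc ∫⁻ y, ‖k y * f y‖ₑ ∂ν ≤ _ := lintegral_mono h1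
    _ ≤ _ := ENNReal.lintegral_mul_le_Lp_mul_Lq ν hpq.symm hk.enorm.aemeasurable hg
    _ ≤ _ := by
      have := hpq.nonneg
      gcongr
      · exact h2 _

lemma slice_bound {Y ι : Type*} [MeasurableSpace Y] (ν : Measure Y) [IsFiniteMeasure ν]
    (s : Finset ι) (k : ι → Y → ℂ) (hk : ∀ i, Measurable (k i)) (hk2 : ∀ i, MemLp (k i) 2 ν)
    (hz : ∀ i, (∀ᵐ y ∂ν, k i y = 0) ∨ (∀ᵐ y ∂ν, k i y ≠ 0)) (f : Y → ℂ) (c : ι → ℂ)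
    {p q : ℝ} (hpq : p.HolderConjugate q) (hp : 2 ≤ p) (ε : ℝ≥0∞) (hε : ε ≠ 0) :
    ‖∑ i ∈ s, c i * ∫ y, k i y * f y ∂ν‖ₑ ≤
      ((∫⁻ y, ‖∑ i ∈ s, c i * k i y‖ₑ ^ q ∂ν) ^ (1 / q) + ε) *
        (∫⁻ y, ‖f y‖ₑ ^ p ∂ν) ^ (1 / p) := by
  have hp0 : 0 < p := by linarith
  by_cases hall : ∀ i ∈ s, Integrable (fun y => k i y * f y) ν
  · have e : ∑ i ∈ s, c i * ∫ y, k i y * f y ∂ν = ∫ y, (∑ i ∈ s, c i * k i y) * f y ∂ν := by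
      simp_rw [← integral_const_mul]
      rw [← integral_finsetSum]
      · congr 1; ext y; rw [Finset.sum_mul]; simp [mul_assoc]
      · intro i hi; exact (hall i hi).const_mul _
    have hIntg : Integrable (fun y => (∑ i ∈ s, c i * k i y) * f y) ν := by
      have := integrable_finsetSum (μ := ν) s (f := fun i y => c i * (k i y * f y))
        (fun i hi => (hall i hi).const_mul _)
      refine this.congr (Filter.Eventually.of_forall fun y => ?_)
      simp only [Finset.sum_mul, mul_assoc]
    rw [e]
    calc _ ≤ ∫⁻ y, ‖(∑ i ∈ s, c i * k i y) * f y‖ₑ ∂ν := enorm_integral_le_lintegral_enorm _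
      _ ≤ _ := holder_nonmeas ν _ f
        (Finset.measurable_sum s (fun i _ => (hk i).const_mul (c i))) hIntg.1 hpq
      _ ≤ _ := by gcongr; exact le_self_add
  · push Not at hall
    obtain ⟨i0, hi0, hn⟩ := hall
    by_cases hf : AEStronglyMeasurable f ν
    · have htop : ∫⁻ y, ‖f y‖ₑ ^ p ∂ν = ⊤ := by
        by_contra hne
        apply hn
        have hkf : AEStronglyMeasurable (fun y => k i0 y * f y) ν :=
          (hk i0).aestronglyMeasurable.mul hf
        refine ⟨hkf, ?_⟩
        have h1 := holder_nonmeas ν (k i0) f (hk i0) hkf hpq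
        refine lt_of_le_of_lt h1 (ENNReal.mul_lt_top ?_ ?_)
        · have hq2 : ENNReal.ofReal q ≤ 2 := by
            have : q ≤ 2 := by
              have := hpq.symm.conjugate_eq
              have := hpq.inv_add_inv_eq_one
              have hq0 := hpq.symm.pos
              by_contra h
              push Not at h
              have a1 : p⁻¹ ≤ 2⁻¹ := inv_anti₀ (by norm_num) hp
              have a2 : q⁻¹ < 2⁻¹ := inv_strictAnti₀ (by norm_num) h
              linarith
            calc ENNReal.ofReal q ≤ ENNReal.ofReal 2 := ENNReal.ofReal_le_ofReal this
              _ = 2 := by simp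
          have := (hk2 i0).mono_exponent hq2
          have h3 := this.2
          rw [eLpNorm_eq_lintegral_rpow_enorm_toReal (by simpa using hpq.symm.pos) (by simp),
            ENNReal.toReal_ofReal hpq.symm.nonneg] at h3
          exact h3
        · exact ENNReal.rpow_lt_top_of_nonneg (by positivity) hne
      rw [htop, ENNReal.top_rpow_of_pos (by positivity), ENNReal.mul_top]
      · exact le_top
      · simp [hε]
    · have : ∀ i, ∫ y, k i y * f y ∂ν = 0 := by
        intro i
        rcases hz i with h | h
        · rw [integral_eq_zero_of_ae]
          filter_upwards [h] with y hy
          simp [hy]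
        · apply integral_non_aestronglyMeasurable
          intro h2
          apply hf
          have : AEStronglyMeasurable (fun y => (k i y)⁻¹ * (k i y * f y)) ν :=
            (hk i).inv.aestronglyMeasurable.mul h2
          refine this.congr ?_
          filter_upwards [h] with y hy
          field_simp
      simp [this]

end

section
lemma functional_bound {X Y ι : Type*} [MeasurableSpace X] [MeasurableSpace Y] (lam : Measure X)
    [IsFiniteMeasure lam] (ν : Measure Y) [IsFiniteMeasure ν]
    (s : Finset ι) (κ : ι → X → Y → ℂ) (hk : ∀ i, Measurable (Function.uncurry (κ i)))
    (hk2 : ∀ i, ∀ᵐ x ∂lam, MemLp (κ i x) 2 ν)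
    (hz : ∀ i, ∀ᵐ x ∂lam, (∀ᵐ y ∂ν, κ i x y = 0) ∨ (∀ᵐ y ∂ν, κ i x y ≠ 0))
    (f : X → Y → ℂ) (c : ι → ℂ)
    (hIntg : ∀ i ∈ s, Integrable (fun x => ∫ y, κ i x y * f x y ∂ν) lam)
    {p q : ℝ} (hpq : p.HolderConjugate q) (hp : 2 ≤ p)
    (hA : ∫⁻ x, ∫⁻ y, ‖f x y‖ₑ ^ p ∂ν ∂lam ≠ ⊤) :
    ‖∑ i ∈ s, c i * ∫ x, ∫ y, κ i x y * f x y ∂ν ∂lam‖ₑ ≤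
      (∫⁻ z, ‖∑ i ∈ s, c i * κ i z.1 z.2‖ₑ ^ q ∂(lam.prod ν)) ^ (1 / q) *
        (∫⁻ x, ∫⁻ y, ‖f x y‖ₑ ^ p ∂ν ∂lam) ^ (1 / p) := by
  have hp0 : 0 < p := by linarith
  have hq0 : 0 < q := hpq.symm.pos
  have hq1 : 1 ≤ q := hpq.symm.lt.le
  set U : X → ℝ≥0∞ := fun x => ‖∑ i ∈ s, c i * ∫ y, κ i x y * f x y ∂ν‖ₑ with hU
  set G : X → Y → ℝ≥0∞ := fun x y => ‖∑ i ∈ s, c i * κ i x y‖ₑ ^ q with hG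
  have hGm : Measurable (Function.uncurry G) := by
    have : Measurable (fun z : X × Y => ∑ i ∈ s, c i * κ i z.1 z.2) :=
      Finset.measurable_sum s (fun i _ => (hk i).const_mul (c i))
    exact this.enorm.pow_const q
  set N : X → ℝ≥0∞ := fun x => (∫⁻ y, G x y ∂ν) ^ (1 / q) with hN
  have hNm : Measurable N := (hGm.lintegral_prod_right).pow_const _
  have hprod : ∫⁻ z, ‖∑ i ∈ s, c i * κ i z.1 z.2‖ₑ ^ q ∂(lam.prod ν) = ∫⁻ x, N x ^ q ∂lam := by
    have := lintegral_prod (μ := lam) (ν := ν) (Function.uncurry G) hGm.aemeasurable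
    rw [show (fun z : X × Y => ‖∑ i ∈ s, c i * κ i z.1 z.2‖ₑ ^ q) = Function.uncurry G from rfl]
    rw [this]
    congr 1; ext x
    rw [hN]
    simp only [Function.uncurry]
    rw [← ENNReal.rpow_mul]
    simp [hq0.ne']
  have hUm : AEMeasurable U lam := by
    have : Integrable (fun x => ∑ i ∈ s, c i * ∫ y, κ i x y * f x y ∂ν) lam :=
      integrable_finsetSum _ (fun i hi => (hIntg i hi).const_mul _)
    exact this.1.enorm
  have hL : ‖∑ i ∈ s, c i * ∫ x, ∫ y, κ i x y * f x y ∂ν ∂lam‖ₑ ≤ ∫⁻ x, U x ∂lam := by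
    have e : ∑ i ∈ s, c i * ∫ x, ∫ y, κ i x y * f x y ∂ν ∂lam =
        ∫ x, ∑ i ∈ s, c i * ∫ y, κ i x y * f x y ∂ν ∂lam := by
      rw [integral_finsetSum _ (fun i hi => (hIntg i hi).const_mul _)]
      refine Finset.sum_congr rfl fun i _ => ?_
      rw [integral_const_mul]
    rw [e]
    exact enorm_integral_le_lintegral_enorm _
  set A := (∫⁻ x, ∫⁻ y, ‖f x y‖ₑ ^ p ∂ν ∂lam) ^ (1 / p) with hAdef
  have hAt : A ≠ ⊤ := ENNReal.rpow_ne_top_of_nonneg (by positivity) hA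
  have hae2 : ∀ᵐ x ∂lam, ∀ i ∈ s, MemLp (κ i x) 2 ν :=
    (Finset.eventually_all s).2 (fun i _ => hk2 i)
  have haez : ∀ᵐ x ∂lam, ∀ i ∈ s, (∀ᵐ y ∂ν, κ i x y = 0) ∨ (∀ᵐ y ∂ν, κ i x y ≠ 0) :=
    (Finset.eventually_all s).2 (fun i _ => hz i)
  have hNfin : ∀ᵐ x ∂lam, N x ≠ ⊤ := by
    filter_upwards [hae2] with x hx
    have h1 : MemLp (fun y => ∑ i ∈ s, c i * κ i x y) 2 ν :=
      memLp_finsetSum s (fun i hi => (hx i hi).const_mul _)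
    have hq2 : ENNReal.ofReal q ≤ 2 := by
      have : q ≤ 2 := by
        have := hpq.inv_add_inv_eq_one
        by_contra h
        push Not at h
        have a1 : p⁻¹ ≤ 2⁻¹ := inv_anti₀ (by norm_num) hp
        have a2 : q⁻¹ < 2⁻¹ := inv_strictAnti₀ (by norm_num) h
        linarith
      calc ENNReal.ofReal q ≤ ENNReal.ofReal 2 := ENNReal.ofReal_le_ofReal this
        _ = 2 := by simp
    have h3 := (h1.mono_exponent hq2).2
    rw [eLpNorm_eq_lintegral_rpow_enorm_toReal (by simpa using hq0) (by simp),
      ENNReal.toReal_ofReal hq0.le] at h3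
    exact h3.ne
  have key : ∀ ε : ℝ≥0∞, ε ≠ 0 → ε ≠ ⊤ → ∫⁻ x, U x ∂lam ≤
      ((∫⁻ x, N x ^ q ∂lam) ^ (1 / q) + (ε * (lam univ) ^ (1 / q))) * A := by
    intro ε hε hε'
    have hs : ∀ᵐ x ∂lam, U x ≤ (N x + ε) * (∫⁻ y, ‖f x y‖ₑ ^ p ∂ν) ^ (1 / p) := by
      filter_upwards [hae2, haez] with x h2 hz
      have := slice_bound ν s.attach (fun i : s => κ i x) (fun i => (hk i).of_uncurry_left)
        (fun i => h2 i i.2) (fun i => hz i i.2) (f x) (fun i => c i) hpq hp ε hε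
      rw [Finset.sum_attach s (fun i => c i * ∫ y, κ i x y * f x y ∂ν)] at this
      have e : ∀ y, ∑ i ∈ s.attach, c i * κ i x y = ∑ i ∈ s, c i * κ i x y :=
        fun y => Finset.sum_attach s (fun i => c i * κ i x y)
      simp_rw [e] at this
      exact this
    set V : X → ℝ≥0∞ := fun x => U x / (N x + ε) with hV
    have hVm : AEMeasurable V lam := hUm.div (hNm.add_const ε).aemeasurable
    have hUV : ∀ᵐ x ∂lam, U x ≤ ((fun x => N x + ε) * V) x := by
      filter_upwards [hNfin] with x hx
      simp only [Pi.mul_apply, hV]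
      rw [ENNReal.mul_div_cancel (by simp [hε]) (by simp [hx, hε'])]
    have hVf : ∀ᵐ x ∂lam, V x ^ p ≤ ∫⁻ y, ‖f x y‖ₑ ^ p ∂ν := by
      filter_upwards [hs] with x hx
      have : V x ≤ (∫⁻ y, ‖f x y‖ₑ ^ p ∂ν) ^ (1 / p) :=
        ENNReal.div_le_of_le_mul' hx
      calc V x ^ p ≤ ((∫⁻ y, ‖f x y‖ₑ ^ p ∂ν) ^ (1 / p)) ^ p := by gcongr
        _ = _ := by rw [← ENNReal.rpow_mul]; simp [hp0.ne']
    calc ∫⁻ x, U x ∂lam ≤ _ := lintegral_mono_ae hUV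
      _ ≤ _ := ENNReal.lintegral_mul_le_Lp_mul_Lq lam hpq.symm (hNm.add_const ε).aemeasurable hVm
      _ ≤ _ := by
        gcongr
        · have := ENNReal.lintegral_Lp_add_le (μ := lam) (f := N) (g := fun _ => ε)
            hNm.aemeasurable aemeasurable_const hq1
          refine this.trans ?_
          gcongr
          rw [lintegral_const, ENNReal.mul_rpow_of_nonneg _ _ (by positivity), ← ENNReal.rpow_mul]
          simp [hq0.ne']
        · rw [hAdef]
          gcongr ?_ ^ _
          exact lintegral_mono_ae hVf
  rw [hprod]
  refine hL.trans ?_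
  have hM : (lam univ) ^ (1 / q) ≠ ⊤ :=
    ENNReal.rpow_ne_top_of_nonneg (by positivity) (measure_ne_top _ _)
  have ht : Filter.Tendsto (fun ε : ℝ≥0∞ => ((∫⁻ x, N x ^ q ∂lam) ^ (1 / q) +
      (ε * (lam univ) ^ (1 / q))) * A) (nhdsWithin 0 (Ioi 0))
      (nhds (((∫⁻ x, N x ^ q ∂lam) ^ (1 / q) + (0 * (lam univ) ^ (1 / q))) * A)) := by
    refine Filter.Tendsto.mono_left ?_ nhdsWithin_le_nhds
    refine ENNReal.Tendsto.mul_const ?_ (Or.inr hAt)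
    refine Filter.Tendsto.add tendsto_const_nhds ?_
    exact ENNReal.Tendsto.mul_const Filter.tendsto_id (Or.inr hM)
  rw [zero_mul, add_zero] at ht
  refine ge_of_tendsto ht ?_
  have : ∀ᶠ ε : ℝ≥0∞ in nhdsWithin 0 (Ioi 0), ε < 1 :=
    mem_nhdsWithin_of_mem_nhds (Iio_mem_nhds (by norm_num))
  filter_upwards [this, self_mem_nhdsWithin] with ε h1 h2
  exact key ε (ne_of_gt h2) (ne_top_of_lt h1)

end

section
lemma extend_functional {V E : Type*} [AddCommGroup V] [Module ℂ V] [NormedAddCommGroup E]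
    [NormedSpace ℂ E] (L1 : V →ₗ[ℂ] E) (L2 : V →ₗ[ℂ] ℂ) (A : ℝ) (hA : 0 ≤ A)
    (h : ∀ v, ‖L2 v‖ ≤ A * ‖L1 v‖) :
    ∃ Λ : StrongDual ℂ E, ‖Λ‖ ≤ A ∧ ∀ v, Λ (L1 v) = L2 v := by
  obtain ⟨r, hr⟩ := L1.rangeRestrict.exists_rightInverse_of_surjective L1.range_rangeRestrict
  have hr' : ∀ y : LinearMap.range L1, L1 (r y) = y := by
    intro y
    have := congrArg (fun g => (g y : LinearMap.range L1).1) hr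
    simpa using this
  let Λ0 : StrongDual ℂ (LinearMap.range L1) := (L2.comp r).mkContinuous A (by
    intro y
    have := h (r y)
    rw [hr' y] at this
    simpa using this)
  obtain ⟨Λ, h1, h2⟩ := exists_extension_norm_eq (LinearMap.range L1) Λ0
  refine ⟨Λ, ?_, ?_⟩
  · rw [h2]; exact LinearMap.mkContinuous_norm_le _ hA _
  · intro v
    have e : Λ (L1 v) = L2 (r ⟨L1 v, ⟨v, rfl⟩⟩) := h1 ⟨L1 v, ⟨v, rfl⟩⟩
    rw [e]
    have := h (r ⟨L1 v, ⟨v, rfl⟩⟩ - v)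
    rw [map_sub L1, hr'] at this
    simp only [sub_self, norm_zero, mul_zero, norm_le_zero_iff, map_sub, sub_eq_zero] at this
    exact this

/-- Riesz representation on a finite measure space for `q ≤ 2`. -/
lemma riesz_finite {Z : Type*} [MeasurableSpace Z] (μ : Measure Z) [IsFiniteMeasure μ]
    {p q : ℝ} (hpq : p.HolderConjugate q) (hq2 : q ≤ 2) [Fact (1 ≤ ENNReal.ofReal q)]
    (Λ : StrongDual ℂ (Lp ℂ (ENNReal.ofReal q) μ)) :
    ∃ F : Z → ℂ, StronglyMeasurable F ∧ MemLp F 2 μ ∧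
      (∫⁻ z, ‖F z‖ₑ ^ p ∂μ) ^ (1 / p) ≤ ENNReal.ofReal ‖Λ‖ ∧
      ∀ (g : Z → ℂ) (_ : MemLp g 2 μ) (hg : MemLp g (ENNReal.ofReal q) μ),
        Λ (hg.toLp g) = ∫ z, g z * F z ∂μ := by
  have hq0 : 0 < q := hpq.symm.pos
  have hp0 : 0 < p := hpq.pos
  have hp1 : 1 < p := hpq.lt
  have hqE : ENNReal.ofReal q ≤ 2 := by
    calc ENNReal.ofReal q ≤ ENNReal.ofReal 2 := ENNReal.ofReal_le_ofReal hq2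
      _ = 2 := by simp
  have hqE0 : ENNReal.ofReal q ≠ 0 := by simpa using hq0
  let inc : Lp ℂ 2 μ →ₗ[ℂ] Lp ℂ (ENNReal.ofReal q) μ :=
    { toFun := fun g => ((Lp.memLp g).mono_exponent hqE).toLp g
      map_add' := by
        intro g h
        rw [← MemLp.toLp_add]
        exact MemLp.toLp_congr _ _ (Lp.coeFn_add g h)
      map_smul' := by
        intro c g
        rw [RingHom.id_apply, ← MemLp.toLp_const_smul]
        exact MemLp.toLp_congr _ _ (Lp.coeFn_smul c g) }
  let Mconst : ℝ := (μ univ ^ (1 / q - 1 / 2)).toReal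
  have hexp : 0 ≤ 1 / q - 1 / 2 := by
    have := one_div_le_one_div_of_le hq0 hq2
    linarith
  have hinc : ∀ g, ‖inc g‖ ≤ Mconst * ‖g‖ := by
    intro g
    change ‖((Lp.memLp g).mono_exponent hqE).toLp g‖ ≤ _
    rw [Lp.norm_toLp, Lp.norm_def, mul_comm, ← ENNReal.toReal_mul]
    apply ENNReal.toReal_mono
    · refine ENNReal.mul_ne_top (Lp.memLp g).2.ne
        (ENNReal.rpow_ne_top_of_nonneg hexp (measure_ne_top _ _))
    · have := eLpNorm_le_eLpNorm_mul_rpow_measure_univ (μ := μ) hqE (Lp.memLp g).1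
      simpa [ENNReal.toReal_ofReal hq0.le] using this
  let Λ2 : StrongDual ℂ (Lp ℂ 2 μ) := Λ.comp (inc.mkContinuous Mconst hinc)
  let F0 := (InnerProductSpace.toDual ℂ (Lp ℂ 2 μ)).symm Λ2
  have hF0 : ∀ g : Lp ℂ 2 μ, Λ2 g = ∫ z, g z * star (F0 z) ∂μ := by
    intro g
    rw [← InnerProductSpace.toDual_symm_apply (y := Λ2), L2.inner_def]
    rfl
  obtain ⟨F, hFm, hFe⟩ : ∃ F : Z → ℂ, StronglyMeasurable F ∧ (fun z => star (F0 z)) =ᵐ[μ] F :=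
    (Lp.memLp F0).1.star
  have hF2 : MemLp F 2 μ := by
    have : MemLp (fun z => star (F0 z)) 2 μ := (Lp.memLp F0).star
    exact this.ae_eq hFe
  have hrep : ∀ (g : Z → ℂ) (_ : MemLp g 2 μ) (hg : MemLp g (ENNReal.ofReal q) μ),
        Λ (hg.toLp g) = ∫ z, g z * F z ∂μ := by
    intro g hg2 hg
    have h1 := hF0 (hg2.toLp g)
    have h2 : Λ2 (hg2.toLp g) = Λ (hg.toLp g) := by
      change Λ (((Lp.memLp (hg2.toLp g)).mono_exponent hqE).toLp _) = _
      congr 1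
      exact MemLp.toLp_congr _ _ hg2.coeFn_toLp
    rw [← h2, h1]
    apply integral_congr_ae
    filter_upwards [hg2.coeFn_toLp, hFe] with z h3 h4
    rw [h3, ← h4]
  refine ⟨F, hFm, hF2, ?_, hrep⟩
  -- norm bound
  set A := ENNReal.ofReal ‖Λ‖
  have hbd : ∀ n : ℕ, ∫⁻ z in {z | ‖F z‖ ≤ n}, ‖F z‖ₑ ^ p ∂μ ≤ A ^ p := by
    intro n
    set S := {z | ‖F z‖ ≤ n}
    have hS : MeasurableSet S := hFm.measurable.norm measurableSet_Iic
    set g : Z → ℂ := S.indicator (fun z => ((‖F z‖ ^ (p - 2) : ℝ) : ℂ) * star (F z)) with hgdef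
    have hgm : Measurable g := by
      refine Measurable.indicator ?_ hS
      refine Measurable.mul ?_ ?_
      · exact Complex.measurable_ofReal.comp (hFm.measurable.norm.pow_const _)
      · exact (continuous_star.measurable).comp hFm.measurable
    have hgn : ∀ z ∈ S, ‖g z‖ₑ = ‖F z‖ₑ ^ (p - 1) := by
      intro z hz
      rw [hgdef, indicator_of_mem hz]
      by_cases h0 : F z = 0
      · simp [h0, hp1]
      · have hpos : 0 < ‖F z‖ := norm_pos_iff.2 h0
        have hst : ‖star (F z)‖ₑ = ‖F z‖ₑ := by rw [← ofReal_norm, ← ofReal_norm, norm_star]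
        rw [enorm_mul, hst]
        have : ‖((‖F z‖ ^ (p - 2) : ℝ) : ℂ)‖ₑ = ‖F z‖ₑ ^ (p - 2) := by
          rw [← ofReal_norm, ← ofReal_norm (F z), Complex.norm_real,
            Real.norm_of_nonneg (by positivity), ENNReal.ofReal_rpow_of_pos hpos]
        rw [this]
        nth_rewrite 2 [← ENNReal.rpow_one ‖F z‖ₑ]
        rw [← ENNReal.rpow_add _ _ (by simpa using h0) (by simp)]
        congr 1; ring
    have hg0 : ∀ z, z ∉ S → g z = 0 := fun z hz => indicator_of_notMem hz _
    have hgb : ∀ z, ‖g z‖ ≤ (n : ℝ) ^ (p - 1) := by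
      intro z
      by_cases hz : z ∈ S
      · have h1 := hgn z hz
        rw [← ofReal_norm, ← ofReal_norm,
          ENNReal.ofReal_rpow_of_nonneg (norm_nonneg _) (by linarith),
          ENNReal.ofReal_eq_ofReal_iff (norm_nonneg _) (by positivity)] at h1
        rw [h1]
        exact Real.rpow_le_rpow (norm_nonneg _) hz (by linarith)
      · rw [hg0 z hz, norm_zero]; positivity
    have hgL : ∀ r : ℝ≥0∞, MemLp g r μ := fun r =>
      MemLp.of_bound hgm.aestronglyMeasurable _ (Filter.Eventually.of_forall hgb)
    have h1 := hrep g (hgL 2) (hgL _)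
    have hqp : (p - 1) * q = p := by
      have := hpq.sub_one_mul_conj; linarith
    set I := ∫⁻ z in S, ‖F z‖ₑ ^ p ∂μ with hI
    have hIfin : I ≠ ⊤ := by
      have : I ≤ ∫⁻ z in S, ENNReal.ofReal ((n : ℝ) ^ p) ∂μ := by
        refine setLIntegral_mono measurable_const fun z hz => ?_
        rw [← ofReal_norm, ENNReal.ofReal_rpow_of_nonneg (norm_nonneg _) hp0.le]
        exact ENNReal.ofReal_le_ofReal (Real.rpow_le_rpow (norm_nonneg _) hz hp0.le)
      refine ne_top_of_le_ne_top ?_ this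
      rw [setLIntegral_const]
      exact ENNReal.mul_ne_top (by simp) (measure_ne_top _ _)
    have hleft : ‖∫ z, g z * F z ∂μ‖ₑ = I := by
      have e : (fun z => g z * F z) = fun z => ((S.indicator (fun z => ‖F z‖ ^ p) z : ℝ) : ℂ) := by
        ext z
        by_cases hz : z ∈ S
        · rw [hgdef, indicator_of_mem hz, indicator_of_mem hz, mul_assoc]
          by_cases h0 : F z = 0
          · simp [h0, hp0.ne']
          have : star (F z) * F z = ((‖F z‖ ^ (2 : ℝ) : ℝ) : ℂ) := by
            rw [mul_comm]
            have := Complex.mul_conj (F z)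
            rw [Complex.normSq_eq_norm_sq] at this
            simpa using this
          rw [this, ← Complex.ofReal_mul, ← Real.rpow_add (norm_pos_iff.2 h0)]
          congr 2; ring
        · rw [hg0 z hz, indicator_of_notMem hz]; simp
      rw [e]
      have e2 : ∫ z, ((S.indicator (fun z => ‖F z‖ ^ p) z : ℝ) : ℂ) ∂μ =
        ((∫ z, S.indicator (fun z => ‖F z‖ ^ p) z ∂μ : ℝ) : ℂ) := integral_ofReal
      rw [e2, ← ofReal_norm, Complex.norm_real, Real.norm_of_nonneg
        (integral_nonneg fun z => indicator_nonneg (fun _ _ => by positivity) _),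
        integral_indicator hS, ofReal_integral_eq_lintegral_ofReal]
      · apply lintegral_congr
        intro z
        rw [← ofReal_norm, ENNReal.ofReal_rpow_of_nonneg (norm_nonneg _) hp0.le]
      · refine Measure.integrableOn_of_bounded (M := (n : ℝ) ^ p) (measure_ne_top _ _)
          (hFm.measurable.norm.pow_const _).aestronglyMeasurable ?_
        refine (ae_restrict_mem hS).mono fun z hz => ?_
        rw [Real.norm_of_nonneg (by positivity)]
        exact Real.rpow_le_rpow (norm_nonneg _) hz hp0.le
      · exact Filter.Eventually.of_forall fun z => by positivity
    have hright : eLpNorm g (ENNReal.ofReal q) μ = I ^ (1 / q) := by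
      rw [eLpNorm_eq_lintegral_rpow_enorm_toReal hqE0 (by simp), ENNReal.toReal_ofReal hq0.le]
      congr 1
      rw [hI, ← lintegral_indicator hS]
      apply lintegral_congr
      intro z
      by_cases hz : z ∈ S
      · rw [indicator_of_mem hz, hgn z hz, ← ENNReal.rpow_mul, hqp]
      · rw [indicator_of_notMem hz, hg0 z hz]; simp [hq0]
    have hmain : I ≤ A * I ^ (1 / q) := by
      rw [← hright]
      nth_rewrite 1 [← hleft]
      rw [← h1, ← ofReal_norm]
      refine (ENNReal.ofReal_le_ofReal (Λ.le_opNorm _)).trans ?_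
      rw [ENNReal.ofReal_mul (norm_nonneg _), Lp.norm_toLp, ENNReal.ofReal_toReal (hgL _).2.ne]
    by_cases hI0 : I = 0
    · rw [hI0]; exact zero_le
    have hdiv : I ^ (1 / p) ≤ A := by
      have e : I = I ^ (1 / p) * I ^ (1 / q) := by
        rw [← ENNReal.rpow_add _ _ hI0 hIfin]
        have := hpq.inv_add_inv_eq_one
        simp only [one_div, this, ENNReal.rpow_one]
      rw [e] at hmain
      have h3 : (I ^ (1 / p) * I ^ (1 / q)) ^ (1 / q) = I ^ (1 / q) := by rw [← e]
      rw [h3] at hmain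
      refine (ENNReal.mul_le_mul_iff_left ?_ ?_).1 hmain
      · exact (ENNReal.rpow_pos (pos_iff_ne_zero.2 hI0) hIfin).ne'
      · exact ENNReal.rpow_ne_top_of_nonneg (by positivity) hIfin
    calc I = (I ^ (1 / p)) ^ p := by rw [← ENNReal.rpow_mul]; simp [hp0.ne']
      _ ≤ A ^ p := by gcongr
  have hlim : ∫⁻ z, ‖F z‖ₑ ^ p ∂μ ≤ A ^ p := by
    have hmono : Monotone (fun n : ℕ => {z | ‖F z‖ ≤ n}) := by
      intro m n hmn z hz
      exact le_trans (show ‖F z‖ ≤ m from hz) (by exact_mod_cast hmn)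
    have hun : ⋃ n : ℕ, {z | ‖F z‖ ≤ n} = univ := by
      ext z
      simp only [mem_iUnion, mem_ofPred_eq, mem_univ, iff_true]
      exact exists_nat_ge _
    have := setLIntegral_iUnion_of_directed (μ := μ) (fun z => ‖F z‖ₑ ^ p) hmono.directed_le
    rw [hun, setLIntegral_univ] at this
    rw [this]
    exact iSup_le hbd
  calc _ ≤ (A ^ p) ^ (1 / p) := by gcongr
    _ = A := by rw [← ENNReal.rpow_mul]; simp [hp0.ne']

end

section
lemma holder_le_two {p q : ℝ} (hpq : p.HolderConjugate q) (hp : 2 ≤ p) : q ≤ 2 := by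
  have := hpq.inv_add_inv_eq_one
  by_contra h
  push Not at h
  have a1 : p⁻¹ ≤ 2⁻¹ := inv_anti₀ (by norm_num) hp
  have a2 : q⁻¹ < 2⁻¹ := inv_strictAnti₀ (by norm_num) h
  linarith

/-- Replace an arbitrary (possibly non-measurable) `f` by a measurable one. -/
theorem reduction {X Y Q : Type*} [MeasurableSpace X] [MeasurableSpace Y] (lam : Measure X)
    [IsFiniteMeasure lam] (ν : Measure Y) [IsFiniteMeasure ν]
    (κ : Q → X → Y → ℂ) (hk : ∀ i, Measurable (Function.uncurry (κ i)))
    (hkp : ∀ i, MemLp (Function.uncurry (κ i)) 2 (lam.prod ν))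
    (hk2 : ∀ i, ∀ᵐ x ∂lam, MemLp (κ i x) 2 ν)
    (hz : ∀ i, ∀ᵐ x ∂lam, (∀ᵐ y ∂ν, κ i x y = 0) ∨ (∀ᵐ y ∂ν, κ i x y ≠ 0))
    (f : X → Y → ℂ) {p : ℝ} (hp : 2 ≤ p)
    (hA : ∫⁻ x, ∫⁻ y, ‖f x y‖ₑ ^ p ∂ν ∂lam ≠ ⊤) :
    ∃ F : X × Y → ℂ, StronglyMeasurable F ∧ MemLp F 2 (lam.prod ν) ∧
      ∫⁻ z, ‖F z‖ₑ ^ p ∂(lam.prod ν) ≤ ∫⁻ x, ∫⁻ y, ‖f x y‖ₑ ^ p ∂ν ∂lam ∧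
      ∀ i, ∫ x, ∫ y, κ i x y * f x y ∂ν ∂lam = 0 ∨
        ∫ x, ∫ y, κ i x y * f x y ∂ν ∂lam = ∫ z, κ i z.1 z.2 * F z ∂(lam.prod ν) := by
  classical
  have hp0 : 0 < p := by linarith
  obtain ⟨q, hpq⟩ : ∃ q, p.HolderConjugate q :=
    ⟨p.conjExponent, Real.HolderConjugate.conjExponent (by linarith)⟩
  have hq2 := holder_le_two hpq hp
  have hq0 : 0 < q := hpq.symm.pos
  have hq1 : 1 ≤ q := hpq.symm.lt.le
  have hqE : ENNReal.ofReal q ≤ 2 := by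
    calc ENNReal.ofReal q ≤ ENNReal.ofReal 2 := ENNReal.ofReal_le_ofReal hq2
      _ = 2 := by simp
  haveI : Fact (1 ≤ ENNReal.ofReal q) := ⟨by simpa using hq1⟩
  set μ := lam.prod ν
  let G : Set Q := {i | Integrable (fun x => ∫ y, κ i x y * f x y ∂ν) lam}
  have hkq : ∀ i, MemLp (Function.uncurry (κ i)) (ENNReal.ofReal q) μ :=
    fun i => (hkp i).mono_exponent hqE
  let L1 : (G →₀ ℂ) →ₗ[ℂ] Lp ℂ (ENNReal.ofReal q) μ :=
    Finsupp.linearCombination ℂ (fun i : G => (hkq i).toLp (Function.uncurry (κ i)))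
  let L2 : (G →₀ ℂ) →ₗ[ℂ] ℂ :=
    Finsupp.linearCombination ℂ (fun i : G => ∫ x, ∫ y, κ i x y * f x y ∂ν ∂lam)
  set A := (∫⁻ x, ∫⁻ y, ‖f x y‖ₑ ^ p ∂ν ∂lam) ^ (1 / p) with hAdef
  have hAt : A ≠ ⊤ := ENNReal.rpow_ne_top_of_nonneg (by positivity) hA
  have hsumLp : ∀ (s : Finset G) (c : G → ℂ),
      MemLp (fun z : X × Y => ∑ i ∈ s, c i * κ i z.1 z.2) (ENNReal.ofReal q) μ := by
    intro s c
    exact memLp_finsetSum s (fun i _ => (hkq i).const_mul (c i))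
  have htoLp : ∀ (s : Finset G) (c : G → ℂ),
      ∑ i ∈ s, c i • (hkq i).toLp (Function.uncurry (κ i)) = (hsumLp s c).toLp _ := by
    intro s c
    induction s using Finset.induction_on with
    | empty =>
      simp only [Finset.sum_empty]
      symm
      exact MemLp.toLp_zero _
    | insert a s ha ih =>
      rw [Finset.sum_insert ha, ih, ← MemLp.toLp_const_smul, ← MemLp.toLp_add]
      apply MemLp.toLp_congr
      refine Filter.Eventually.of_forall fun z => ?_
      simp [Finset.sum_insert ha, Function.uncurry]
  have hbound : ∀ v, ‖L2 v‖ ≤ A.toReal * ‖L1 v‖ := by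
    intro v
    have h1 : L2 v = ∑ i ∈ v.support, v i * ∫ x, ∫ y, κ i x y * f x y ∂ν ∂lam := by
      simp [L2, Finsupp.linearCombination_apply, Finsupp.sum]
    have h2 : L1 v = (hsumLp v.support v).toLp _ := by
      rw [← htoLp]
      simp [L1, Finsupp.linearCombination_apply, Finsupp.sum]
    have := functional_bound lam ν v.support (fun i : G => κ i) (fun i => hk i) (fun i => hk2 i)
      (fun i => hz i) f v (fun i _ => i.2) hpq hp hA
    rw [← h1] at this
    rw [h2, Lp.norm_toLp, ← toReal_enorm, ← ENNReal.toReal_mul, mul_comm]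
    refine ENNReal.toReal_mono (ENNReal.mul_ne_top (hsumLp _ _).2.ne hAt) ?_
    rw [eLpNorm_eq_lintegral_rpow_enorm_toReal (by simpa using hq0) (by simp),
      ENNReal.toReal_ofReal hq0.le]
    exact this
  obtain ⟨Λ, hΛ, hΛ2⟩ := extend_functional L1 L2 A.toReal ENNReal.toReal_nonneg hbound
  obtain ⟨F, hF, hF2, hFp, hrep⟩ := riesz_finite μ hpq hq2 Λ
  refine ⟨F, hF, hF2, ?_, ?_⟩
  · have h1 : (∫⁻ z, ‖F z‖ₑ ^ p ∂μ) ^ (1 / p) ≤ A := by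
      refine hFp.trans ?_
      calc ENNReal.ofReal ‖Λ‖ ≤ ENNReal.ofReal A.toReal := ENNReal.ofReal_le_ofReal hΛ
        _ = A := ENNReal.ofReal_toReal hAt
    rw [hAdef] at h1
    exact (ENNReal.rpow_le_rpow_iff (by positivity)).1 h1
  · intro i
    by_cases hi : i ∈ G
    · right
      have h1 := hΛ2 (Finsupp.single ⟨i, hi⟩ 1)
      simp only [L1, L2, Finsupp.linearCombination_single, one_smul] at h1
      rw [hrep _ (hkp i)] at h1
      exact h1.symm
    · left
      exact integral_undef hi

end

section
noncomputable abbrev nuC : Measure ℝ := volume.restrict (Ico 0 (2 * π))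

lemma nuC_eq : nuC = volume.restrict (Ioc 0 (2 * π)) := Measure.restrict_congr_set Ico_ae_eq_Ioc

lemma per_base (h : ℝ → ℝ≥0∞) (hp : ∀ x, h (x + 2 * π) = h x) (t : ℝ) :
    ∫⁻ x in Ioc t (t + 2 * π), h x = ∫⁻ x, h x ∂nuC := by
  rw [nuC_eq]
  have h2 : (0:ℝ) < 2 * π := by positivity
  have := (isAddFundamentalDomain_Ioc h2 t).setLIntegral_eq (isAddFundamentalDomain_Ioc h2 0) h ?_
  · simpa using this
  · rintro ⟨g, hg⟩ x
    obtain ⟨n, rfl⟩ := AddSubgroup.mem_zmultiples_iff.1 hg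
    have hP : Function.Periodic h (2 * π) := hp
    have := hP.zsmul n x
    rw [add_comm] at this
    simpa [AddSubgroup.vadd_def] using this

lemma per_sub_right (h : ℝ → ℝ≥0∞) (hp : ∀ x, h (x + 2 * π) = h x) (t : ℝ) :
    ∫⁻ x, h (x - t) ∂nuC = ∫⁻ x, h x ∂nuC := by
  rw [← per_base h hp (-t), nuC_eq]
  have h1 := (measurePreserving_sub_right (volume : Measure ℝ) t).setLIntegral_comp_preimage_emb
    (MeasurableEquiv.subRight t).measurableEmbedding h (Ioc (-t) (-t + 2 * π))
  rw [← h1]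
  congr 2
  ext x
  simp only [mem_Ioc, mem_preimage]
  constructor <;> rintro ⟨a, b⟩ <;> constructor <;> linarith

lemma per_sub_left (h : ℝ → ℝ≥0∞) (hp : ∀ x, h (x + 2 * π) = h x) (t : ℝ) :
    ∫⁻ x, h (t - x) ∂nuC = ∫⁻ x, h x ∂nuC := by
  have h1 := (Measure.measurePreserving_sub_left (volume : Measure ℝ) t).setLIntegral_comp_preimage_emb
    (MeasurableEquiv.subLeft t).measurableEmbedding h (Ioc (t - 2 * π) (t - 2 * π + 2 * π))
  rw [← per_base h hp (t - 2 * π), ← h1]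
  have : Ico 0 (2 * π) = (fun x => t - x) ⁻¹' Ioc (t - 2 * π) (t - 2 * π + 2 * π) := ?_
  · rw [← this]
  ext x
  simp only [mem_Ioc, mem_Ico, mem_preimage]
  constructor <;> rintro ⟨a, b⟩ <;> constructor <;> linarith

lemma per_int_sub_right (h : ℝ → ℂ) (hp : ∀ x, h (x + 2 * π) = h x) (t : ℝ) :
    ∫ x, h (x - t) ∂nuC = ∫ x, h x ∂nuC := by
  rw [nuC_eq]
  have h2 : (0:ℝ) ≤ 2 * π := by positivity
  rw [← intervalIntegral.integral_of_le h2, ← intervalIntegral.integral_of_le h2,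
    intervalIntegral.integral_comp_sub_right]
  have hP : Function.Periodic h (2 * π) := hp
  have := hP.intervalIntegral_add_eq (0 - t) 0
  rw [show 0 - t + 2 * π = 2 * π - t by ring, zero_add] at this
  exact this

noncomputable def eN (n : ℤ) (θ : ℝ) : ℂ := Complex.exp (-(n * θ * Complex.I))

lemma eN_norm (n : ℤ) (θ : ℝ) : ‖eN n θ‖ = 1 := by
  have : eN n θ = Complex.exp (((-(n * θ) : ℝ) : ℂ) * Complex.I) := by
    unfold eN; congr 1; push_cast; ring
  rw [this, Complex.norm_exp_ofReal_mul_I]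

lemma eN_add (n : ℤ) (x y : ℝ) : eN n (x + y) = eN n x * eN n y := by
  unfold eN; rw [← Complex.exp_add]; congr 1; push_cast; ring

lemma eN_per (n : ℤ) (x : ℝ) : eN n (x + 2 * π) = eN n x := by
  rw [eN_add]
  have : eN n (2 * π) = 1 := by
    unfold eN
    rw [Complex.exp_eq_one_iff]
    exact ⟨-n, by push_cast; ring⟩
  rw [this, mul_one]

lemma eN_cont (n : ℤ) : Continuous (eN n) := by unfold eN; fun_prop

lemma parseval (h : ℝ → ℂ) (hh : MemLp h 2 nuC) :
    ∑' n : ℤ, ‖∫ x, eN n x * h x ∂nuC‖ₑ ^ 2 = ENNReal.ofReal (2 * π) * ∫⁻ x, ‖h x‖ₑ ^ 2 ∂nuC := by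
  have h2 : (0:ℝ) < 2 * π := by positivity
  have hI : ∫⁻ x, ‖h x‖ₑ ^ 2 ∂nuC = ENNReal.ofReal (∫ x, ‖h x‖ ^ 2 ∂nuC) := by
    have := hh.integrable_norm_pow (by norm_num)
    rw [ofReal_integral_eq_lintegral_ofReal (by simpa using this) (ae_of_all _ fun x => by positivity)]
    refine lintegral_congr fun x => ?_
    rw [ENNReal.ofReal_pow (norm_nonneg _), ofReal_norm]
  rw [nuC_eq] at hh
  have hs := hasSum_sq_fourierCoeffOn h2 hh
  have hc : ∀ n : ℤ, ∫ x, eN n x * h x ∂nuC = (2 * π : ℝ) • fourierCoeffOn h2 h n := by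
    intro n
    rw [fourierCoeffOn_eq_integral, smul_smul, nuC_eq]
    have : 2 * π * (1 / (2 * π - 0)) = 1 := by field_simp; ring
    rw [this, one_smul, intervalIntegral.integral_of_le h2.le]
    refine integral_congr_ae (ae_of_all _ fun x => ?_)
    simp only [smul_eq_mul, fourier_coe_apply]
    congr 1
    unfold eN
    congr 1
    push_cast
    have : (π : ℂ) ≠ 0 := by exact_mod_cast pi_ne_zero
    field_simp
    ring
  have hs2 : HasSum (fun n : ℤ => ‖∫ x, eN n x * h x ∂nuC‖ ^ 2) (2 * π * ∫ x, ‖h x‖ ^ 2 ∂nuC) := by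
    have := hs.mul_left ((2 * π) ^ 2)
    have e1 : (fun n : ℤ => ‖∫ x, eN n x * h x ∂nuC‖ ^ 2) = fun i => (2 * π) ^ 2 * ‖fourierCoeffOn h2 h i‖ ^ 2 := ?_
    have e2 : 2 * π * ∫ (x : ℝ), ‖h x‖ ^ 2 ∂nuC = (2 * π) ^ 2 * (2 * π - 0)⁻¹ • ∫ (x : ℝ) in 0..2 * π, ‖h x‖ ^ 2 := ?_
    · rw [e1, e2]; exact this
    rotate_left
    · funext n; rw [hc, norm_smul, mul_pow]; simp [abs_of_pos pi_pos]
    · rw [intervalIntegral.integral_of_le h2.le, nuC_eq, smul_eq_mul, sub_zero]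
      field_simp
  rw [hI, ← ENNReal.ofReal_mul h2.le, ← hs2.tsum_eq, ENNReal.ofReal_tsum_of_nonneg (fun n => by positivity) hs2.summable]
  refine tsum_congr fun n => ?_
  rw [ENNReal.ofReal_pow (norm_nonneg _), ofReal_norm]

end

section
lemma cs_enn {X : Type*} [MeasurableSpace X] (μ : Measure X) (f g : X → ℝ≥0∞)
    (hf : AEMeasurable f μ) (hg : AEMeasurable g μ) :
    (∫⁻ x, f x * g x ∂μ) ^ 2 ≤ (∫⁻ x, f x ^ 2 ∂μ) * ∫⁻ x, g x ^ 2 ∂μ := by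
  have h := ENNReal.lintegral_mul_le_Lp_mul_Lq μ (Real.HolderConjugate.two_two) hf hg
  simp only [Pi.mul_apply, ENNReal.rpow_two] at h
  have e : ∀ t : ℝ≥0∞, (t ^ (1 / 2 : ℝ)) ^ 2 = t := by
    intro t
    rw [← ENNReal.rpow_two, ← ENNReal.rpow_mul]; norm_num
  calc _ ≤ ((∫⁻ x, f x ^ 2 ∂μ) ^ (1 / 2 : ℝ) * (∫⁻ x, g x ^ 2 ∂μ) ^ (1 / 2 : ℝ)) ^ 2 := by gcongr
    _ = _ := by rw [mul_pow, e, e]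

lemma memLp_two_of_lintegral {X : Type*} [MeasurableSpace X] {μ : Measure X} {f : X → ℂ}
    (hf : AEStronglyMeasurable f μ) (h : ∫⁻ x, ‖f x‖ₑ ^ 2 ∂μ ≠ ⊤) : MemLp f 2 μ := by
  refine ⟨hf, ?_⟩
  rw [eLpNorm_lt_top_iff_lintegral_rpow_enorm_lt_top (by norm_num) (by norm_num)]
  simpa using h.lt_top

lemma lintegral_of_memLp_two {X : Type*} [MeasurableSpace X] {μ : Measure X} {f : X → ℂ}
    (h : MemLp f 2 μ) : ∫⁻ x, ‖f x‖ₑ ^ 2 ∂μ ≠ ⊤ := by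
  have := h.2
  rw [eLpNorm_lt_top_iff_lintegral_rpow_enorm_lt_top (by norm_num) (by norm_num)] at this
  simpa using this.ne

section
variable {X : Type*} [MeasurableSpace X] (lam : Measure X) [IsFiniteMeasure lam]
    (k : X → ℝ → ℂ)

lemma shift_sq (hk : Measurable (Function.uncurry k)) (hper : ∀ x φ, k x (φ + 2 * π) = k x φ) (θ : ℝ) :
    ∫⁻ z, ‖k z.1 (θ - z.2)‖ₑ ^ 2 ∂(lam.prod nuC) = ∫⁻ z, ‖k z.1 z.2‖ₑ ^ 2 ∂(lam.prod nuC) := by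
  have m1 : Measurable fun z : X × ℝ => k z.1 (θ - z.2) :=
    hk.comp (by fun_prop : Measurable fun z : X × ℝ => (z.1, θ - z.2))
  have m2 : Measurable fun z : X × ℝ => k z.1 z.2 := hk
  rw [lintegral_prod _ (by fun_prop), lintegral_prod _ (by fun_prop)]
  refine lintegral_congr fun x => ?_
  exact per_sub_left (fun y => ‖k x y‖ₑ ^ 2) (fun y => by simp [hper]) θ

lemma conv_sq_le (hk : Measurable (Function.uncurry k)) (hper : ∀ x φ, k x (φ + 2 * π) = k x φ)
    (F : X × ℝ → ℂ) (hF : StronglyMeasurable F) (θ : ℝ) :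
    (∫⁻ z, ‖k z.1 (θ - z.2) * F z‖ₑ ∂(lam.prod nuC)) ^ 2 ≤
      (∫⁻ z, ‖k z.1 z.2‖ₑ ^ 2 ∂(lam.prod nuC)) * ∫⁻ z, ‖F z‖ₑ ^ 2 ∂(lam.prod nuC) := by
  have m1 : Measurable fun z : X × ℝ => k z.1 (θ - z.2) :=
    hk.comp (by fun_prop : Measurable fun z : X × ℝ => (z.1, θ - z.2))
  rw [← shift_sq lam k hk hper θ]
  simp_rw [enorm_mul]
  exact cs_enn _ _ _ (by fun_prop) hF.enorm.aemeasurable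

theorem l2_lemma (hk : Measurable (Function.uncurry k)) (hper : ∀ x φ, k x (φ + 2 * π) = k x φ)
    (hk2 : MemLp (Function.uncurry k) 2 (lam.prod nuC))
    (B : X → ℝ≥0∞) (hB : Measurable B) (hkB : ∀ n : ℤ, ∀ x, ‖∫ φ, eN n φ * k x φ ∂nuC‖ₑ ≤ B x)
    (F : X × ℝ → ℂ) (hF : StronglyMeasurable F) (hF2 : MemLp F 2 (lam.prod nuC)) :
    ∫⁻ θ, ‖∫ z, k z.1 (θ - z.2) * F z ∂(lam.prod nuC)‖ₑ ^ 2 ∂nuC ≤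
      (∫⁻ x, B x ^ 2 ∂lam) * ∫⁻ z, ‖F z‖ₑ ^ 2 ∂(lam.prod nuC) := by
  set g : ℝ → ℂ := fun θ => ∫ z, k z.1 (θ - z.2) * F z ∂(lam.prod nuC) with hg
  have hpi : (0:ℝ) < 2 * π := by positivity
  have hm3 : Measurable fun q : ℝ × (X × ℝ) => k q.2.1 (q.1 - q.2.2) :=
    hk.comp (by fun_prop : Measurable fun q : ℝ × (X × ℝ) => (q.2.1, q.1 - q.2.2))
  have hsm : StronglyMeasurable fun q : ℝ × (X × ℝ) => k q.2.1 (q.1 - q.2.2) * F q.2 :=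
    hm3.stronglyMeasurable.mul (hF.comp_measurable measurable_snd)
  have hgm : StronglyMeasurable g := hsm.integral_prod_right (f := fun θ z => k z.1 (θ - z.2) * F z)
  set D : ℝ≥0∞ := (∫⁻ z, ‖k z.1 z.2‖ₑ ^ 2 ∂(lam.prod nuC)) * ∫⁻ z, ‖F z‖ₑ ^ 2 ∂(lam.prod nuC) with hD
  have hDt : D ≠ ⊤ := ENNReal.mul_ne_top (lintegral_of_memLp_two hk2) (lintegral_of_memLp_two hF2)
  have hgb : ∀ θ, ‖g θ‖ₑ ^ 2 ≤ D := fun θ => by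
    refine le_trans ?_ (conv_sq_le lam k hk hper F hF θ)
    gcongr
    exact enorm_integral_le_lintegral_enorm _
  have hg2 : MemLp g 2 nuC := by
    refine memLp_two_of_lintegral hgm.aestronglyMeasurable ?_
    refine ne_top_of_le_ne_top ?_ (lintegral_mono hgb)
    rw [lintegral_const]
    exact ENNReal.mul_ne_top hDt (measure_ne_top _ _)
  -- Fourier coefficients
  set Fh : ℤ → X → ℂ := fun n x => ∫ y, eN n y * F (x, y) ∂nuC with hFh
  set kh : ℤ → X → ℂ := fun n x => ∫ y, eN n y * k x y ∂nuC with hkh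
  have hIntg : ∀ n : ℤ, Integrable (Function.uncurry fun (θ : ℝ) (z : X × ℝ) => eN n θ * (k z.1 (θ - z.2) * F z))
      (nuC.prod (lam.prod nuC)) := by
    intro n
    have hsm' : StronglyMeasurable (Function.uncurry fun (θ : ℝ) (z : X × ℝ) => eN n θ * (k z.1 (θ - z.2) * F z)) :=
      ((eN_cont n).stronglyMeasurable.comp_measurable measurable_fst).mul hsm
    refine ⟨hsm'.aestronglyMeasurable, ?_⟩
    rw [hasFiniteIntegral_iff_enorm, lintegral_prod _ hsm'.enorm.aemeasurable]
    have hb : ∀ θ, ∫⁻ z, ‖eN n θ * (k z.1 (θ - z.2) * F z)‖ₑ ∂(lam.prod nuC) ≤ D + 1 := by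
      intro θ
      have := conv_sq_le lam k hk hper F hF θ
      have e : ∀ z : X × ℝ, ‖eN n θ * (k z.1 (θ - z.2) * F z)‖ₑ = ‖k z.1 (θ - z.2) * F z‖ₑ := by
        intro z
        rw [enorm_mul, ← ofReal_norm (eN n θ), eN_norm]; simp
      simp_rw [e]
      set A := ∫⁻ z, ‖k z.1 (θ - z.2) * F z‖ₑ ∂(lam.prod nuC)
      rcases le_total A 1 with h1 | h1
      · exact h1.trans le_add_self
      · calc A = A * 1 := (mul_one _).symm
          _ ≤ A * A := by gcongr
          _ = A ^ 2 := (sq A).symm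
          _ ≤ D := this
          _ ≤ D + 1 := le_self_add
    refine lt_of_le_of_lt (lintegral_mono hb) ?_
    rw [lintegral_const]
    exact ENNReal.mul_lt_top (by simp [hDt.lt_top]) (measure_lt_top _ _)
  have hcoef : ∀ n : ℤ, ∫ θ, eN n θ * g θ ∂nuC = ∫ x, kh n x * Fh n x ∂lam := by
    intro n
    have h1 : ∫ θ, eN n θ * g θ ∂nuC
        = ∫ θ, ∫ z, eN n θ * (k z.1 (θ - z.2) * F z) ∂(lam.prod nuC) ∂nuC := by
      refine integral_congr_ae (ae_of_all _ fun θ => ?_)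
      simp only [hg, integral_const_mul]
    rw [h1, integral_integral_swap (hIntg n)]
    have h2 : ∀ z : X × ℝ, ∫ θ, eN n θ * (k z.1 (θ - z.2) * F z) ∂nuC
        = kh n z.1 * (eN n z.2 * F z) := by
      intro z
      have e : ∀ θ, eN n θ * (k z.1 (θ - z.2) * F z)
          = (fun u => eN n u * k z.1 u) (θ - z.2) * (eN n z.2 * F z) := by
        intro θ
        have : eN n θ = eN n (θ - z.2) * eN n z.2 := by rw [← eN_add]; simp
        rw [this]; ring
      simp_rw [e]
      rw [integral_mul_const, per_int_sub_right (fun u => eN n u * k z.1 u) (fun x => by simp [eN_per, hper])]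
    have h3 := (hIntg n).integral_prod_right
    simp only [Function.uncurry_apply_pair] at h3
    simp_rw [h2] at h3 ⊢
    rw [integral_prod _ h3]
    refine integral_congr_ae (ae_of_all _ fun x => ?_)
    simp only
    rw [integral_const_mul]
  have hkm : ∀ n, StronglyMeasurable (kh n) := by
    intro n
    have : StronglyMeasurable (Function.uncurry fun x y => eN n y * k x y) :=
      ((eN_cont n).stronglyMeasurable.comp_measurable measurable_snd).mul hk.stronglyMeasurable
    exact this.integral_prod_right
  have hFm : ∀ n, StronglyMeasurable (Fh n) := by
    intro n
    have : StronglyMeasurable (Function.uncurry fun x y => eN n y * F (x, y)) :=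
      ((eN_cont n).stronglyMeasurable.comp_measurable measurable_snd).mul hF
    exact this.integral_prod_right
  have hbn : ∀ n, ‖∫ θ, eN n θ * g θ ∂nuC‖ₑ ^ 2 ≤ (∫⁻ x, B x ^ 2 ∂lam) * ∫⁻ x, ‖Fh n x‖ₑ ^ 2 ∂lam := by
    intro n
    rw [hcoef]
    refine le_trans ?_ (cs_enn lam B _ hB.aemeasurable (hFm n).enorm.aemeasurable)
    gcongr
    refine (enorm_integral_le_lintegral_enorm _).trans (lintegral_mono fun x => ?_)
    rw [enorm_mul]
    gcongr
    exact hkB n x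
  have hFsl : ∀ᵐ x ∂lam, ∑' n : ℤ, ‖Fh n x‖ₑ ^ 2 = ENNReal.ofReal (2 * π) * ∫⁻ y, ‖F (x, y)‖ₑ ^ 2 ∂nuC := by
    have hfin := lintegral_of_memLp_two hF2
    rw [lintegral_prod _ (by exact (hF.enorm.pow_const 2).aemeasurable)] at hfin
    have hsm2 : Measurable fun z : X × ℝ => ‖F z‖ₑ ^ 2 := hF.enorm.pow_const 2
    filter_upwards [ae_lt_top hsm2.lintegral_prod_right' hfin] with x hx
    exact parseval _ (memLp_two_of_lintegral (hF.comp_measurable measurable_prodMk_left).aestronglyMeasurable hx.ne)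
  have hP := parseval g hg2
  have hc0 : ENNReal.ofReal (2 * π) ≠ 0 := by simp [pi_pos]
  rw [← ENNReal.mul_le_mul_iff_right hc0 ENNReal.ofReal_ne_top, ← hP]
  calc ∑' n : ℤ, ‖∫ θ, eN n θ * g θ ∂nuC‖ₑ ^ 2
      ≤ ∑' n : ℤ, (∫⁻ x, B x ^ 2 ∂lam) * ∫⁻ x, ‖Fh n x‖ₑ ^ 2 ∂lam := ENNReal.tsum_le_tsum hbn
    _ = (∫⁻ x, B x ^ 2 ∂lam) * ∫⁻ x, ∑' n : ℤ, ‖Fh n x‖ₑ ^ 2 ∂lam := by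
        rw [ENNReal.tsum_mul_left, lintegral_tsum fun n => ((hFm n).enorm.pow_const 2).aemeasurable]
    _ = (∫⁻ x, B x ^ 2 ∂lam) * ∫⁻ x, ENNReal.ofReal (2 * π) * ∫⁻ y, ‖F (x, y)‖ₑ ^ 2 ∂nuC ∂lam := by
        rw [lintegral_congr_ae hFsl]
    _ = _ := by
        rw [lintegral_const_mul' _ _ ENNReal.ofReal_ne_top, lintegral_prod _ (by exact (hF.enorm.pow_const 2).aemeasurable)]
        ring
end

end

section
theorem lp_lemma {X : Type*} [MeasurableSpace X] (lam : Measure X) [IsFiniteMeasure lam]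
    (k : X → ℝ → ℂ) (M : X → ℝ≥0∞) (hM : Measurable M) (S : ℝ → ℝ≥0∞) (hS : Measurable S)
    (hper : ∀ φ, S (φ + 2 * π) = S φ) (hkM : ∀ x φ, ‖k x φ‖ₑ ≤ M x * S φ)
    {p q : ℝ} (hpq : p.HolderConjugate q) (F : X × ℝ → ℂ) (hF : StronglyMeasurable F) :
    ∫⁻ θ, ‖∫ z, k z.1 (θ - z.2) * F z ∂(lam.prod nuC)‖ₑ ^ p ∂nuC ≤
      (∫⁻ x, M x ^ q ∂lam) ^ (p / q) * (∫⁻ φ, S φ ∂nuC) ^ p * ∫⁻ z, ‖F z‖ₑ ^ p ∂(lam.prod nuC) := by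
  have hp0 := hpq.pos
  have hq0 := hpq.symm.pos
  have hpi := hpq.inv_add_inv_eq_one
  set I := ∫⁻ φ, S φ ∂nuC
  set m := ∫⁻ x, M x ^ q ∂lam
  have hFe : Measurable fun z => ‖F z‖ₑ := hF.enorm
  have hpt : ∀ θ, ‖∫ z, k z.1 (θ - z.2) * F z ∂(lam.prod nuC)‖ₑ ^ p ≤
      (m * I) ^ (p / q) * ∫⁻ z, S (θ - z.2) * ‖F z‖ₑ ^ p ∂(lam.prod nuC) := by
    intro θ
    have hSm : Measurable fun z : X × ℝ => S (θ - z.2) := hS.comp (by fun_prop)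
    have hMm : Measurable fun z : X × ℝ => M z.1 := hM.comp (by fun_prop)
    have h1 : ‖∫ z, k z.1 (θ - z.2) * F z ∂(lam.prod nuC)‖ₑ ≤
        ∫⁻ z, ((fun z : X × ℝ => S (θ - z.2) ^ (1 / p) * ‖F z‖ₑ) * (fun z : X × ℝ => M z.1 * S (θ - z.2) ^ (1 / q))) z ∂(lam.prod nuC) := by
      refine (enorm_integral_le_lintegral_enorm _).trans (lintegral_mono fun z => ?_)
      rw [enorm_mul]
      simp only [Pi.mul_apply]
      have : S (θ - z.2) = S (θ - z.2) ^ (1 / p) * S (θ - z.2) ^ (1 / q) := by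
        rw [← ENNReal.rpow_add_of_nonneg _ _ (by positivity) (by positivity), one_div, one_div, hpi, ENNReal.rpow_one]
      calc _ ≤ M z.1 * S (θ - z.2) * ‖F z‖ₑ := by gcongr; exact hkM _ _
        _ = M z.1 * (S (θ - z.2) ^ (1 / p) * S (θ - z.2) ^ (1 / q)) * ‖F z‖ₑ := by rw [← this]
        _ = _ := by ring
    have h2 := h1.trans (ENNReal.lintegral_mul_le_Lp_mul_Lq (lam.prod nuC) hpq
      (((hSm.pow_const _).mul hFe).aemeasurable) ((hMm.mul (hSm.pow_const _)).aemeasurable))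
    have e1 : ∫⁻ z : X × ℝ, (S (θ - z.2) ^ (1 / p) * ‖F z‖ₑ) ^ p ∂(lam.prod nuC)
        = ∫⁻ z, S (θ - z.2) * ‖F z‖ₑ ^ p ∂(lam.prod nuC) := by
      refine lintegral_congr fun z => ?_
      rw [ENNReal.mul_rpow_of_nonneg _ _ hp0.le, ← ENNReal.rpow_mul, one_div_mul_cancel hp0.ne', ENNReal.rpow_one]
    have e2 : ∫⁻ z : X × ℝ, (M z.1 * S (θ - z.2) ^ (1 / q)) ^ q ∂(lam.prod nuC) = m * I := by
      have : ∀ z : X × ℝ, (M z.1 * S (θ - z.2) ^ (1 / q)) ^ q = M z.1 ^ q * S (θ - z.2) := by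
        intro z
        rw [ENNReal.mul_rpow_of_nonneg _ _ hq0.le, ← ENNReal.rpow_mul, one_div_mul_cancel hq0.ne', ENNReal.rpow_one]
      simp_rw [this]
      rw [lintegral_prod _ (by exact ((hMm.pow_const _).mul hSm).aemeasurable)]
      have : ∀ x : X, ∫⁻ y, M x ^ q * S (θ - y) ∂nuC = M x ^ q * I := by
        intro x
        rw [lintegral_const_mul _ (by fun_prop), per_sub_left S hper]
      simp only [this]
      rw [lintegral_mul_const _ (hM.pow_const _)]
    rw [e1, e2] at h2
    calc _ ≤ _ := ENNReal.rpow_le_rpow h2 hp0.le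
      _ = _ := by
        rw [ENNReal.mul_rpow_of_nonneg _ _ hp0.le, ← ENNReal.rpow_mul, one_div_mul_cancel hp0.ne', ENNReal.rpow_one,
          ← ENNReal.rpow_mul, mul_comm, show 1 / q * p = p / q by ring]
  refine (lintegral_mono hpt).trans ?_
  have hm3 : Measurable fun w : ℝ × (X × ℝ) => S (w.1 - w.2.2) * ‖F w.2‖ₑ ^ p :=
    (hS.comp (by fun_prop)).mul ((hFe.comp measurable_snd).pow_const _)
  rw [lintegral_const_mul _ hm3.lintegral_prod_right', lintegral_lintegral_swap hm3.aemeasurable]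
  have e3 : ∀ z : X × ℝ, ∫⁻ θ, S (θ - z.2) * ‖F z‖ₑ ^ p ∂nuC = I * ‖F z‖ₑ ^ p := by
    intro z
    rw [lintegral_mul_const _ (by fun_prop), per_sub_right S hper]
  simp only [e3]
  rw [lintegral_const_mul _ (hFe.pow_const _), ENNReal.mul_rpow_of_nonneg _ _ (by positivity)]
  have : I ^ p = I ^ (p / q) * I := by
    have hh : p = p / q + 1 := by
      have : p * (p⁻¹ + q⁻¹) = p := by rw [hpi, mul_one]
      rw [mul_add, mul_inv_cancel₀ hp0.ne'] at this
      rw [div_eq_mul_inv]; linarith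
    nth_rw 1 [hh]
    rw [ENNReal.rpow_add_of_nonneg _ _ (by positivity) zero_le_one, ENNReal.rpow_one]
  rw [this]
  apply le_of_eq
  ring

end

section
noncomputable def lamR (R : ℝ) : Measure ℝ :=
  (volume.restrict (Ioc 0 (2 * R))).withDensity fun r => ((Real.toNNReal r : ℝ≥0) : ℝ≥0∞)

lemma lamR_lintegral (R : ℝ) (h : ℝ → ℝ≥0∞) :
    ∫⁻ r, h r ∂(lamR R) = ∫⁻ r in Ioc 0 (2 * R), h r * ENNReal.ofReal r := by
  unfold lamR
  rw [lintegral_withDensity_eq_lintegral_mul_non_measurable _ (by fun_prop) (ae_of_all _ fun x => ENNReal.coe_lt_top)]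
  refine lintegral_congr fun r => ?_
  simp only [Pi.mul_apply]
  rw [mul_comm]; rfl

instance lamR_finite (R : ℝ) : IsFiniteMeasure (lamR R) := by
  constructor
  have := lamR_lintegral R (fun _ => 1)
  rw [lintegral_one] at this
  rw [this]
  calc _ ≤ ∫⁻ r in Ioc 0 (2 * R), ENNReal.ofReal (2 * R) := by
        refine setLIntegral_mono' measurableSet_Ioc fun r hr => ?_
        rw [one_mul]; exact ENNReal.ofReal_le_ofReal hr.2
    _ < ⊤ := by
        rw [lintegral_const]
        exact ENNReal.mul_lt_top ENNReal.ofReal_lt_top (measure_lt_top _ _)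

lemma lamR_integral (R : ℝ) (h : ℝ → ℂ) (hh : ∀ r, r ∉ Ioc 0 (2 * R) → h r = 0) :
    ∫ r, h r ∂(lamR R) = ∫ r in Ioi 0, h r * (r : ℂ) := by
  unfold lamR
  rw [integral_withDensity_eq_integral_smul (by fun_prop)]
  rw [← setIntegral_eq_of_subset_of_forall_diff_eq_zero (s := Ioc 0 (2 * R)) measurableSet_Ioi (fun x hx => hx.1)
    (fun x hx => by rw [hh x hx.2, smul_zero])]
  refine setIntegral_congr_fun measurableSet_Ioi fun r hr => ?_
  simp only [NNReal.smul_def, Complex.real_smul]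
  rw [Real.coe_toNNReal _ (le_of_lt hr), mul_comm]

theorem assemble (R : ℝ) (K : ℝ → ℝ → ℝ → ℂ)
    (h0 : ∀ r₁ r₂ φ, r₂ ∉ Ioc 0 (2 * R) → K r₁ r₂ φ = 0)
    (hm : ∀ r₁, Measurable (Function.uncurry (K r₁)))
    (hper : ∀ r₁ r₂ φ, K r₁ r₂ (φ + 2 * π) = K r₁ r₂ φ)
    (S0 : ℝ → ℝ≥0∞) (hS : Measurable S0) (hSp : ∀ φ, S0 (φ + 2 * π) = S0 φ)
    (hS2 : ∫⁻ φ, S0 φ ^ 2 ∂nuC ≠ ⊤) (hb : ∀ r₁ r₂ φ, ‖K r₁ r₂ φ‖ₑ ≤ S0 φ)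
    (hz : ∀ r₁ r₂, (∀ᵐ φ : ℝ, K r₁ r₂ φ = 0) ∨ (∀ᵐ φ : ℝ, K r₁ r₂ φ ≠ 0))
    {p : ℝ} (hp : 2 ≤ p) (G : ℝ → ℝ≥0∞)
    (hG : ∀ r₁ > 0, ∀ F : ℝ × ℝ → ℂ, StronglyMeasurable F → MemLp F 2 ((lamR R).prod nuC) →
      ∫⁻ θ, ‖∫ z, K r₁ z.1 (θ - z.2) * F z ∂((lamR R).prod nuC)‖ₑ ^ p ∂nuC ≤
        G r₁ * ∫⁻ z, ‖F z‖ₑ ^ p ∂((lamR R).prod nuC))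
    (f : ℝ → ℝ → ℂ)
    (hf : ∫⁻ r in Ioi 0, (∫⁻ θ, ‖f r θ‖ₑ ^ p ∂nuC) * ENNReal.ofReal r ≠ ⊤) :
    ∫⁻ r₁ in Ioi 0, (∫⁻ θ₁, ‖∫ r₂ in Ioi 0, (∫ θ₂, K r₁ r₂ (θ₁ - θ₂) * f r₂ θ₂ ∂nuC) * (r₂ : ℂ)‖ₑ ^ p ∂nuC)
        * ENNReal.ofReal r₁ ≤
      (∫⁻ r₁ in Ioi 0, G r₁ * ENNReal.ofReal r₁) *
        ∫⁻ r in Ioi 0, (∫⁻ θ, ‖f r θ‖ₑ ^ p ∂nuC) * ENNReal.ofReal r := by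
  have hle : ∫⁻ x, ∫⁻ y, ‖f x y‖ₑ ^ p ∂nuC ∂(lamR R) ≤
      ∫⁻ r in Ioi 0, (∫⁻ θ, ‖f r θ‖ₑ ^ p ∂nuC) * ENNReal.ofReal r := by
    rw [lamR_lintegral]
    exact lintegral_mono_set fun x hx => hx.1
  set κ : ℝ × ℝ → ℝ → ℝ → ℂ := fun q r₂ θ₂ => K q.1 r₂ (q.2 - θ₂) with hκ
  have hκm : ∀ q, Measurable (Function.uncurry (κ q)) := fun q =>
    (hm q.1).comp (by fun_prop : Measurable fun z : ℝ × ℝ => (z.1, q.2 - z.2))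
  have hsl : ∀ q x, ∫⁻ y, ‖κ q x y‖ₑ ^ 2 ∂nuC ≤ ∫⁻ φ, S0 φ ^ 2 ∂nuC := by
    intro q x
    rw [← per_sub_left (fun φ => S0 φ ^ 2) (fun φ => by simp [hSp]) q.2]
    exact lintegral_mono fun y => by gcongr; exact hb _ _ _
  have hκs : ∀ q x, MemLp (κ q x) 2 nuC := fun q x =>
    memLp_two_of_lintegral ((hκm q).comp measurable_prodMk_left).aestronglyMeasurable
      (ne_top_of_le_ne_top hS2 (hsl q x))
  obtain ⟨F, hFm, hF2, hFp, hFe⟩ := reduction (lamR R) nuC κ hκm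
    (fun q => by
      refine memLp_two_of_lintegral (hκm q).aestronglyMeasurable ?_
      rw [lintegral_prod _ ((hκm q).enorm.pow_const 2).aemeasurable]
      refine ne_top_of_le_ne_top ?_ (lintegral_mono (hsl q))
      rw [lintegral_const]
      exact ENNReal.mul_ne_top hS2 (measure_ne_top _ _))
    (fun q => ae_of_all _ (hκs q))
    (fun q => ae_of_all _ fun x => by
      have hq : Measure.QuasiMeasurePreserving (fun y : ℝ => q.2 - y) volume volume :=
        (Measure.measurePreserving_sub_left (volume : Measure ℝ) q.2).quasiMeasurePreserving
      rcases hz q.1 x with h | h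
      · exact Or.inl (ae_restrict_of_ae (hq.ae h))
      · exact Or.inr (ae_restrict_of_ae (hq.ae h)))
    f hp (ne_top_of_le_ne_top hf hle)
  have hT : ∀ r₁ θ₁, ‖∫ r₂ in Ioi 0, (∫ θ₂, K r₁ r₂ (θ₁ - θ₂) * f r₂ θ₂ ∂nuC) * (r₂ : ℂ)‖ₑ ≤
      ‖∫ z, K r₁ z.1 (θ₁ - z.2) * F z ∂((lamR R).prod nuC)‖ₑ := by
    intro r₁ θ₁
    rw [← lamR_integral R (fun r₂ => ∫ θ₂, K r₁ r₂ (θ₁ - θ₂) * f r₂ θ₂ ∂nuC) (fun r hr => by simp [h0 _ _ _ hr])]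
    rcases hFe (r₁, θ₁) with h | h
    · simp only [hκ] at h
      rw [h]; simp
    · simp only [hκ] at h
      rw [h]
  have hfin : ∫⁻ z, ‖F z‖ₑ ^ p ∂((lamR R).prod nuC) ≤
      ∫⁻ r in Ioi 0, (∫⁻ θ, ‖f r θ‖ₑ ^ p ∂nuC) * ENNReal.ofReal r := hFp.trans hle
  rw [← lintegral_mul_const' _ _ hf]
  refine setLIntegral_mono' measurableSet_Ioi fun r₁ hr₁ => ?_
  calc _ ≤ (G r₁ * ∫⁻ z, ‖F z‖ₑ ^ p ∂((lamR R).prod nuC)) * ENNReal.ofReal r₁ := by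
        gcongr
        refine le_trans (lintegral_mono fun θ => ?_) (hG r₁ hr₁ F hFm hF2)
        exact ENNReal.rpow_le_rpow (hT r₁ θ) (by linarith)
    _ ≤ (G r₁ * ∫⁻ r in Ioi 0, (∫⁻ θ, ‖f r θ‖ₑ ^ p ∂nuC) * ENNReal.ofReal r) * ENNReal.ofReal r₁ := by gcongr
    _ = _ := by ring

end

section
lemma radial_inner (x A R q r₁ : ℝ) (hx : 0 ≤ x) (hx1 : x ≤ 1) (hA : 0 < A) (hR : 1 ≤ R) (hq : 0 < q)
    (hr0 : 0 < r₁) (hr : r₁ ≤ 2 * R) :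
    ∫⁻ r₂, ENNReal.ofReal (A * (1 + min r₁ r₂) ^ (-(x / q))) ^ q ∂(lamR R) ≤
      ENNReal.ofReal (A ^ q * (10 * R ^ 2) * (1 + r₁) ^ (-x)) := by
  rw [lamR_lintegral]
  have hpt : ∀ r₂ ∈ Ioc (0:ℝ) (2 * R), ENNReal.ofReal (A * (1 + min r₁ r₂) ^ (-(x / q))) ^ q * ENNReal.ofReal r₂ ≤
      ENNReal.ofReal (A ^ q * (5 * R) * (1 + r₁) ^ (-x)) := by
    rintro r₂ ⟨h0, h1⟩
    have hmin : 0 < 1 + min r₁ r₂ := by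
      have : 0 < min r₁ r₂ := lt_min hr0 h0
      linarith
    rw [ENNReal.ofReal_rpow_of_pos (by positivity), ← ENNReal.ofReal_mul (by positivity)]
    apply ENNReal.ofReal_le_ofReal
    rw [Real.mul_rpow hA.le (by positivity), ← Real.rpow_mul hmin.le,
      show -(x / q) * q = -x by field_simp]
    have key : (1 + min r₁ r₂) ^ (-x) * r₂ ≤ (5 * R) * (1 + r₁) ^ (-x) := by
      have hE : (3 * R) ^ (-x) ≤ (1 + r₁) ^ (-x) :=
        Real.rpow_le_rpow_of_nonpos (by linarith) (by linarith) (by linarith)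
      have hP : 0 < (1 + r₁) ^ (-x) := by positivity
      rcases min_cases r₁ r₂ with ⟨h, _⟩ | ⟨h, _⟩
      · rw [h]
        nlinarith
      · rw [h]
        calc (1 + r₂) ^ (-x) * r₂ ≤ (1 + r₂) ^ (-x) * (1 + r₂) := by gcongr; linarith
          _ = (1 + r₂) ^ (1 - x) := by
            rw [← Real.rpow_add_one (by positivity)]; congr 1; ring
          _ ≤ (3 * R) ^ (1 - x) := Real.rpow_le_rpow (by linarith) (by linarith) (by linarith)
          _ = (3 * R) * (3 * R) ^ (-x) := by
            rw [mul_comm (3 * R), ← Real.rpow_add_one (by positivity)]; congr 1; ring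
          _ ≤ (5 * R) * (1 + r₁) ^ (-x) := by gcongr; linarith
    calc A ^ q * (1 + min r₁ r₂) ^ (-x) * r₂ = A ^ q * ((1 + min r₁ r₂) ^ (-x) * r₂) := by ring
      _ ≤ A ^ q * ((5 * R) * (1 + r₁) ^ (-x)) := by gcongr
      _ = _ := by ring
  refine (setLIntegral_mono' measurableSet_Ioc hpt).trans ?_
  rw [setLIntegral_const, Real.volume_Ioc, ← ENNReal.ofReal_mul (by positivity)]
  apply ENNReal.ofReal_le_ofReal
  apply le_of_eq; ring

lemma radial_outer_gt (y : ℝ) (hy : y < -1) : ∃ C : ℝ≥0, ∀ R : ℝ,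
    ∫⁻ r in Ioc 0 (2 * R), ENNReal.ofReal ((1 + r) ^ y) ≤ C := by
  have h := integrable_one_add_norm (E := ℝ) (μ := volume) (r := -y) (by simp; linarith)
  have hfin : ∫⁻ r : ℝ, ENNReal.ofReal ((1 + ‖r‖) ^ (- -y)) ≠ ⊤ := by
    have := h.lintegral_lt_top
    exact this.ne
  refine ⟨(∫⁻ r : ℝ, ENNReal.ofReal ((1 + ‖r‖) ^ (- -y))).toNNReal, fun R => ?_⟩
  rw [ENNReal.coe_toNNReal hfin]
  calc _ ≤ ∫⁻ r in Ioc 0 (2 * R), ENNReal.ofReal ((1 + ‖r‖) ^ (- -y)) := by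
        refine setLIntegral_mono' measurableSet_Ioc fun r hr => ?_
        rw [neg_neg, Real.norm_of_nonneg hr.1.le]
    _ ≤ _ := setLIntegral_le_lintegral _ _

lemma radial_outer_lt (y : ℝ) (hy : -1 < y) (hy0 : y ≤ 0) : ∃ C : ℝ≥0, ∀ R : ℝ, 1 ≤ R →
    ∫⁻ r in Ioc 0 (2 * R), ENNReal.ofReal ((1 + r) ^ y) ≤ C * ENNReal.ofReal (R ^ (y + 1)) := by
  refine ⟨(2 ^ (y + 1) / (y + 1)).toNNReal, fun R hR => ?_⟩
  have hi : IntervalIntegrable (fun r : ℝ => r ^ y) volume 0 (2 * R) := intervalIntegral.intervalIntegrable_rpow' hy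
  calc _ ≤ ∫⁻ r in Ioc 0 (2 * R), ENNReal.ofReal (r ^ y) := by
        refine setLIntegral_mono' measurableSet_Ioc fun r hr => ?_
        exact ENNReal.ofReal_le_ofReal (Real.rpow_le_rpow_of_nonpos hr.1 (by linarith) hy0)
    _ = ENNReal.ofReal (∫ r in Ioc 0 (2 * R), r ^ y) := by
        rw [ofReal_integral_eq_lintegral_ofReal hi.1]
        filter_upwards [ae_restrict_mem measurableSet_Ioc] with r hr
        exact Real.rpow_nonneg hr.1.le _
    _ = ENNReal.ofReal ((2 * R) ^ (y + 1) / (y + 1)) := by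
        rw [← intervalIntegral.integral_of_le (by linarith), integral_rpow (Or.inl hy),
          Real.zero_rpow (by linarith), sub_zero]
    _ = _ := by
        have hy1 : 0 < y + 1 := by linarith
        change _ = ENNReal.ofReal _ * _
        rw [← ENNReal.ofReal_mul (by positivity), Real.mul_rpow (by norm_num) (by linarith)]
        congr 1; ring
    _ ≤ _ := le_rfl

/-- combination -/
lemma radial_comb (τ A R p q : ℝ) (hpq : p.HolderConjugate q) (hτ : 0 ≤ τ) (hτq : τ * q / 2 ≤ 1) (hA : 0 < A)
    (hR : 1 ≤ R) :
    ∫⁻ r₁ in Ioc 0 (2 * R), (∫⁻ r₂, ENNReal.ofReal (A * (1 + min r₁ r₂) ^ (-(τ / 2))) ^ q ∂(lamR R)) ^ (p / q)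
        * ENNReal.ofReal r₁ ≤
      ENNReal.ofReal (A ^ p * R ^ (2 * p / q) * 10 ^ (p / q)) *
        ∫⁻ r in Ioc 0 (2 * R), ENNReal.ofReal ((1 + r) ^ (1 - τ * p / 2)) := by
  have hp0 := hpq.pos
  have hq0 := hpq.symm.pos
  rw [← lintegral_const_mul' _ _ ENNReal.ofReal_ne_top]
  refine setLIntegral_mono' measurableSet_Ioc fun r₁ hr => ?_
  have h1 := radial_inner (τ * q / 2) A R q r₁ (by positivity) hτq hA hR hq0 hr.1 hr.2
  rw [show τ * q / 2 / q = τ / 2 by field_simp] at h1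
  have hr1 : 0 < 1 + r₁ := by linarith [hr.1]
  calc _ ≤ ENNReal.ofReal (A ^ q * (10 * R ^ 2) * (1 + r₁) ^ (-(τ * q / 2))) ^ (p / q) * ENNReal.ofReal r₁ := by gcongr
    _ = ENNReal.ofReal ((A ^ q * (10 * R ^ 2) * (1 + r₁) ^ (-(τ * q / 2))) ^ (p / q) * r₁) := by
        rw [ENNReal.ofReal_rpow_of_pos (by positivity), ← ENNReal.ofReal_mul (by positivity)]
    _ ≤ ENNReal.ofReal ((A ^ p * R ^ (2 * p / q) * 10 ^ (p / q)) * (1 + r₁) ^ (1 - τ * p / 2)) := by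
        apply ENNReal.ofReal_le_ofReal
        rw [Real.mul_rpow (by positivity) (by positivity), Real.mul_rpow (by positivity) (by positivity),
          Real.mul_rpow (by positivity) (by positivity), ← Real.rpow_mul hA.le, ← Real.rpow_mul hr1.le,
          ← Real.rpow_natCast R 2, ← Real.rpow_mul (by linarith),
          show q * (p / q) = p by field_simp, show -(τ * q / 2) * (p / q) = -(τ * p / 2) by field_simp,
          show ((2:ℕ):ℝ) * (p / q) = 2 * p / q by push_cast; ring,
          show 1 - τ * p / 2 = -(τ * p / 2) + 1 by ring, Real.rpow_add_one hr1.ne']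
        calc _ ≤ A ^ p * (10 ^ (p / q) * R ^ (2 * p / q)) * (1 + r₁) ^ (-(τ * p / 2)) * (1 + r₁) := by gcongr; linarith
          _ = _ := by ring
    _ = _ := by rw [ENNReal.ofReal_mul (by positivity)]

end

section
noncomputable def sg (φ : ℝ) : ℝ := |Real.sin ((φ + π) / 2)|

lemma sg_per (φ : ℝ) : sg (φ + 2 * π) = sg φ := by
  unfold sg
  rw [show (φ + 2 * π + π) / 2 = (φ + π) / 2 + π by ring, Real.sin_add_pi, abs_neg]

lemma sg_cont : Continuous sg := by unfold sg; fun_prop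

lemma sg_nonneg (φ : ℝ) : 0 ≤ sg φ := abs_nonneg _

noncomputable def SS (κ : ℝ) (φ : ℝ) : ℝ≥0∞ := ENNReal.ofReal (sg φ) ^ (-κ)

lemma SS_per (κ φ : ℝ) : SS κ (φ + 2 * π) = SS κ φ := by unfold SS; rw [sg_per]

lemma SS_meas (κ : ℝ) : Measurable (SS κ) := by
  unfold SS
  exact (ENNReal.measurable_ofReal.comp sg_cont.measurable).pow_const _

lemma SS_int (κ : ℝ) (h0 : 0 ≤ κ) (h1 : κ < 1) : ∫⁻ φ, SS κ φ ∂nuC ≠ ⊤ := by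
  rw [← per_sub_right (SS κ) (SS_per κ) π, nuC_eq]
  have hpi := pi_pos
  have hA : IntervalIntegrable (fun r : ℝ => (r / π) ^ (-κ)) volume 0 (2 * π) := by
    have h := (intervalIntegral.intervalIntegrable_rpow' (a := 0) (b := 2 * π) (r := -κ) (by linarith)).div_const (π ^ (-κ))
    rw [intervalIntegrable_iff] at h ⊢
    refine h.congr_fun (fun x hx => ?_) measurableSet_uIoc
    rw [uIoc_of_le (by positivity)] at hx
    simp only
    rw [Real.div_rpow hx.1.le hpi.le]
  have hB : IntervalIntegrable (fun r : ℝ => ((2 * π - r) / π) ^ (-κ)) volume 0 (2 * π) := by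
    have := (hA.comp_sub_left (2 * π)).symm
    simpa using this
  have hs := (hA.add hB).1.lintegral_lt_top
  refine ne_top_of_le_ne_top hs.ne ?_
  have hae : ∀ᵐ x ∂(volume.restrict (Ioc 0 (2 * π))), x ≠ 2 * π :=
    ae_restrict_of_ae (Measure.ae_ne volume (2 * π))
  refine lintegral_mono_ae ?_
  filter_upwards [hae, ae_restrict_mem measurableSet_Ioc] with x hx1 hx
  have hx2 : x < 2 * π := lt_of_le_of_ne hx.2 hx1
  have hsg : sg (x - π) = |Real.sin (x / 2)| := by unfold sg; congr 2; ring
  have hpos : 0 < Real.sin (x / 2) := Real.sin_pos_of_pos_of_lt_pi (by linarith [hx.1]) (by linarith)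
  have hx0 := hx.1
  unfold SS
  rw [hsg, abs_of_pos hpos, ENNReal.ofReal_rpow_of_pos hpos]
  apply ENNReal.ofReal_le_ofReal
  have p1 : 0 ≤ (x / π) ^ (-κ) := by positivity
  have p2 : 0 ≤ ((2 * π - x) / π) ^ (-κ) := by
    have : 0 < 2 * π - x := by linarith
    positivity
  rcases le_total x π with h | h
  · have h3 := Real.mul_le_sin (x := x / 2) (by linarith) (by linarith)
    have h4 : Real.sin (x / 2) ^ (-κ) ≤ (x / π) ^ (-κ) := by
      refine Real.rpow_le_rpow_of_nonpos (by positivity) ?_ (by linarith)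
      calc x / π = 2 / π * (x / 2) := by ring
        _ ≤ _ := h3
    linarith
  · have h3 := Real.mul_le_sin (x := (2 * π - x) / 2) (by linarith) (by linarith)
    have h5 : Real.sin ((2 * π - x) / 2) = Real.sin (x / 2) := by
      rw [show (2 * π - x) / 2 = π - x / 2 by ring, Real.sin_pi_sub]
    rw [h5] at h3
    have h4 : Real.sin (x / 2) ^ (-κ) ≤ ((2 * π - x) / π) ^ (-κ) := by
      refine Real.rpow_le_rpow_of_nonpos (div_pos (by linarith) hpi) ?_ (by linarith)
      calc (2 * π - x) / π = 2 / π * ((2 * π - x) / 2) := by ring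
        _ ≤ _ := h3
    linarith

/-- The facts about a kernel that are needed for the operator bounds. -/
structure KFacts (δ : ℝ) (k : ℝ → ℝ → ℝ → ℂ) : Prop where
  meas : ∀ r₁ > 0, Measurable (fun z : ℝ × ℝ => if 0 < z.1 then k r₁ z.1 z.2 else 0)
  per : ∀ r₁ r₂ φ, k r₁ r₂ (φ + 2 * π) = k r₁ r₂ φ
  size : ∀ τ : ℝ, 0 ≤ τ → τ ≤ 1 → ∃ C : ℝ, 0 < C ∧ ∀ r₁ > 0, ∀ r₂ > 0, ∀ φ,
    ‖k r₁ r₂ φ‖ₑ ≤ ENNReal.ofReal (C * (1 + r₁ + r₂) ^ (-(3 / 2 + δ)) * (1 + min r₁ r₂) ^ (-(τ / 2))) *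
      SS ((1 + 3 * τ) / 4) φ
  four : ∃ C : ℝ, 0 < C ∧ ∀ r₁ > 0, ∀ r₂ > 0, ∀ n : ℤ,
    ‖∫ φ, eN n φ * k r₁ r₂ φ ∂nuC‖ ≤ C * (1 + r₁ + r₂) ^ (-(3 / 2 + δ)) * (1 + min r₁ r₂) ^ (-(1 / 2 : ℝ))
  zero : ∀ r₁ > 0, ∀ r₂ > 0, (∀ᵐ φ : ℝ, k r₁ r₂ φ = 0) ∨ (∀ᵐ φ : ℝ, k r₁ r₂ φ ≠ 0)

structure Cut (b R : ℝ) (χ : ℝ → ℝ) : Prop where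
  meas : Measurable χ
  bd : ∀ t, |χ t| ≤ b
  supp : ∀ t, 0 < t → χ t ≠ 0 → 3 / 8 * R ≤ 1 + t ∧ t ≤ 2 * R

noncomputable def Kc (χ : ℝ → ℝ) (k : ℝ → ℝ → ℝ → ℂ) (r₁ r₂ φ : ℝ) : ℂ :=
  if 0 < r₁ ∧ 0 < r₂ then (χ (r₁ + r₂) : ℂ) * k r₁ r₂ φ else 0

section
variable {δ b R : ℝ} {k : ℝ → ℝ → ℝ → ℂ} {χ : ℝ → ℝ}

lemma Kc_zero (hχ : Cut b R χ) (r₁ r₂ φ : ℝ) (h : r₁ ∉ Ioc 0 (2 * R) ∨ r₂ ∉ Ioc 0 (2 * R)) :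
    Kc χ k r₁ r₂ φ = 0 := by
  unfold Kc
  split_ifs with hp
  · by_cases h0 : χ (r₁ + r₂) = 0
    · simp [h0]
    · exfalso
      have := (hχ.supp _ (by linarith [hp.1, hp.2]) h0).2
      rcases h with h | h
      · exact h ⟨hp.1, by linarith⟩
      · exact h ⟨hp.2, by linarith⟩
  · rfl

lemma Kc_meas (hk : KFacts δ k) (hχ : Cut b R χ) (r₁ : ℝ) : Measurable (Function.uncurry (Kc χ k r₁)) := by
  by_cases h : 0 < r₁
  · have : Function.uncurry (Kc χ k r₁) = fun z : ℝ × ℝ => ((χ (r₁ + z.1) : ℝ) : ℂ) * (if 0 < z.1 then k r₁ z.1 z.2 else 0) := by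
      funext z
      simp only [Function.uncurry, Kc, h, true_and]
      split_ifs <;> simp
    rw [this]
    exact (Complex.measurable_ofReal.comp (hχ.meas.comp (by fun_prop))).mul (hk.meas r₁ h)
  · have : Function.uncurry (Kc χ k r₁) = fun z : ℝ × ℝ => 0 := by
      funext z
      simp [Function.uncurry, Kc, h]
    rw [this]; exact measurable_const

lemma Kc_per (hk : KFacts δ k) (r₁ r₂ φ : ℝ) : Kc χ k r₁ r₂ (φ + 2 * π) = Kc χ k r₁ r₂ φ := by
  unfold Kc; rw [hk.per]

lemma Kc_ae (hk : KFacts δ k) (r₁ r₂ : ℝ) :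
    (∀ᵐ φ : ℝ, Kc χ k r₁ r₂ φ = 0) ∨ (∀ᵐ φ : ℝ, Kc χ k r₁ r₂ φ ≠ 0) := by
  unfold Kc
  by_cases hp : 0 < r₁ ∧ 0 < r₂
  · simp only [hp, and_self, if_true]
    by_cases h0 : χ (r₁ + r₂) = 0
    · left; simp [h0]
    · rcases hk.zero r₁ hp.1 r₂ hp.2 with h | h
      · left; filter_upwards [h] with φ h; simp [h]
      · right; filter_upwards [h] with φ h; simp [h, h0]
  · left; simp [hp]

lemma cut_pow (hχ : Cut b R χ) (hδ : 0 ≤ δ) (hb : 0 < b) (hR : 1 ≤ R) {r₁ r₂ C : ℝ} (hC : 0 < C) (h1 : 0 < r₁) (h2 : 0 < r₂) {x : ℝ} (hx : 0 ≤ x) :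
    |χ (r₁ + r₂)| * (C * (1 + r₁ + r₂) ^ (-(3 / 2 + δ)) * x) ≤
      b * C * (8 / 3) ^ (3 / 2 + δ) * R ^ (-(3 / 2 + δ)) * x := by
  by_cases h0 : χ (r₁ + r₂) = 0
  · rw [h0, abs_zero, zero_mul]
    positivity
  · have hs := (hχ.supp _ (by linarith) h0).1
    have : (1 + r₁ + r₂) ^ (-(3 / 2 + δ)) ≤ (8 / 3) ^ (3 / 2 + δ) * R ^ (-(3 / 2 + δ)) := by
      calc (1 + r₁ + r₂) ^ (-(3 / 2 + δ)) ≤ (3 / 8 * R) ^ (-(3 / 2 + δ)) :=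
            Real.rpow_le_rpow_of_nonpos (by linarith) (by linarith) (by linarith)
        _ = _ := by
          rw [Real.mul_rpow (by norm_num) (by linarith), Real.rpow_neg (by norm_num), ← Real.inv_rpow (by norm_num)]
          norm_num
    calc |χ (r₁ + r₂)| * (C * (1 + r₁ + r₂) ^ (-(3 / 2 + δ)) * x)
        ≤ b * (C * ((8 / 3) ^ (3 / 2 + δ) * R ^ (-(3 / 2 + δ))) * x) := by
          gcongr
          exact hχ.bd _
      _ = _ := by ring

lemma Kc_size (hk : KFacts δ k) (hδ : 0 ≤ δ) (hb : 0 < b) (τ : ℝ) (hτ : 0 ≤ τ) (hτ1 : τ ≤ 1) :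
    ∃ C : ℝ, 0 < C ∧ ∀ R χ, 1 ≤ R → Cut b R χ → ∀ r₁ > 0, ∀ r₂ φ, ‖Kc χ k r₁ r₂ φ‖ₑ ≤
      ENNReal.ofReal (C * R ^ (-(3 / 2 + δ)) * (1 + min r₁ r₂) ^ (-(τ / 2))) * SS ((1 + 3 * τ) / 4) φ := by
  obtain ⟨C, hC, h⟩ := hk.size τ hτ hτ1
  refine ⟨b * C * (8 / 3) ^ (3 / 2 + δ), by positivity, fun R χ hR hχ r₁ h1 r₂ φ => ?_⟩
  by_cases h2 : 0 < r₂
  · have h1' : 0 < r₁ := h1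
    simp only [Kc, h1', h2, and_self, if_true]
    rw [enorm_mul, ← ofReal_norm, Complex.norm_real, Real.norm_eq_abs]
    have hm : 0 < 1 + min r₁ r₂ := by linarith [lt_min h1 h2]
    calc _ ≤ ENNReal.ofReal |χ (r₁ + r₂)| * (ENNReal.ofReal (C * (1 + r₁ + r₂) ^ (-(3 / 2 + δ)) * (1 + min r₁ r₂) ^ (-(τ / 2))) *
            SS ((1 + 3 * τ) / 4) φ) := by gcongr; exact h _ h1 _ h2 _
      _ = ENNReal.ofReal (|χ (r₁ + r₂)| * (C * (1 + r₁ + r₂) ^ (-(3 / 2 + δ)) * (1 + min r₁ r₂) ^ (-(τ / 2)))) *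
            SS ((1 + 3 * τ) / 4) φ := by rw [ENNReal.ofReal_mul (abs_nonneg _)]; ring
      _ ≤ _ := by
        refine mul_le_mul_left (ENNReal.ofReal_le_ofReal ?_) _
        exact cut_pow hχ hδ hb hR hC h1 h2 (by positivity)
  · simp [Kc, h2]

lemma Kc_four (hk : KFacts δ k) (hδ : 0 ≤ δ) (hb : 0 < b) :
    ∃ C : ℝ, 0 < C ∧ ∀ R χ, 1 ≤ R → Cut b R χ → ∀ r₁ > 0, ∀ r₂, ∀ n : ℤ, ‖∫ φ, eN n φ * Kc χ k r₁ r₂ φ ∂nuC‖ₑ ≤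
      ENNReal.ofReal (C * R ^ (-(3 / 2 + δ)) * (1 + min r₁ r₂) ^ (-(1 / 2 : ℝ))) := by
  obtain ⟨C, hC, h⟩ := hk.four
  refine ⟨b * C * (8 / 3) ^ (3 / 2 + δ), by positivity, fun R χ hR hχ r₁ h1 r₂ n => ?_⟩
  by_cases h2 : 0 < r₂
  · have hm : 0 < 1 + min r₁ r₂ := by linarith [lt_min h1 h2]
    have e : ∀ φ, eN n φ * Kc χ k r₁ r₂ φ = (χ (r₁ + r₂) : ℂ) * (eN n φ * k r₁ r₂ φ) := by
      intro φ
      have h1' : 0 < r₁ := h1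
      simp only [Kc, h1', h2, and_self, if_true]; ring
    simp_rw [e]
    rw [integral_const_mul, ← ofReal_norm, norm_mul, Complex.norm_real, Real.norm_eq_abs]
    apply ENNReal.ofReal_le_ofReal
    calc _ ≤ |χ (r₁ + r₂)| * (C * (1 + r₁ + r₂) ^ (-(3 / 2 + δ)) * (1 + min r₁ r₂) ^ (-(1 / 2 : ℝ))) := by
          gcongr; exact h _ h1 _ h2 _
      _ ≤ _ := cut_pow hχ hδ hb hR hC h1 h2 (by positivity)
  · simp [Kc, h2]
end

end

section
noncomputable def Nf (p : ℝ) (f : ℝ → ℝ → ℂ) : ℝ≥0∞ := ∫⁻ r in Ioi 0, (∫⁻ θ, ‖f r θ‖ₑ ^ p ∂nuC) * ENNReal.ofReal r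

noncomputable def Tker (K : ℝ → ℝ → ℝ → ℂ) (f : ℝ → ℝ → ℂ) (r₁ θ₁ : ℝ) : ℂ :=
  ∫ r₂ in Ioi 0, (∫ θ₂, K r₁ r₂ (θ₁ - θ₂) * f r₂ θ₂ ∂nuC) * (r₂ : ℂ)

section
variable {δ b : ℝ} {k : ℝ → ℝ → ℝ → ℂ}

lemma assemble_cut (hk : KFacts δ k) (hδ : 0 ≤ δ) (hb : 0 < b) {R : ℝ} {χ : ℝ → ℝ} (hR : 1 ≤ R) (hχ : Cut b R χ)
    {p : ℝ} (hp : 2 ≤ p) (G : ℝ → ℝ≥0∞)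
    (hG : ∀ r₁ ∈ Ioc 0 (2 * R), ∀ F : ℝ × ℝ → ℂ, StronglyMeasurable F → MemLp F 2 ((lamR R).prod nuC) →
      ∫⁻ θ, ‖∫ z, Kc χ k r₁ z.1 (θ - z.2) * F z ∂((lamR R).prod nuC)‖ₑ ^ p ∂nuC ≤
        G r₁ * ∫⁻ z, ‖F z‖ₑ ^ p ∂((lamR R).prod nuC))
    (f : ℝ → ℝ → ℂ) (hf : Nf p f ≠ ⊤) :
    Nf p (Tker (Kc χ k) f) ≤ (∫⁻ r₁ in Ioc 0 (2 * R), G r₁ * ENNReal.ofReal r₁) * Nf p f := by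
  obtain ⟨C, hC, hsz⟩ := Kc_size hk hδ hb 0 le_rfl zero_le_one
  have hsz := hsz R χ hR hχ
  set c := ENNReal.ofReal (C * R ^ (-(3 / 2 + δ)))
  have hb' : ∀ r₁ r₂ φ, ‖Kc χ k r₁ r₂ φ‖ₑ ≤ c * SS (1 / 4) φ := by
    intro r₁ r₂ φ
    by_cases h : 0 < r₁
    · have := hsz r₁ h r₂ φ
      simpa [c, add_comm] using this
    · simp [Kc, h]
  have h := assemble R (Kc χ k) (fun r₁ r₂ φ h => Kc_zero hχ _ _ _ (Or.inr h)) (Kc_meas hk hχ) (Kc_per hk)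
    (fun φ => c * SS (1 / 4) φ) ((SS_meas _).const_mul _) (fun φ => by simp only [SS_per]) ?_ hb' (Kc_ae hk) hp
    (fun r => (Ioc 0 (2 * R)).indicator G r) ?_ f hf
  · refine h.trans (le_of_eq ?_)
    unfold Nf
    congr 1
    have : ∀ r, (Ioc 0 (2 * R)).indicator G r * ENNReal.ofReal r = (Ioc 0 (2 * R)).indicator (fun r => G r * ENNReal.ofReal r) r := by
      intro r
      by_cases hr : r ∈ Ioc 0 (2 * R) <;> simp [hr]
    simp_rw [this]
    rw [setLIntegral_indicator measurableSet_Ioc]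
    congr 2
    exact inter_eq_left.2 fun x hx => hx.1
  · simp_rw [mul_pow]
    rw [lintegral_const_mul _ ((SS_meas _).pow_const _)]
    refine ENNReal.mul_ne_top (by simp [c]) ?_
    have e : ∀ φ, SS (1 / 4) φ ^ 2 = SS (1 / 2) φ := by
      intro φ
      unfold SS
      rw [← ENNReal.rpow_two, ← ENNReal.rpow_mul]; norm_num
    simp_rw [e]
    exact SS_int _ (by norm_num) (by norm_num)
  · intro r₁ h1 F hF hF2
    by_cases hr : r₁ ∈ Ioc 0 (2 * R)
    · simp only [hr, indicator_of_mem]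
      exact hG r₁ hr F hF hF2
    · have h0 : 0 < p := by linarith
      simp only [Kc_zero hχ _ _ _ (Or.inl hr)]
      simp [h0]

lemma lp_unrooted (hk : KFacts δ k) (hδ : 0 ≤ δ) (hb : 0 < b) {p q τ : ℝ} (hpq : p.HolderConjugate q) (hp : 2 ≤ p)
    (hτ : 0 ≤ τ) (hτ1 : τ < 1) (hq2 : q ≤ 2) :
    ∃ C : ℝ≥0, ∀ R χ, 1 ≤ R → Cut b R χ → ∀ f, Nf p f ≠ ⊤ → Nf p (Tker (Kc χ k) f) ≤
      C * ENNReal.ofReal (R ^ (-(3 / 2 + δ) * p + 2 * p / q)) *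
        (∫⁻ r in Ioc 0 (2 * R), ENNReal.ofReal ((1 + r) ^ (1 - τ * p / 2))) * Nf p f := by
  obtain ⟨C, hC, hsz⟩ := Kc_size hk hδ hb τ hτ hτ1.le
  have hSi := SS_int ((1 + 3 * τ) / 4) (by positivity) (by linarith)
  set I := ∫⁻ φ, SS ((1 + 3 * τ) / 4) φ ∂nuC with hI
  have hp0 := hpq.pos
  have hIt : I ^ p ≠ ⊤ := ENNReal.rpow_ne_top_of_nonneg hp0.le hSi
  refine ⟨(I ^ p).toNNReal * (C ^ p * 10 ^ (p / q)).toNNReal, fun R χ hR hχ f hf => ?_⟩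
  have hsz := hsz R χ hR hχ
  have hR0 : 0 < R := by linarith
  set A := C * R ^ (-(3 / 2 + δ)) with hA
  have hA0 : 0 < A := by positivity
  have h := assemble_cut hk hδ hb hR hχ hp
    (fun r₁ => (∫⁻ r₂, ENNReal.ofReal (A * (1 + min r₁ r₂) ^ (-(τ / 2))) ^ q ∂(lamR R)) ^ (p / q) * I ^ p)
    (fun r₁ hr₁ F hF hF2 => lp_lemma (lamR R) (Kc χ k r₁) _ (by fun_prop) _ (SS_meas _) (SS_per _)
      (fun r₂ φ => hsz r₁ hr₁.1 r₂ φ) hpq F hF) f hf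
  refine h.trans ?_
  gcongr
  have e : ∀ r₁, (∫⁻ r₂, ENNReal.ofReal (A * (1 + min r₁ r₂) ^ (-(τ / 2))) ^ q ∂(lamR R)) ^ (p / q) * I ^ p * ENNReal.ofReal r₁
      = I ^ p * ((∫⁻ r₂, ENNReal.ofReal (A * (1 + min r₁ r₂) ^ (-(τ / 2))) ^ q ∂(lamR R)) ^ (p / q) * ENNReal.ofReal r₁) := by
    intro r₁; ring
  simp_rw [e]
  rw [lintegral_const_mul' _ _ hIt]
  have h2 := radial_comb τ A R p q hpq hτ (by nlinarith) hA0 hR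
  calc _ ≤ I ^ p * _ := mul_le_mul_right h2 _
    _ = _ := by
      rw [ENNReal.coe_mul, ENNReal.coe_toNNReal hIt]
      change _ = I ^ p * ENNReal.ofReal _ * _ * _
      have : A ^ p * R ^ (2 * p / q) * 10 ^ (p / q) = (C ^ p * 10 ^ (p / q)) * R ^ (-(3 / 2 + δ) * p + 2 * p / q) := by
        rw [hA, Real.mul_rpow hC.le (by positivity), ← Real.rpow_mul hR0.le, Real.rpow_add hR0]; ring
      rw [this, ENNReal.ofReal_mul (by positivity)]
      ring

lemma l2_unrooted (hk : KFacts δ k) (hδ : 0 ≤ δ) (hb : 0 < b) :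
    ∃ C : ℝ≥0, ∀ R χ, 1 ≤ R → Cut b R χ → ∀ f, Nf 2 f ≠ ⊤ → Nf 2 (Tker (Kc χ k) f) ≤
      C * ENNReal.ofReal (R ^ (-(3 / 2 + δ) * 2 + 2 * 2 / 2)) *
        (∫⁻ r in Ioc 0 (2 * R), ENNReal.ofReal ((1 + r) ^ (1 - 1 * 2 / 2 : ℝ))) * Nf 2 f := by
  obtain ⟨C, hC, hsz⟩ := Kc_four hk hδ hb
  obtain ⟨C', hC', hsz'⟩ := Kc_size hk hδ hb 0 le_rfl zero_le_one
  refine ⟨(C ^ (2:ℝ) * 10 ^ (2 / 2 : ℝ)).toNNReal, fun R χ hR hχ f hf => ?_⟩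
  have hsz := hsz R χ hR hχ
  have hsz' := hsz' R χ hR hχ
  have hR0 : 0 < R := by linarith
  set A := C * R ^ (-(3 / 2 + δ)) with hA
  have hA0 : 0 < A := by positivity
  set c := ENNReal.ofReal (C' * R ^ (-(3 / 2 + δ)))
  have hm2 : ∀ r₁ ∈ Ioc 0 (2 * R), MemLp (Function.uncurry (Kc χ k r₁)) 2 ((lamR R).prod nuC) := by
    intro r₁ hr₁
    refine memLp_two_of_lintegral (Kc_meas hk hχ r₁).aestronglyMeasurable ?_
    rw [lintegral_prod _ ((Kc_meas hk hχ r₁).enorm.pow_const 2).aemeasurable]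
    have hS := SS_int (1 / 2) (by norm_num) (by norm_num)
    have hsl : ∀ x, ∫⁻ y, ‖Function.uncurry (Kc χ k r₁) (x, y)‖ₑ ^ 2 ∂nuC ≤ c ^ 2 * ∫⁻ φ, SS (1 / 2) φ ∂nuC := by
      intro x
      rw [← lintegral_const_mul _ (SS_meas _)]
      refine lintegral_mono fun y => ?_
      have := hsz' r₁ hr₁.1 x y
      have e : SS (1 / 4) y ^ 2 = SS (1 / 2) y := by
        unfold SS
        rw [← ENNReal.rpow_two, ← ENNReal.rpow_mul]; norm_num
      rw [← e, ← mul_pow]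
      gcongr
      simpa [c, add_comm] using this
    refine ne_top_of_le_ne_top ?_ (lintegral_mono hsl)
    rw [lintegral_const]
    exact ENNReal.mul_ne_top (ENNReal.mul_ne_top (by simp [c]) hS) (measure_ne_top _ _)
  have h := assemble_cut hk hδ hb hR hχ (le_refl 2)
    (fun r₁ => (∫⁻ r₂, ENNReal.ofReal (A * (1 + min r₁ r₂) ^ (-(1 / 2 : ℝ))) ^ (2:ℝ) ∂(lamR R)) ^ (2 / 2 : ℝ))
    (fun r₁ hr₁ F hF hF2 => by
      have := l2_lemma (lamR R) (Kc χ k r₁) (Kc_meas hk hχ r₁) (Kc_per hk r₁) (hm2 r₁ hr₁)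
        (fun r₂ => ENNReal.ofReal (A * (1 + min r₁ r₂) ^ (-(1 / 2 : ℝ)))) (by fun_prop)
        (fun n r₂ => hsz r₁ hr₁.1 r₂ n) F hF hF2
      simpa using this) f hf
  refine h.trans ?_
  gcongr
  have h2 := radial_comb 1 A R 2 2 Real.HolderConjugate.two_two zero_le_one (by norm_num) hA0 hR
  refine h2.trans (le_of_eq ?_)
  change _ = ENNReal.ofReal _ * _ * _
  have : A ^ (2:ℝ) * R ^ (2 * 2 / 2 : ℝ) * 10 ^ (2 / 2 : ℝ) = (C ^ (2:ℝ) * 10 ^ (2 / 2 : ℝ)) * R ^ (-(3 / 2 + δ) * 2 + 2 * 2 / 2) := by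
    rw [hA, Real.mul_rpow hC.le (by positivity), ← Real.rpow_mul hR0.le, Real.rpow_add hR0]; ring
  rw [this, ENNReal.ofReal_mul (by positivity)]
end

lemma root_step {p : ℝ} (hp : 0 < p) {C : ℝ≥0} {N N' : ℝ≥0∞} {R E : ℝ} (hR : 0 < R)
    (h : N' ≤ C * ENNReal.ofReal (R ^ (E * p)) * N) :
    N' ^ (1 / p) ≤ ((C ^ (1 / p) : ℝ≥0) : ℝ≥0∞) * ENNReal.ofReal (R ^ E) * N ^ (1 / p) := by
  have hp' : 0 ≤ 1 / p := by positivity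
  refine (ENNReal.rpow_le_rpow h hp').trans (le_of_eq ?_)
  rw [ENNReal.mul_rpow_of_nonneg _ _ hp', ENNReal.mul_rpow_of_nonneg _ _ hp', ENNReal.coe_rpow_of_nonneg _ hp',
    ENNReal.ofReal_rpow_of_pos (by positivity), ← Real.rpow_mul hR.le, mul_assoc E, mul_one_div_cancel hp.ne', mul_one]

end

section
lemma polarLp_eq (p : ℝ) (g : ℝ → ℝ → ℂ) : polarLp p g = Nf p g ^ (1 / p) := rfl

noncomputable def chiJ (β β₀ : ℝ → ℝ) (j : ℕ) (t : ℝ) : ℝ :=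
  if j = 0 then β₀ t else β ((2 : ℝ) ^ (-(j : ℝ)) * t)

lemma cut_bound (β : ℝ → ℝ) (hβ : Continuous β) (x y : ℝ) (h : Function.support β ⊆ Icc x y) :
    ∃ b : ℝ, ∀ t, |β t| ≤ b := by
  have hc : HasCompactSupport β := by
    refine HasCompactSupport.of_support_subset_isCompact isCompact_Icc h
  obtain ⟨b, hb⟩ := hc.exists_bound_of_continuous hβ
  exact ⟨b, fun t => by simpa using hb t⟩

lemma chi_cut (β β₀ : ℝ → ℝ) (hβ : Continuous β)
    (hβs : Function.support β ⊆ Set.Icc (3 / 8) (4 / 3))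
    (hβ₀ : Continuous β₀) (hβ₀s : Function.support β₀ ⊆ Set.Icc 0 1) :
    ∃ b : ℝ, 0 < b ∧ ∀ j : ℕ, Cut b ((2:ℝ) ^ (j : ℝ)) (chiJ β β₀ j) := by
  obtain ⟨b1, h1⟩ := cut_bound β hβ _ _ hβs
  obtain ⟨b2, h2⟩ := cut_bound β₀ hβ₀ _ _ hβ₀s
  have p1 := (abs_nonneg _).trans (h1 0)
  have p2 := (abs_nonneg _).trans (h2 0)
  refine ⟨b1 + b2 + 1, by linarith, fun j => ⟨?_, ?_, ?_⟩⟩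
  · unfold chiJ
    split_ifs
    · exact hβ₀.measurable
    · exact hβ.measurable.comp (by fun_prop)
  · intro t
    unfold chiJ
    split_ifs
    · linarith [h2 t]
    · linarith [h1 ((2 : ℝ) ^ (-(j : ℝ)) * t)]
  · intro t ht h
    unfold chiJ at h
    split_ifs at h with hj
    · have := hβ₀s (Function.mem_support.2 h)
      rw [hj]; simp
      constructor <;> linarith [this.1, this.2]
    · have := hβs (Function.mem_support.2 h)
      have hR : (0:ℝ) < 2 ^ (j : ℝ) := by positivity
      rw [Real.rpow_neg (by norm_num)] at this
      obtain ⟨a1, a2⟩ := this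
      have e : (2:ℝ) ^ (j:ℝ) * (((2:ℝ) ^ (j:ℝ))⁻¹ * t) = t := by field_simp
      constructor
      · nlinarith
      · nlinarith

lemma TD_eq (δ α : ℝ) (a : ℝ → ℂ) (β β₀ : ℝ → ℝ) (ℓ : Fin 3) (j : ℕ) (f : ℝ → ℝ → ℂ) (r₁ θ₁ : ℝ) (h : 0 < r₁) :
    TD δ α a β β₀ ℓ j f r₁ θ₁ = Tker (Kc (chiJ β β₀ j) (KD δ α a ℓ)) f r₁ θ₁ := by
  unfold TD Tker
  refine setIntegral_congr_fun measurableSet_Ioi fun r₂ h2 => ?_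
  have h2' : 0 < r₂ := h2
  simp only [Kc, h, h2', and_self, if_true, KDj, chiJ]

lemma Nf_TD (p δ α : ℝ) (a : ℝ → ℂ) (β β₀ : ℝ → ℝ) (ℓ : Fin 3) (j : ℕ) (f : ℝ → ℝ → ℂ) :
    Nf p (TD δ α a β β₀ ℓ j f) = Nf p (Tker (Kc (chiJ β β₀ j) (KD δ α a ℓ)) f) := by
  unfold Nf
  refine setLIntegral_congr_fun measurableSet_Ioi fun r hr => ?_
  simp only [TD_eq δ α a β β₀ ℓ j f r _ hr]

lemma two_pow_conv (j : ℕ) (E : ℝ) : ENNReal.ofReal (((2:ℝ) ^ (j:ℝ)) ^ E) = (2 : ℝ≥0∞) ^ ((j:ℝ) * E) := by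
  rw [← Real.rpow_mul (by norm_num), ← ENNReal.ofReal_rpow_of_pos (by norm_num)]
  norm_num

lemma finish {p : ℝ} (hp : 0 < p) (E : ℝ) (C : ℝ≥0) (T : ℕ → (ℝ → ℝ → ℂ) → ℝ → ℝ → ℂ)
    (h : ∀ j f, Nf p f ≠ ⊤ → Nf p (T j f) ≤ C * ENNReal.ofReal (((2:ℝ) ^ (j:ℝ)) ^ (E * p)) * Nf p f) :
    ∃ C' : ℝ≥0, ∀ j f, polarLp p (T j f) ≤ C' * (2 : ℝ≥0∞) ^ ((j:ℝ) * E) * polarLp p f := by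
  refine ⟨C ^ (1 / p) + 1, fun j f => ?_⟩
  rw [polarLp_eq, polarLp_eq]
  by_cases hf : Nf p f = ⊤
  · rw [hf, ENNReal.top_rpow_of_pos (by positivity), ENNReal.mul_top]
    · exact le_top
    · refine mul_ne_zero ?_ ?_
      · simp
      · exact (ENNReal.rpow_pos (by norm_num) (by norm_num)).ne'
  · have := root_step hp (by positivity) (h j f hf)
    rw [two_pow_conv] at this
    refine this.trans ?_
    gcongr
    simp

theorem stmt_of_facts (δ : ℝ) (hδ : 0 ≤ δ) (a : ℝ → ℂ)
    (β β₀ : ℝ → ℝ) (hβ : Continuous β)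
    (hβs : Function.support β ⊆ Set.Icc (3 / 8) (4 / 3))
    (hβ₀ : Continuous β₀) (hβ₀s : Function.support β₀ ⊆ Set.Icc 0 1)
    (α : ℝ) (ℓ : Fin 3) (hk : KFacts δ (KD δ α a ℓ)) :
      (∃ C : ℝ≥0, ∀ (j : ℕ) (f : ℝ → ℝ → ℂ),
          polarLp 2 (TD δ α a β β₀ ℓ j f) ≤
            (C : ℝ≥0∞) * (2 : ℝ≥0∞) ^ (-(j : ℝ) * δ) * polarLp 2 f) ∧
      (∀ p : ℝ, 6 ≤ p → ∃ C : ℝ≥0, ∀ (j : ℕ) (f : ℝ → ℝ → ℂ),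
          polarLp p (TD δ α a β β₀ ℓ j f) ≤
            (C : ℝ≥0∞) * (2 : ℝ≥0∞) ^ ((j : ℝ) * (deltaC p - δ)) * polarLp p f) ∧
      (∀ p : ℝ, 4 ≤ p → p < 6 → ∀ ε' : ℝ, 0 < ε' → ε' < 1 →
          ∃ C : ℝ≥0, ∀ (j : ℕ) (f : ℝ → ℝ → ℂ),
            polarLp p (TD δ α a β β₀ ℓ j f) ≤
              (C : ℝ≥0∞) * (2 : ℝ≥0∞) ^ ((j : ℝ) * (deltaC p - δ)) *
                (2 : ℝ≥0∞) ^ ((j : ℝ) * ε') * polarLp p f) := by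
  obtain ⟨b, hb, hcut⟩ := chi_cut β β₀ hβ hβs hβ₀ hβ₀s
  have hR1 : ∀ j : ℕ, (1:ℝ) ≤ 2 ^ (j:ℝ) := fun j => Real.one_le_rpow (by norm_num) (by positivity)
  have hdc : ∀ p : ℝ, 4 ≤ p → deltaC p = 1 / 2 - 2 / p := by
    intro p hp
    have h2 : 1 / p ≤ 1 / 4 := one_div_le_one_div_of_le (by norm_num) hp
    have h3 : 2 / p = 2 * (1 / p) := by ring
    unfold deltaC
    rw [abs_of_nonneg (by linarith), max_eq_right (by linarith)]
    linarith
  refine ⟨?_, ?_, ?_⟩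
  · obtain ⟨C1, h1⟩ := l2_unrooted hk hδ hb
    obtain ⟨C2, h2⟩ := radial_outer_lt 0 (by norm_num) le_rfl
    obtain ⟨C, hC⟩ := finish (p := 2) (by norm_num) (-δ) (C1 * C2) (TD δ α a β β₀ ℓ) (fun j f hf => by
      rw [Nf_TD]
      refine (h1 _ _ (hR1 j) (hcut j) f hf).trans ?_
      have h2 := h2 _ (hR1 j)
      norm_num only at h2 ⊢
      have hR0 : (0:ℝ) < 2 ^ (j:ℝ) := by positivity
      calc _ ≤ C1 * ENNReal.ofReal (((2:ℝ) ^ (j:ℝ)) ^ (-(3 / 2 + δ) * 2 + 2)) * (C2 * ENNReal.ofReal (((2:ℝ) ^ (j:ℝ)) ^ (1:ℝ))) * Nf 2 f := by gcongr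
        _ = C1 * C2 * (ENNReal.ofReal (((2:ℝ) ^ (j:ℝ)) ^ (-(3 / 2 + δ) * 2 + 2)) * ENNReal.ofReal (((2:ℝ) ^ (j:ℝ)) ^ (1:ℝ))) * Nf 2 f := by ring
        _ = _ := by
          rw [← ENNReal.ofReal_mul (by positivity), ← Real.rpow_add hR0, ENNReal.coe_mul]
          congr 4
          ring)
    refine ⟨C, fun j f => ?_⟩
    have := hC j f
    rwa [show (j:ℝ) * -δ = -(j:ℝ) * δ by ring] at this
  · intro p hp
    have hp0 : 0 < p := by linarith
    have hpq : p.HolderConjugate (p / (p - 1)) := Real.HolderConjugate.conjExponent (by linarith)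
    have hq2 : p / (p - 1) ≤ 2 := by rw [div_le_iff₀ (by linarith)]; linarith
    obtain ⟨C1, h1⟩ := lp_unrooted hk hδ hb (τ := 3 / 4) hpq (by linarith) (by norm_num) (by norm_num) hq2
    obtain ⟨C2, h2⟩ := radial_outer_gt (1 - 3 / 4 * p / 2) (by linarith)
    refine finish hp0 (deltaC p - δ) (C1 * C2) (TD δ α a β β₀ ℓ) (fun j f hf => ?_)
    rw [Nf_TD]
    refine (h1 _ _ (hR1 j) (hcut j) f hf).trans ?_
    calc _ ≤ C1 * ENNReal.ofReal (((2:ℝ) ^ (j:ℝ)) ^ (-(3 / 2 + δ) * p + 2 * p / (p / (p - 1)))) * C2 * Nf p f := by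
          gcongr; exact h2 _
      _ = _ := by
        have : -(3 / 2 + δ) * p + 2 * p / (p / (p - 1)) = (deltaC p - δ) * p := by
          rw [hdc p (by linarith)]
          have : p - 1 ≠ 0 := by linarith
          field_simp
          ring
        rw [this, ENNReal.coe_mul]; ring
  · intro p hp hp6 ε' hε hε1
    have hp0 : 0 < p := by linarith
    have hpq : p.HolderConjugate (p / (p - 1)) := Real.HolderConjugate.conjExponent (by linarith)
    have hq2 : p / (p - 1) ≤ 2 := by rw [div_le_iff₀ (by linarith)]; linarith
    have h4p : 4 / p ≤ 1 := by rw [div_le_one hp0]; exact hp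
    have h4p' : 2 / 3 < 4 / p := by rw [lt_div_iff₀ hp0]; linarith
    set τ := max (4 / p - 2 * ε') (1 / 2) with hτ
    have t1 : τ < 4 / p := max_lt (by linarith) (by linarith)
    have t2 : 1 / 2 ≤ τ := le_max_right _ _
    have t3 : 4 / p - 2 * ε' ≤ τ := le_max_left _ _
    have t4 : τ * p < 4 := by rwa [lt_div_iff₀ hp0] at t1
    obtain ⟨C1, h1⟩ := lp_unrooted hk hδ hb (τ := τ) hpq (by linarith) (by linarith) (by linarith) hq2
    obtain ⟨C2, h2⟩ := radial_outer_lt (1 - τ * p / 2) (by linarith) (by nlinarith)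
    obtain ⟨C, hC⟩ := finish hp0 (deltaC p - δ + ε') (C1 * C2) (TD δ α a β β₀ ℓ) (fun j f hf => by
      rw [Nf_TD]
      refine (h1 _ _ (hR1 j) (hcut j) f hf).trans ?_
      have hR0 : (0:ℝ) < 2 ^ (j:ℝ) := by positivity
      calc _ ≤ C1 * ENNReal.ofReal (((2:ℝ) ^ (j:ℝ)) ^ (-(3 / 2 + δ) * p + 2 * p / (p / (p - 1)))) * (C2 * ENNReal.ofReal (((2:ℝ) ^ (j:ℝ)) ^ (1 - τ * p / 2 + 1))) * Nf p f := by
            gcongr; exact h2 _ (hR1 j)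
        _ = C1 * C2 * (ENNReal.ofReal (((2:ℝ) ^ (j:ℝ)) ^ (-(3 / 2 + δ) * p + 2 * p / (p / (p - 1)))) * ENNReal.ofReal (((2:ℝ) ^ (j:ℝ)) ^ (1 - τ * p / 2 + 1))) * Nf p f := by ring
        _ ≤ _ := by
          rw [← ENNReal.ofReal_mul (by positivity), ← Real.rpow_add hR0, ENNReal.coe_mul]
          gcongr
          · exact hR1 j
          · rw [hdc p hp]
            have hp1 : p - 1 ≠ 0 := by linarith
            have e1 : 2 * p / (p / (p - 1)) = 2 * p - 2 := by field_simp
            have e2 : (1 / 2 - 2 / p - δ + ε') * p = p / 2 - 2 - δ * p + ε' * p := by field_simp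
            have e3 : (4 / p - 2 * ε') * p = 4 - 2 * ε' * p := by field_simp
            have e4 := mul_le_mul_of_nonneg_right t3 hp0.le
            rw [e1, e2]
            linarith)
    refine ⟨C, fun j f => ?_⟩
    have := hC j f
    rw [mul_add, ENNReal.rpow_add _ _ (by norm_num) (by norm_num), ← mul_assoc] at this
    exact this

end

section
lemma vdc_abs {d dp dpp : ℝ → ℝ} {h h' : ℝ → ℂ} {Q Q' : ℝ → ℝ} {u0 : ℝ}
    (hd : ∀ s ≥ u0, HasDerivAt d (dp s) s) (hdp : ∀ s ≥ u0, HasDerivAt dp (dpp s) s)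
    (hpos : ∀ s ≥ u0, 0 < dp s) (hdpp : ∀ s ≥ u0, 0 ≤ dpp s)
    (hh : ∀ s ≥ u0, HasDerivAt h (h' s) s) (hQ : ∀ s ≥ u0, HasDerivAt Q (Q' s) s)
    (hhQ : ∀ s ≥ u0, ‖h s‖ ≤ Q s) (hhQ' : ∀ s ≥ u0, ‖h' s‖ ≤ -Q' s) (U : ℝ) (hU : u0 ≤ U) :
    ‖∫ s in u0..U, Complex.exp (Complex.I * (d s : ℂ)) * h s‖ ≤ 2 * (Q u0 / dp u0) := by
  set e : ℝ → ℂ := fun s => Complex.exp (Complex.I * (d s : ℂ)) with he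
  have hen : ∀ s, ‖e s‖ = 1 := by
    intro s
    simp only [he]
    rw [mul_comm, Complex.norm_exp_ofReal_mul_I]
  have hde : ∀ s ≥ u0, HasDerivAt e (e s * (Complex.I * (dp s : ℂ))) s := by
    intro s hs
    exact (((hd s hs).ofReal_comp).const_mul Complex.I).cexp
  have hec : ContinuousOn (fun s => e s * h s) (Icc u0 U) := fun s hs =>
    ((hde s hs.1).continuousAt.mul (hh s hs.1).continuousAt).continuousWithinAt
  -- the primitive
  set Φ : ℝ → ℂ := fun x => Complex.I * (∫ s in u0..x, e s * h s) - e x * (h x / (dp x : ℂ)) + e u0 * (h u0 / (dp u0 : ℂ)) with hΦ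
  set Φ' : ℝ → ℂ := fun x => - (e x * ((h' x * (dp x : ℂ) - h x * (dpp x : ℂ)) / (dp x : ℂ) ^ 2)) with hΦ'
  set Z : ℝ → ℝ := fun x => Q u0 / dp u0 - Q x / dp x
  set Z' : ℝ → ℝ := fun x => -((Q' x * dp x - Q x * dpp x) / dp x ^ 2) with hZ'
  have hdq : ∀ s ≥ u0, HasDerivAt (fun x => e x * (h x / (dp x : ℂ)))
      (e s * (Complex.I * (dp s : ℂ)) * (h s / (dp s : ℂ)) + e s * ((h' s * (dp s : ℂ) - h s * (dpp s : ℂ)) / (dp s : ℂ) ^ 2)) s := by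
    intro s hs
    have hne : (dp s : ℂ) ≠ 0 := by exact_mod_cast (hpos s hs).ne'
    exact (hde s hs).mul ((hh s hs).div ((hdp s hs).ofReal_comp) hne)
  have hi : IntervalIntegrable (fun s => e s * h s) volume u0 U := by
    apply ContinuousOn.intervalIntegrable
    rwa [uIcc_of_le hU]
  have hder : ∀ x ∈ Ico u0 U, HasDerivWithinAt Φ (Φ' x) (Ici x) x := by
    intro x hx
    have hne : (dp x : ℂ) ≠ 0 := by exact_mod_cast (hpos x hx.1).ne'
    have h1 : HasDerivWithinAt (fun x => ∫ s in u0..x, e s * h s) (e x * h x) (Ici x) x := by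
      have hix : IntervalIntegrable (fun s => e s * h s) volume u0 x :=
        hi.mono_set (by rw [uIcc_of_le hU, uIcc_of_le hx.1]; exact Icc_subset_Icc le_rfl hx.2.le)
      have hsm : StronglyMeasurableAtFilter (fun s => e s * h s) (nhdsWithin x (Ioi x)) volume := by
        refine ⟨Ioo x U, Ioo_mem_nhdsGT hx.2, ?_⟩
        exact (hec.mono fun y hy => ⟨hx.1.trans hy.1.le, hy.2.le⟩).aestronglyMeasurable measurableSet_Ioo
      exact intervalIntegral.integral_hasDerivWithinAt_right hix hsm
        (((hde x hx.1).continuousAt.mul (hh x hx.1).continuousAt).continuousWithinAt)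
    have h2 := ((h1.const_mul Complex.I).sub (hdq x hx.1).hasDerivWithinAt).add_const (e u0 * (h u0 / (dp u0 : ℂ)))
    have e3 : Φ' x = Complex.I * (e x * h x) - (e x * (Complex.I * (dp x : ℂ)) * (h x / (dp x : ℂ)) + e x * ((h' x * (dp x : ℂ) - h x * (dpp x : ℂ)) / (dp x : ℂ) ^ 2)) := by
      show - (e x * ((h' x * (dp x : ℂ) - h x * (dpp x : ℂ)) / (dp x : ℂ) ^ 2)) = _
      field_simp
      ring
    rw [e3]
    exact h2
  have hcont : ContinuousOn Φ (Icc u0 U) := by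
    have h1 : ContinuousOn (fun x => ∫ s in u0..x, e s * h s) (Icc u0 U) := by
      have := intervalIntegral.continuousOn_primitive_interval' hi (left_mem_uIcc)
      rwa [uIcc_of_le hU] at this
    have h2 : ContinuousOn (fun x => e x * (h x / (dp x : ℂ))) (Icc u0 U) := fun x hx =>
      (hdq x hx.1).continuousAt.continuousWithinAt
    exact ((continuousOn_const.mul h1).sub h2).add continuousOn_const
  have hZd : ∀ x ≥ u0, HasDerivAt Z (Z' x) x := by
    intro x hx
    exact ((hQ x hx).div (hdp x hx) (hpos x hx).ne').const_sub _
  have hb : ∀ x ∈ Ico u0 U, ‖Φ' x‖ ≤ Z' x := by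
    intro x hx
    simp only [hΦ', hZ', norm_neg, norm_mul, hen, one_mul, norm_div, norm_pow, Complex.norm_real, Real.norm_eq_abs]
    rw [sq_abs, ← neg_div]
    have p1 := hpos x hx.1
    have p2 := hdpp x hx.1
    gcongr
    calc ‖h' x * (dp x : ℂ) - h x * (dpp x : ℂ)‖ ≤ ‖h' x‖ * dp x + ‖h x‖ * dpp x := by
          refine (norm_sub_le _ _).trans ?_
          simp [abs_of_pos p1, abs_of_nonneg p2]
      _ ≤ -Q' x * dp x + Q x * dpp x := by
          have := hhQ x hx.1
          have := hhQ' x hx.1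
          gcongr
      _ = _ := by ring
  have hfin := image_norm_le_of_norm_deriv_right_le_deriv_boundary' hcont hder (B := Z) (B' := Z')
    (by simp [hΦ, Z]) (fun x hx => (hZd x hx.1).continuousAt.continuousWithinAt)
    (fun x hx => (hZd x hx.1).hasDerivWithinAt) hb (right_mem_Icc.2 hU)
  have hA : ∀ s ≥ u0, ‖e s * (h s / (dp s : ℂ))‖ ≤ Q s / dp s := by
    intro s hs
    rw [norm_mul, hen, one_mul, norm_div, Complex.norm_real, Real.norm_of_nonneg (hpos s hs).le]
    have := hhQ s hs
    have := hpos s hs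
    gcongr
  have e1 : Complex.I * (∫ s in u0..U, e s * h s) = Φ U + e U * (h U / (dp U : ℂ)) - e u0 * (h u0 / (dp u0 : ℂ)) := by
    simp only [hΦ]; ring
  calc ‖∫ s in u0..U, e s * h s‖ = ‖Complex.I * (∫ s in u0..U, e s * h s)‖ := by simp
    _ = ‖Φ U + e U * (h U / (dp U : ℂ)) - e u0 * (h u0 / (dp u0 : ℂ))‖ := by rw [e1]
    _ ≤ ‖Φ U‖ + ‖e U * (h U / (dp U : ℂ))‖ + ‖e u0 * (h u0 / (dp u0 : ℂ))‖ :=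
        (norm_sub_le _ _).trans (by gcongr; exact norm_add_le _ _)
    _ ≤ Z U + Q U / dp U + Q u0 / dp u0 := by
        gcongr
        · exact hA U hU
        · exact hA u0 le_rfl
    _ = _ := by simp only [Z]; ring

end

section
/-- the amplitude, cut off to positive arguments -/
noncomputable def bT (m : ℝ) (a : ℝ → ℂ) (t : ℝ) : ℂ :=
  if 0 < t then (((1 + t) ^ (-m) : ℝ) : ℂ) * a t else 0

/-- the oscillating factor of the kernels -/
noncomputable def psi (m : ℝ) (a : ℝ → ℂ) (r₁ r₂ s : ℝ) : ℂ :=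
  Complex.exp (Complex.I * (dS r₁ r₂ s : ℂ)) * bT m a (dS r₁ r₂ s)

lemma dS_sq {r₁ r₂ : ℝ} (h1 : 0 < r₁) (h2 : 0 < r₂) (s : ℝ) :
    dS r₁ r₂ s ^ 2 = r₁ ^ 2 + r₂ ^ 2 + 2 * r₁ * r₂ * Real.cosh s := by
  have := Real.cosh_pos s
  exact Real.sq_sqrt (by positivity)

lemma dS_ge {r₁ r₂ : ℝ} (h1 : 0 < r₁) (h2 : 0 < r₂) (s : ℝ) : r₁ + r₂ ≤ dS r₁ r₂ s := by
  apply Real.le_sqrt_of_sq_le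
  have := Real.one_le_cosh s
  have h3 : 0 < r₁ * r₂ := by positivity
  nlinarith

lemma dS_pos {r₁ r₂ : ℝ} (h1 : 0 < r₁) (h2 : 0 < r₂) (s : ℝ) : 0 < dS r₁ r₂ s :=
  lt_of_lt_of_le (by positivity) (dS_ge h1 h2 s)

lemma dS_cont : Continuous (fun z : ℝ × ℝ × ℝ => dS z.1 z.2.1 z.2.2) := by
  unfold dS
  have := Real.continuous_cosh
  fun_prop

lemma dS_deriv {r₁ r₂ : ℝ} (h1 : 0 < r₁) (h2 : 0 < r₂) (s : ℝ) :
    HasDerivAt (dS r₁ r₂) (r₁ * r₂ * Real.sinh s / dS r₁ r₂ s) s := by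
  have h3 := dS_pos h1 h2 s
  have h4 : HasDerivAt (fun s => r₁ ^ 2 + r₂ ^ 2 + 2 * r₁ * r₂ * Real.cosh s) (2 * r₁ * r₂ * Real.sinh s) s :=
    ((Real.hasDerivAt_cosh s).const_mul _).const_add _
  have h5 := h4.sqrt (by rw [← dS_sq h1 h2]; positivity)
  have e : r₁ * r₂ * Real.sinh s / dS r₁ r₂ s = 2 * r₁ * r₂ * Real.sinh s / (2 * √(r₁ ^ 2 + r₂ ^ 2 + 2 * r₁ * r₂ * Real.cosh s)) := by
    change _ = 2 * r₁ * r₂ * Real.sinh s / (2 * dS r₁ r₂ s)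
    field_simp
  rw [e]
  exact h5

lemma dS_deriv2 {r₁ r₂ : ℝ} (h1 : 0 < r₁) (h2 : 0 < r₂) (s : ℝ) :
    HasDerivAt (fun s => r₁ * r₂ * Real.sinh s / dS r₁ r₂ s)
      ((r₁ * r₂ * Real.cosh s * dS r₁ r₂ s - r₁ * r₂ * Real.sinh s * (r₁ * r₂ * Real.sinh s / dS r₁ r₂ s)) / dS r₁ r₂ s ^ 2) s :=
  ((Real.hasDerivAt_sinh s).const_mul _).div (dS_deriv h1 h2 s) (dS_pos h1 h2 s).ne'

lemma dS_deriv2_nonneg {r₁ r₂ : ℝ} (h1 : 0 < r₁) (h2 : 0 < r₂) (s : ℝ) :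
    0 ≤ (r₁ * r₂ * Real.cosh s * dS r₁ r₂ s - r₁ * r₂ * Real.sinh s * (r₁ * r₂ * Real.sinh s / dS r₁ r₂ s)) / dS r₁ r₂ s ^ 2 := by
  have h3 := dS_pos h1 h2 s
  apply div_nonneg _ (by positivity)
  have e : r₁ * r₂ * Real.cosh s * dS r₁ r₂ s - r₁ * r₂ * Real.sinh s * (r₁ * r₂ * Real.sinh s / dS r₁ r₂ s)
    = r₁ * r₂ * (Real.cosh s * dS r₁ r₂ s ^ 2 - r₁ * r₂ * Real.sinh s ^ 2) / dS r₁ r₂ s := by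
    field_simp
  rw [e, dS_sq h1 h2]
  have hc := Real.cosh_pos s
  have hcs := Real.cosh_sq s
  have h5 : 0 ≤ Real.cosh s * (r₁ ^ 2 + r₂ ^ 2 + 2 * r₁ * r₂ * Real.cosh s) - r₁ * r₂ * Real.sinh s ^ 2 := by
    have e2 : Real.cosh s * (r₁ ^ 2 + r₂ ^ 2 + 2 * r₁ * r₂ * Real.cosh s) - r₁ * r₂ * Real.sinh s ^ 2
      = Real.cosh s * (r₁ ^ 2 + r₂ ^ 2) + 2 * (r₁ * r₂) * Real.cosh s ^ 2 - r₁ * r₂ * Real.sinh s ^ 2 := by ring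
    rw [e2, hcs]
    have e3 : Real.cosh s * (r₁ ^ 2 + r₂ ^ 2) + 2 * (r₁ * r₂) * (Real.sinh s ^ 2 + 1) - r₁ * r₂ * Real.sinh s ^ 2
      = Real.cosh s * (r₁ ^ 2 + r₂ ^ 2) + r₁ * r₂ * Real.sinh s ^ 2 + 2 * (r₁ * r₂) := by ring
    rw [e3]; positivity
  positivity

lemma dS_upper {r₁ r₂ u : ℝ} (h1 : 0 < r₁) (h2 : 0 < r₂) (hu0 : 0 ≤ u) (hu : u ≤ 1) :
    dS r₁ r₂ u ≤ 2 * (r₁ + r₂) := by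
  apply Real.sqrt_le_iff.2 ⟨by positivity, ?_⟩
  have hc : Real.cosh u ≤ 4 := by
    have : Real.cosh u ≤ Real.cosh 1 := by
      rw [Real.cosh_le_cosh, abs_of_nonneg hu0]; simpa using hu
    refine this.trans ?_
    rw [Real.cosh_eq]
    have e1 := Real.exp_one_lt_d9
    have e2 : Real.exp (-1) ≤ 1 := Real.exp_le_one_iff.2 (by norm_num)
    linarith
  have h3 : 0 < r₁ * r₂ := by positivity
  nlinarith

lemma dS_slope {r₁ r₂ : ℝ} (h1 : 1 ≤ r₁) (h2 : 1 ≤ r₂) :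
    (min r₁ r₂) ^ (1 / 2 : ℝ) / 4 ≤
      r₁ * r₂ * Real.sinh ((min r₁ r₂) ^ (-(1 / 2) : ℝ)) / dS r₁ r₂ ((min r₁ r₂) ^ (-(1 / 2) : ℝ)) := by
  have p1 : 0 < r₁ := by linarith
  have p2 : 0 < r₂ := by linarith
  set ρ := min r₁ r₂ with hρ
  have hρ1 : 1 ≤ ρ := le_min h1 h2
  have hρ0 : 0 < ρ := by linarith
  set u := ρ ^ (-(1 / 2) : ℝ) with hu
  have hu0 : 0 < u := by positivity
  have hu1 : u ≤ 1 := Real.rpow_le_one_of_one_le_of_nonpos hρ1 (by norm_num)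
  have hup := dS_upper p1 p2 hu0.le hu1
  have hs : u ≤ Real.sinh u := Real.self_le_sinh_iff.2 hu0.le
  have hd := dS_pos p1 p2 u
  rw [le_div_iff₀ hd]
  have hD : ρ / 2 * (r₁ + r₂) ≤ r₁ * r₂ := by
    rcases le_total r₁ r₂ with h | h
    · have : ρ = r₁ := min_eq_left h
      rw [this]; nlinarith
    · have : ρ = r₂ := min_eq_right h
      rw [this]; nlinarith
  have hh : ρ ^ (1 / 2 : ℝ) = ρ * u := by
    rw [hu]
    nth_rewrite 2 [← Real.rpow_one ρ]
    rw [← Real.rpow_add hρ0]; norm_num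
  rw [hh]
  calc ρ * u / 4 * dS r₁ r₂ u ≤ ρ * u / 4 * (2 * (r₁ + r₂)) := by gcongr
    _ = (ρ / 2 * (r₁ + r₂)) * u := by ring
    _ ≤ r₁ * r₂ * Real.sinh u := by gcongr

lemma symbol_bounds {a : ℝ → ℂ} (ha : IsSymbol0 a) {m : ℝ} (hm : 1 ≤ m) :
    ∃ (c : ℝ) (b' : ℝ → ℂ), 0 < c ∧ (∀ t > 0, ‖bT m a t‖ ≤ c * (1 + t) ^ (-m)) ∧
      (∀ t > 0, HasDerivAt (bT m a) (b' t) t) ∧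
      (∀ t > 0, ‖b' t‖ ≤ c * (m * t ^ (-m - 1))) := by
  obtain ⟨hs, ⟨M, hM⟩, hN⟩ := ha
  obtain ⟨C1, hC1⟩ := hN 1
  have hM0 : 0 ≤ M := (norm_nonneg _).trans (hM 1 one_pos)
  have hC0 : 0 ≤ C1 := by
    have := (norm_nonneg _).trans (hC1 1 one_pos)
    simpa using this
  have hda : ∀ t > 0, HasDerivAt a (derivWithin a (Ioi 0) t) t := by
    intro t ht
    have h1 : DifferentiableOn ℝ a (Ioi 0) := hs.differentiableOn (by simp)
    exact ((h1 t ht).hasDerivWithinAt).hasDerivAt (Ioi_mem_nhds ht)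
  have hda' : ∀ t > 0, ‖derivWithin a (Ioi 0) t‖ ≤ C1 * t ^ (-1 : ℝ) := by
    intro t ht
    have := hC1 t ht
    rwa [iteratedDerivWithin_one, Nat.cast_one] at this
  refine ⟨M + C1 + 1, fun t => ((-m * (1 + t) ^ (-m - 1) : ℝ) : ℂ) * a t + (((1 + t) ^ (-m) : ℝ) : ℂ) * derivWithin a (Ioi 0) t, by positivity, ?_, ?_, ?_⟩
  · intro t ht
    have p : 0 ≤ (1 + t) ^ (-m) := by positivity
    simp only [bT, if_pos ht, norm_mul, Complex.norm_real, Real.norm_eq_abs, abs_of_nonneg p]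
    rw [mul_comm]
    gcongr
    linarith [hM t ht]
  · intro t ht
    have h1 : HasDerivAt (fun t : ℝ => (1 + t) ^ (-m)) (-m * (1 + t) ^ (-m - 1)) t := by
      have := ((hasDerivAt_id t).const_add 1).rpow_const (p := -m) (Or.inl (by simp; linarith))
      simpa using this
    have h2 := h1.ofReal_comp.mul (hda t ht)
    refine h2.congr_of_eventuallyEq ?_
    filter_upwards [Ioi_mem_nhds ht] with x hx
    simp only [bT, if_pos (show 0 < x from hx)]
    rfl
  · intro t ht
    have p : 0 ≤ (1 + t) ^ (-m) := by positivity
    have q1 : (1 + t) ^ (-m - 1) ≤ t ^ (-m - 1) :=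
      Real.rpow_le_rpow_of_nonpos ht (by linarith) (by linarith)
    have q2 : (1 + t) ^ (-m) ≤ t ^ (-m) :=
      Real.rpow_le_rpow_of_nonpos ht (by linarith) (by linarith)
    have e : t ^ (-m) * t ^ (-1 : ℝ) = t ^ (-m - 1) := by rw [← Real.rpow_add ht]; rfl
    have hn : ‖((-m * (1 + t) ^ (-m - 1) : ℝ) : ℂ)‖ = m * (1 + t) ^ (-m - 1) := by
      rw [Complex.norm_real, Real.norm_eq_abs, abs_mul, abs_neg, abs_of_pos (by linarith), abs_of_nonneg (by positivity)]
    calc _ ≤ m * (1 + t) ^ (-m - 1) * M + (1 + t) ^ (-m) * (C1 * t ^ (-1 : ℝ)) := by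
          refine (norm_add_le _ _).trans ?_
          rw [norm_mul, norm_mul, hn]
          refine add_le_add ?_ ?_
          · gcongr; exact hM t ht
          · rw [Complex.norm_real, Real.norm_of_nonneg p]
            gcongr; exact hda' t ht
      _ ≤ m * t ^ (-m - 1) * M + t ^ (-m) * (C1 * t ^ (-1 : ℝ)) := by gcongr
      _ = (m * M + C1) * t ^ (-m - 1) := by rw [← e]; ring
      _ ≤ (M + C1 + 1) * (m * t ^ (-m - 1)) := by
          rw [← mul_assoc]
          gcongr
          nlinarith

lemma bT_meas {a : ℝ → ℂ} (ha : IsSymbol0 a) {m : ℝ} : Measurable (bT m a) := by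
  have h : ContinuousOn (fun t : ℝ => (((1 + t) ^ (-m) : ℝ) : ℂ) * a t) (Ioi 0) := by
    refine ContinuousOn.mul ?_ ha.1.continuousOn
    refine Complex.continuous_ofReal.comp_continuousOn ?_
    refine ContinuousOn.rpow_const (by fun_prop) ?_
    intro x hx
    left
    have : (0 : ℝ) < x := hx
    positivity
  have := ContinuousOn.measurable_piecewise (s := Ioi (0 : ℝ)) h (continuousOn_const (c := (0 : ℂ))) measurableSet_Ioi
  have e : bT m a = (Ioi (0 : ℝ)).piecewise (fun t : ℝ => (((1 + t) ^ (-m) : ℝ) : ℂ) * a t) (fun _ => 0) := by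
    ext t
    by_cases ht : 0 < t
    · rw [Set.piecewise_eq_of_mem _ _ _ (by exact ht)]; simp [bT, ht]
    · rw [Set.piecewise_eq_of_notMem _ _ _ (by exact ht)]; simp [bT, ht]
  rw [e]; exact this

lemma psi_meas {a : ℝ → ℂ} (ha : IsSymbol0 a) {m : ℝ} :
    Measurable (fun z : ℝ × ℝ × ℝ => psi m a z.1 z.2.1 z.2.2) := by
  unfold psi
  refine Measurable.mul ?_ ((bT_meas ha).comp dS_cont.measurable)
  have := dS_cont
  exact Continuous.measurable (by fun_prop)

lemma psi_norm {m : ℝ} {a : ℝ → ℂ} {c : ℝ} (hm : 0 ≤ m) (hc : 0 < c) (hb : ∀ t > 0, ‖bT m a t‖ ≤ c * (1 + t) ^ (-m))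
    {r₁ r₂ : ℝ} (h1 : 0 < r₁) (h2 : 0 < r₂) (s : ℝ) : ‖psi m a r₁ r₂ s‖ ≤ c * (1 + r₁ + r₂) ^ (-m) := by
  unfold psi
  rw [norm_mul, mul_comm Complex.I, Complex.norm_exp_ofReal_mul_I, one_mul]
  refine (hb _ (dS_pos h1 h2 s)).trans ?_
  have := dS_ge h1 h2 s
  gcongr c * ?_
  exact Real.rpow_le_rpow_of_nonpos (by linarith) (by linarith) (by linarith)

lemma KD_eq (δ α : ℝ) (a : ℝ → ℂ) (ℓ : Fin 3) {r₁ r₂ : ℝ} (h1 : 0 < r₁) (h2 : 0 < r₂) (φ : ℝ) :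
    KD δ α a ℓ r₁ r₂ φ = ∫ s in Ioi (0 : ℝ), psi (3 / 2 + δ) a r₁ r₂ s * ((wD α φ s ℓ : ℝ) : ℂ) := by
  unfold KD psi bT
  congr 1
  ext s
  rw [if_pos (dS_pos h1 h2 s)]
  ring

lemma vdc_main {m : ℝ} {a : ℝ → ℂ} {c : ℝ} {b' : ℝ → ℂ} (hm : 1 ≤ m) (hc : 0 < c)
    (hb : ∀ t > 0, ‖bT m a t‖ ≤ c * (1 + t) ^ (-m))
    (hbd : ∀ t > 0, HasDerivAt (bT m a) (b' t) t)
    (hb' : ∀ t > 0, ‖b' t‖ ≤ c * (m * t ^ (-m - 1)))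
    {g g' : ℝ → ℂ} {P P' : ℝ → ℝ} {P0 : ℝ}
    (hg : ∀ s > 0, HasDerivAt g (g' s) s) (hP : ∀ s > 0, HasDerivAt P (P' s) s)
    (hgP : ∀ s > 0, ‖g s‖ ≤ P s) (hgP' : ∀ s > 0, ‖g' s‖ ≤ -P' s) (hP0 : ∀ s > 0, P s ≤ P0)
    {r₁ r₂ : ℝ} (h1 : 1 ≤ r₁) (h2 : 1 ≤ r₂)
    (hIntg : IntegrableOn (fun s => psi m a r₁ r₂ s * g s) (Ioi 0)) :
    ‖∫ s in Ioi (0 : ℝ), psi m a r₁ r₂ s * g s‖ ≤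
      9 * c * P0 * (r₁ + r₂) ^ (-m) * (min r₁ r₂) ^ (-(1 / 2) : ℝ) := by
  have p1 : 0 < r₁ := by linarith
  have p2 : 0 < r₂ := by linarith
  have hsl := dS_slope h1 h2
  set ρ := min r₁ r₂ with hρ
  have hρ1 : 1 ≤ ρ := le_min h1 h2
  have hρ0 : 0 < ρ := by linarith
  set u := ρ ^ (-(1 / 2) : ℝ) with hu
  have hu0 : 0 < u := by positivity
  have hP00 : 0 ≤ P0 := (norm_nonneg _).trans ((hgP 1 one_pos).trans (hP0 1 one_pos))
  have hbN : ∀ t > 0, ‖bT m a t‖ ≤ c * t ^ (-m) := by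
    intro t ht
    refine (hb t ht).trans ?_
    gcongr c * ?_
    exact Real.rpow_le_rpow_of_nonpos ht (by linarith) (by linarith)
  set d := dS r₁ r₂ with hd
  have hdp : ∀ s, 0 < d s := dS_pos p1 p2
  set dp : ℝ → ℝ := fun s => r₁ * r₂ * Real.sinh s / d s with hdpd
  have hdppos : ∀ s ≥ u, 0 < dp s := by
    intro s hs
    have := hdp s
    have : 0 < Real.sinh s := Real.sinh_pos_iff.2 (by linarith)
    simp only [hdpd]; positivity
  have key : ∀ U ≥ u, ‖∫ s in u..U, psi m a r₁ r₂ s * g s‖ ≤ 8 * c * P0 * (r₁ + r₂) ^ (-m) * u := by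
    intro U hU
    have h := vdc_abs (d := d) (dp := dp) (u0 := u) (h := fun s => bT m a (d s) * g s)
      (h' := fun s => (dp s • b' (d s)) * g s + bT m a (d s) * g' s)
      (Q := fun s => c * d s ^ (-m) * P s)
      (Q' := fun s => c * (dp s * (-m) * d s ^ (-m - 1)) * P s + c * d s ^ (-m) * P' s)
      (fun s _ => dS_deriv p1 p2 s) (fun s _ => dS_deriv2 p1 p2 s) hdppos
      (fun s _ => dS_deriv2_nonneg p1 p2 s)
      (fun s hs => ((hbd _ (hdp s)).scomp s (dS_deriv p1 p2 s)).mul (hg s (by linarith)))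
      (fun s hs => (((dS_deriv p1 p2 s).rpow_const (Or.inl (hdp s).ne')).const_mul c).mul (hP s (by linarith)))
      (fun s hs => by
        rw [norm_mul]
        have := hbN _ (hdp s)
        have := hgP s (by linarith)
        have := hdp s
        gcongr)
      (fun s hs => by
        have q1 := hb' _ (hdp s)
        have q2 := hbN _ (hdp s)
        have q3 := hgP s (by linarith)
        have q4 := hgP' s (by linarith)
        have q5 := hdppos s hs
        have q6 := hdp s
        calc _ ≤ dp s * ‖b' (d s)‖ * ‖g s‖ + ‖bT m a (d s)‖ * ‖g' s‖ := by
              refine (norm_add_le _ _).trans ?_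
              rw [norm_mul, norm_mul, norm_smul, Real.norm_of_nonneg q5.le]
          _ ≤ dp s * (c * (m * d s ^ (-m - 1))) * P s + c * d s ^ (-m) * (-P' s) := by gcongr
          _ = _ := by ring) U hU
    have e : (fun s => psi m a r₁ r₂ s * g s) = fun s => Complex.exp (Complex.I * (d s : ℂ)) * (bT m a (d s) * g s) := by
      ext s; simp only [psi, hd]; ring
    rw [e]
    refine h.trans ?_
    have hQ0 : 0 ≤ P u := (norm_nonneg _).trans (hgP u hu0)
    have hPu := hP0 u hu0
    have hi : ρ ^ (1 / 2 : ℝ) = u⁻¹ := by rw [hu, Real.rpow_neg hρ0.le, inv_inv]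
    rw [hi] at hsl
    have hdu : d u ^ (-m) ≤ (r₁ + r₂) ^ (-m) :=
      Real.rpow_le_rpow_of_nonpos (by positivity) (dS_ge p1 p2 u) (by linarith)
    have := hdp u
    calc 2 * (c * d u ^ (-m) * P u / dp u) ≤ 2 * (c * (r₁ + r₂) ^ (-m) * P0 / (u⁻¹ / 4)) := by
          gcongr
      _ = _ := by field_simp; ring
  have hiu : IntegrableOn (fun s => psi m a r₁ r₂ s * g s) (Ioi u) := hIntg.mono_set (Ioi_subset_Ioi hu0.le)
  have hfar : ‖∫ s in Ioi u, psi m a r₁ r₂ s * g s‖ ≤ 8 * c * P0 * (r₁ + r₂) ^ (-m) * u := by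
    have ht := (intervalIntegral_tendsto_integral_Ioi u hiu Filter.tendsto_id).norm
    refine le_of_tendsto ht ?_
    filter_upwards [Filter.eventually_ge_atTop u] with U hU using key U hU
  have hnear : ‖∫ s in Ioc 0 u, psi m a r₁ r₂ s * g s‖ ≤ c * P0 * (r₁ + r₂) ^ (-m) * u := by
    have := norm_setIntegral_le_of_norm_le_const (μ := volume) (s := Ioc 0 u) (f := fun s => psi m a r₁ r₂ s * g s)
      (C := c * P0 * (r₁ + r₂) ^ (-m)) (by simp) ?_
    · refine this.trans (le_of_eq ?_)
      simp [measureReal_def, hu0.le]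
    · intro s hs
      rw [norm_mul]
      have q1 := psi_norm (by linarith) hc hb p1 p2 s
      have q2 := (hgP s hs.1).trans (hP0 s hs.1)
      have q3 : (1 + r₁ + r₂) ^ (-m) ≤ (r₁ + r₂) ^ (-m) :=
        Real.rpow_le_rpow_of_nonpos (by positivity) (by linarith) (by linarith)
      calc _ ≤ c * (1 + r₁ + r₂) ^ (-m) * P0 := by gcongr
        _ ≤ c * (r₁ + r₂) ^ (-m) * P0 := by gcongr
        _ = _ := by ring
  have hsplit : ∫ s in Ioi (0 : ℝ), psi m a r₁ r₂ s * g s =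
      (∫ s in Ioc 0 u, psi m a r₁ r₂ s * g s) + ∫ s in Ioi u, psi m a r₁ r₂ s * g s := by
    rw [← Ioc_union_Ioi_eq_Ioi hu0.le]
    exact setIntegral_union (Ioc_disjoint_Ioi le_rfl) measurableSet_Ioi (hIntg.mono_set Ioc_subset_Ioi_self) hiu
  rw [hsplit]
  refine (norm_add_le _ _).trans ((add_le_add hnear hfar).trans (le_of_eq ?_))
  ring

end

section
/-- amplitudes to which van der Corput applies, with size bound `P0` and `L¹` bound `J` -/
def AmpOK (g : ℝ → ℂ) (P0 J : ℝ) : Prop :=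
  IntegrableOn g (Ioi 0) ∧ (∫ s in Ioi (0 : ℝ), ‖g s‖) ≤ J ∧
  ∃ (g' : ℝ → ℂ) (P P' : ℝ → ℝ), (∀ s > 0, HasDerivAt g (g' s) s) ∧ (∀ s > 0, HasDerivAt P (P' s) s) ∧
    (∀ s > 0, ‖g s‖ ≤ P s) ∧ (∀ s > 0, ‖g' s‖ ≤ -P' s) ∧ (∀ s > 0, P s ≤ P0)

lemma psi_meas1 {m : ℝ} {a : ℝ → ℂ} (ha : IsSymbol0 a) (r₁ r₂ : ℝ) : Measurable (fun s => psi m a r₁ r₂ s) := by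
  have h : Measurable (fun s : ℝ => (r₁, r₂, s)) := by fun_prop
  have e : (fun s => psi m a r₁ r₂ s) = (fun z : ℝ × ℝ × ℝ => psi m a z.1 z.2.1 z.2.2) ∘ (fun s : ℝ => (r₁, r₂, s)) := rfl
  rw [e]
  exact Measurable.comp (psi_meas ha (m := m)) h

lemma psi_int {m : ℝ} {a : ℝ → ℂ} (ha : IsSymbol0 a) (hm : 1 ≤ m) {r₁ r₂ : ℝ} (h1 : 0 < r₁) (h2 : 0 < r₂)
    {g : ℝ → ℂ} (hg : IntegrableOn g (Ioi 0)) : IntegrableOn (fun s => psi m a r₁ r₂ s * g s) (Ioi 0) := by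
  obtain ⟨c, b', hc, hb, hbd, hb'⟩ := symbol_bounds ha hm
  have hmeas : Measurable (fun s => psi m a r₁ r₂ s) :=
    psi_meas1 ha r₁ r₂
  have hn : ∀ s, ‖psi m a r₁ r₂ s‖ ≤ c * (1 + r₁ + r₂) ^ (-m) := fun s => psi_norm (by linarith) hc hb h1 h2 s
  have hi : Integrable g (volume.restrict (Ioi 0)) := hg
  have h3 : Integrable (fun s => psi m a r₁ r₂ s * g s) (volume.restrict (Ioi 0)) :=
    hi.bdd_mul hmeas.aestronglyMeasurable (Filter.Eventually.of_forall hn)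
  exact h3

lemma amp_bound {m : ℝ} {a : ℝ → ℂ} (ha : IsSymbol0 a) (hm : 1 ≤ m) :
    ∃ C : ℝ, 0 < C ∧ ∀ (g : ℝ → ℂ) (P0 J : ℝ), AmpOK g P0 J → ∀ r₁ > 0, ∀ r₂ > 0,
      ‖∫ s in Ioi (0 : ℝ), psi m a r₁ r₂ s * g s‖ ≤ C * (1 + r₁ + r₂) ^ (-m) * J ∧
      ‖∫ s in Ioi (0 : ℝ), psi m a r₁ r₂ s * g s‖ ≤
        C * (1 + r₁ + r₂) ^ (-m) * ((1 + min r₁ r₂) ^ (-(1 / 2) : ℝ) * (P0 + J)) := by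
  obtain ⟨c, b', hc, hb, hbd, hb'⟩ := symbol_bounds ha hm
  refine ⟨18 * 2 ^ m * c + 2 * c, by positivity, ?_⟩
  rintro g P0 J ⟨hgi, hJ, g', P, P', hg, hP, hgP, hgP', hP0⟩ r₁ h1 r₂ h2
  have hJ0 : 0 ≤ J := le_trans (integral_nonneg fun s => norm_nonneg _) hJ
  have hP00 : 0 ≤ P0 := (norm_nonneg _).trans ((hgP 1 one_pos).trans (hP0 1 one_pos))
  have hpi := psi_int ha hm h1 h2 hgi
  have hR : 0 ≤ (1 + r₁ + r₂) ^ (-m) := by positivity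
  have htriv : ‖∫ s in Ioi (0 : ℝ), psi m a r₁ r₂ s * g s‖ ≤ c * (1 + r₁ + r₂) ^ (-m) * J := by
    calc _ ≤ ∫ s in Ioi (0 : ℝ), ‖psi m a r₁ r₂ s * g s‖ := norm_integral_le_integral_norm _
      _ ≤ ∫ s in Ioi (0 : ℝ), c * (1 + r₁ + r₂) ^ (-m) * ‖g s‖ := by
          refine integral_mono hpi.norm (hgi.norm.const_mul _) fun s => ?_
          simp only [norm_mul]
          gcongr
          exact psi_norm (by linarith) hc hb h1 h2 s
      _ = c * (1 + r₁ + r₂) ^ (-m) * ∫ s in Ioi (0 : ℝ), ‖g s‖ := integral_const_mul _ _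
      _ ≤ _ := by gcongr
  have h2m : 0 < (2 : ℝ) ^ m := by positivity
  refine ⟨htriv.trans ?_, ?_⟩
  · gcongr
    nlinarith [mul_pos h2m hc]
  · have hρ : 0 < min r₁ r₂ := lt_min h1 h2
    have hE : 0 ≤ (1 + min r₁ r₂) ^ (-(1 / 2) : ℝ) := by positivity
    have h4 : (4 : ℝ) ^ (-(1 / 2) : ℝ) = 1 / 2 := by
      rw [show (4 : ℝ) = 2 ^ (2 : ℝ) by norm_num, ← Real.rpow_mul (by norm_num)]
      norm_num
    by_cases hb1 : 1 ≤ min r₁ r₂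
    · have g1 : 1 ≤ r₁ := hb1.trans (min_le_left _ _)
      have g2 : 1 ≤ r₂ := hb1.trans (min_le_right _ _)
      have hv := vdc_main hm hc hb hbd hb' hg hP hgP hgP' hP0 g1 g2 hpi
      refine hv.trans ?_
      have q1 : (r₁ + r₂) ^ (-m) ≤ 2 ^ m * (1 + r₁ + r₂) ^ (-m) := by
        have : (2 * (r₁ + r₂)) ^ (-m) ≤ (1 + r₁ + r₂) ^ (-m) :=
          Real.rpow_le_rpow_of_nonpos (by positivity) (by linarith) (by linarith)
        rw [Real.mul_rpow (by norm_num) (by positivity)] at this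
        calc (r₁ + r₂) ^ (-m) = 2 ^ m * (2 ^ (-m) * (r₁ + r₂) ^ (-m)) := by
              rw [← mul_assoc, ← Real.rpow_add (by norm_num)]; simp
          _ ≤ _ := by gcongr
      have q2 : (min r₁ r₂) ^ (-(1 / 2) : ℝ) ≤ 2 * (1 + min r₁ r₂) ^ (-(1 / 2) : ℝ) := by
        have : (4 * min r₁ r₂) ^ (-(1 / 2) : ℝ) ≤ (1 + min r₁ r₂) ^ (-(1 / 2) : ℝ) :=
          Real.rpow_le_rpow_of_nonpos (by positivity) (by linarith) (by norm_num)
        rw [Real.mul_rpow (by norm_num) hρ.le, h4] at this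
        linarith
      calc 9 * c * P0 * (r₁ + r₂) ^ (-m) * (min r₁ r₂) ^ (-(1 / 2) : ℝ)
          ≤ 9 * c * P0 * (2 ^ m * (1 + r₁ + r₂) ^ (-m)) * (2 * (1 + min r₁ r₂) ^ (-(1 / 2) : ℝ)) := by gcongr
        _ = (18 * 2 ^ m * c) * (1 + r₁ + r₂) ^ (-m) * ((1 + min r₁ r₂) ^ (-(1 / 2) : ℝ) * P0) := by ring
        _ ≤ _ := by gcongr <;> linarith
    · push Not at hb1
      have q2 : 1 ≤ 2 * (1 + min r₁ r₂) ^ (-(1 / 2) : ℝ) := by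
        have : (4 : ℝ) ^ (-(1 / 2) : ℝ) ≤ (1 + min r₁ r₂) ^ (-(1 / 2) : ℝ) :=
          Real.rpow_le_rpow_of_nonpos (by positivity) (by linarith) (by norm_num)
        rw [h4] at this
        linarith
      calc _ ≤ c * (1 + r₁ + r₂) ^ (-m) * J * 1 := by rw [mul_one]; exact htriv
        _ ≤ c * (1 + r₁ + r₂) ^ (-m) * J * (2 * (1 + min r₁ r₂) ^ (-(1 / 2) : ℝ)) := by gcongr
        _ = (2 * c) * (1 + r₁ + r₂) ^ (-m) * ((1 + min r₁ r₂) ^ (-(1 / 2) : ℝ) * J) := by ring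
        _ ≤ _ := by
            gcongr
            · nlinarith [mul_pos h2m hc]
            · linarith

lemma interp_bound {X A B1 B2 E σ τ K : ℝ} (hX : 0 ≤ X) (hA : 0 ≤ A) (hE : 0 < E) (hσ : 0 < σ) (hK : 0 < K)
    (hτ0 : 0 ≤ τ) (hτ1 : τ ≤ 1)
    (h1 : X ≤ A * B1) (h2 : X ≤ A * (E * B2)) (hB1 : B1 ≤ K * σ ^ (-(1 / 4) : ℝ)) (hB2 : B2 ≤ K * σ ^ (-1 : ℝ)) :
    X ≤ A * K * E ^ τ * σ ^ (-((1 + 3 * τ) / 4)) := by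
  have k1 : X ≤ A * (K * σ ^ (-(1 / 4) : ℝ)) := h1.trans (by gcongr)
  have k2 : X ≤ A * (E * (K * σ ^ (-1 : ℝ))) := h2.trans (by gcongr)
  have e0 : X = X ^ (1 - τ) * X ^ τ := by
    rcases hX.eq_or_lt with h | h
    · rw [← h]
      rcases eq_or_ne τ 0 with h' | h'
      · rw [h']; simp
      · rw [Real.zero_rpow h']; simp
    · rw [← Real.rpow_add h]; simp
  rw [e0]
  calc X ^ (1 - τ) * X ^ τ ≤ (A * (K * σ ^ (-(1 / 4) : ℝ))) ^ (1 - τ) * (A * (E * (K * σ ^ (-1 : ℝ)))) ^ τ := by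
        gcongr
    _ = (A ^ (1 - τ) * A ^ τ) * (K ^ (1 - τ) * K ^ τ) * E ^ τ * ((σ ^ (-(1 / 4) : ℝ)) ^ (1 - τ) * (σ ^ (-1 : ℝ)) ^ τ) := by
        rw [Real.mul_rpow hA (by positivity), Real.mul_rpow hA (by positivity), Real.mul_rpow hK.le (by positivity),
          Real.mul_rpow hE.le (by positivity), Real.mul_rpow hK.le (by positivity)]
        ring
    _ = _ := by
        have e1 : A ^ (1 - τ) * A ^ τ = A := by
          rw [← Real.rpow_add_of_nonneg hA (by linarith) hτ0]; simp
        have e2 : K ^ (1 - τ) * K ^ τ = K := by rw [← Real.rpow_add hK]; simp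
        rw [e1, e2, ← Real.rpow_mul hσ.le, ← Real.rpow_mul hσ.le, ← Real.rpow_add hσ]
        congr 2
        ring

end

section
/-- basic angular amplitude -/
noncomputable def gG (γ x s : ℝ) : ℂ :=
  ((Real.exp (-(γ * s)) : ℝ) : ℂ) * Complex.exp (x * Complex.I) /
    (1 - Complex.exp (x * Complex.I) * ((Real.exp (-s) : ℝ) : ℂ))

lemma gG_meas (γ : ℝ) : Measurable (fun z : ℝ × ℝ => gG γ z.1 z.2) := by
  unfold gG
  refine Measurable.div ?_ ?_
  · exact Continuous.measurable (by fun_prop)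
  · exact Continuous.measurable (by fun_prop)

lemma exp_real_integrable {c : ℝ} (hc : 0 < c) : IntegrableOn (fun s => Real.exp (-(c * s))) (Ioi 0) := by
  have := exp_neg_integrableOn_Ioi 0 hc
  simpa [neg_mul] using this

lemma exp_real_integral {c : ℝ} (hc : 0 < c) : ∫ s in Ioi (0 : ℝ), Real.exp (-(c * s)) = 1 / c := by
  have h := integral_exp_mul_Ioi (a := -c) (by linarith) 0
  simp only [neg_mul] at h
  rw [h]; simp

lemma ampOK_exp {c : ℝ} (hc : 0 < c) : AmpOK (fun s => ((Real.exp (-(c * s)) : ℝ) : ℂ)) 1 (1 / c) := by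
  have hd : ∀ s : ℝ, HasDerivAt (fun s => Real.exp (-(c * s))) (Real.exp (-(c * s)) * (-(c * 1))) s := fun s =>
    (((hasDerivAt_id s).const_mul c).neg).exp
  refine ⟨?_, ?_, fun s => ((Real.exp (-(c * s)) * (-(c * 1)) : ℝ) : ℂ), fun s => Real.exp (-(c * s)),
    fun s => Real.exp (-(c * s)) * (-(c * 1)), ?_, ?_, ?_, ?_, ?_⟩
  · exact (exp_real_integrable hc).ofReal
  · simp only [Complex.norm_real, Real.norm_eq_abs, Real.abs_exp]
    exact (exp_real_integral hc).le
  · intro s _; exact (hd s).ofReal_comp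
  · intro s _; exact hd s
  · intro s _; simp only [Complex.norm_real, Real.norm_eq_abs, Real.abs_exp]; exact le_rfl
  · intro s _
    have := Real.exp_pos (-(c * s))
    rw [Complex.norm_real, Real.norm_eq_abs, abs_of_nonpos (by nlinarith)]
  · intro s hs
    exact Real.exp_le_one_iff.2 (by nlinarith [mul_pos hc hs])

lemma normsq_one_sub (x t : ℝ) : ‖1 - Complex.exp (x * Complex.I) * (t : ℂ)‖ ^ 2 = (1 - t) ^ 2 + 4 * t * |Real.sin (x / 2)| ^ 2 := by
  rw [← Complex.normSq_eq_norm_sq, Complex.normSq_apply, sq_abs, Complex.exp_mul_I]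
  have e : (1 - (Complex.cos x + Complex.sin x * Complex.I) * (t : ℂ)).re = 1 - Real.cos x * t := by
    simp [Complex.cos_ofReal_re, Complex.sin_ofReal_re, ← Complex.ofReal_cos, ← Complex.ofReal_sin]
  have e' : (1 - (Complex.cos x + Complex.sin x * Complex.I) * (t : ℂ)).im = - (Real.sin x * t) := by
    simp [← Complex.ofReal_cos, ← Complex.ofReal_sin]
  rw [e, e']
  have h1 := Real.sin_sq_add_cos_sq x
  have h2 : Real.cos x = 1 - 2 * Real.sin (x / 2) ^ 2 := by
    have := Real.cos_two_mul (x / 2)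
    have h3 := Real.sin_sq_add_cos_sq (x / 2)
    rw [show 2 * (x / 2) = x by ring] at this
    linarith
  have h4 : Real.sin x ^ 2 = 1 - Real.cos x ^ 2 := by linarith
  calc (1 - Real.cos x * t) * (1 - Real.cos x * t) + -(Real.sin x * t) * -(Real.sin x * t)
      = 1 - 2 * t * Real.cos x + Real.cos x ^ 2 * t ^ 2 + Real.sin x ^ 2 * t ^ 2 := by ring
    _ = 1 - 2 * t * Real.cos x + t ^ 2 := by rw [h4]; ring
    _ = _ := by rw [h2]; ring

lemma one_sub_ge_sig (x : ℝ) {t : ℝ} (h0 : 0 ≤ t) : |Real.sin (x / 2)| ≤ ‖1 - Complex.exp (x * Complex.I) * (t : ℂ)‖ := by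
  apply le_of_sq_le_sq _ (norm_nonneg _)
  rw [normsq_one_sub]
  have h1 : |Real.sin (x / 2)| ^ 2 ≤ 1 := by rw [sq_abs]; exact Real.sin_sq_le_one _
  have h2 : 0 ≤ |Real.sin (x / 2)| ^ 2 := by positivity
  set v := |Real.sin (x / 2)| ^ 2
  rcases le_total (1 / 4) t with h | h
  · nlinarith [sq_nonneg (1 - t)]
  · nlinarith [sq_nonneg t, mul_nonneg (by linarith : (0 : ℝ) ≤ 1 - 4 * t) (by linarith : (0 : ℝ) ≤ 1 - v)]

lemma one_sub_ge_t (x : ℝ) {t : ℝ} (h0 : 0 ≤ t) (h1 : t ≤ 1) : 1 - t ≤ ‖1 - Complex.exp (x * Complex.I) * (t : ℂ)‖ := by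
  apply le_of_sq_le_sq _ (norm_nonneg _)
  rw [normsq_one_sub]
  have : 0 ≤ 4 * t * |Real.sin (x / 2)| ^ 2 := by positivity
  linarith

lemma majorant_integrable {γ : ℝ} (hγ : 0 < γ) :
    IntegrableOn (fun s => Real.exp (-(γ * s)) * (1 - Real.exp (-s)) ^ (-(3 / 4) : ℝ)) (Ioi 0) := by
  have i1 := integrableOn_rpow_mul_exp_neg_mul_rpow (p := 1) (s := -(3 / 4)) (b := γ) (by norm_num) one_pos hγ
  have i2 := integrableOn_rpow_mul_exp_neg_mul_rpow (p := 1) (s := 1 / 4) (b := γ) (by norm_num) one_pos hγ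
  have i3 := i1.add i2
  refine Integrable.mono' i3 ?_ ?_
  · apply Measurable.aestronglyMeasurable
    have h : Measurable (fun s : ℝ => 1 - Real.exp (-s)) := by fun_prop
    exact Measurable.mul (by fun_prop) (h.pow_const _)
  · filter_upwards [ae_restrict_mem measurableSet_Ioi] with s hs
    have hs0 : (0 : ℝ) < s := hs
    have hlow : s / (1 + s) ≤ 1 - Real.exp (-s) := by
      have h1 : 1 + s ≤ Real.exp s := by linarith [Real.add_one_le_exp s]
      have h2 : Real.exp (-s) ≤ 1 / (1 + s) := by
        rw [Real.exp_neg, ← one_div]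
        exact one_div_le_one_div_of_le (by linarith) h1
      have h3 : s / (1 + s) = 1 - 1 / (1 + s) := by field_simp; ring
      linarith
    have hpos : 0 < s / (1 + s) := by positivity
    have hle : (1 - Real.exp (-s)) ^ (-(3 / 4) : ℝ) ≤ (s / (1 + s)) ^ (-(3 / 4) : ℝ) :=
      Real.rpow_le_rpow_of_nonpos hpos hlow (by norm_num)
    have hle2 : (s / (1 + s)) ^ (-(3 / 4) : ℝ) ≤ s ^ (-(3 / 4) : ℝ) + s ^ (1 / 4 : ℝ) := by
      rw [Real.div_rpow hs0.le (by linarith), Real.rpow_neg (by linarith : (0 : ℝ) ≤ 1 + s), div_inv_eq_mul]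
      have : (1 + s) ^ (3 / 4 : ℝ) ≤ 1 + s := by
        nth_rewrite 2 [← Real.rpow_one (1 + s)]
        exact Real.rpow_le_rpow_of_exponent_le (by linarith) (by norm_num)
      calc s ^ (-(3 / 4) : ℝ) * (1 + s) ^ (3 / 4 : ℝ) ≤ s ^ (-(3 / 4) : ℝ) * (1 + s) := by gcongr
        _ = s ^ (-(3 / 4) : ℝ) + s ^ (-(3 / 4) : ℝ) * s ^ (1 : ℝ) := by rw [Real.rpow_one]; ring
        _ = _ := by rw [← Real.rpow_add hs0]; norm_num
    have hp : 0 ≤ (1 - Real.exp (-s)) ^ (-(3 / 4) : ℝ) := Real.rpow_nonneg (by linarith) _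
    rw [Real.norm_of_nonneg (by positivity)]
    simp only [Pi.add_apply, Real.rpow_one, neg_mul]
    calc _ ≤ Real.exp (-(γ * s)) * (s ^ (-(3 / 4) : ℝ) + s ^ (1 / 4 : ℝ)) := by gcongr; exact hle.trans hle2
      _ = _ := by ring

lemma gG_norm_le {γ x s : ℝ} (hs : 0 < s) (hx : 0 < |Real.sin (x / 2)|) :
    ‖gG γ x s‖ ≤ |Real.sin (x / 2)| ^ (-(1 / 4) : ℝ) * (Real.exp (-(γ * s)) * (1 - Real.exp (-s)) ^ (-(3 / 4) : ℝ)) := by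
  set σ := |Real.sin (x / 2)|
  set t := Real.exp (-s) with ht
  have t0 : 0 < t := Real.exp_pos _
  have t1 : t < 1 := Real.exp_lt_one_iff.2 (by linarith)
  have n1 := one_sub_ge_sig x t0.le
  have n2 := one_sub_ge_t x t0.le t1.le
  unfold gG
  rw [norm_div, norm_mul, Complex.norm_exp_ofReal_mul_I, mul_one, Complex.norm_real, Real.norm_eq_abs, Real.abs_exp, ← ht]
  set V := ‖1 - Complex.exp (x * Complex.I) * (t : ℂ)‖
  have hV : 0 < V := by linarith
  have k1 : V ^ (-(1 / 4) : ℝ) ≤ σ ^ (-(1 / 4) : ℝ) := Real.rpow_le_rpow_of_nonpos hx n1 (by norm_num)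
  have k2 : V ^ (-(3 / 4) : ℝ) ≤ (1 - t) ^ (-(3 / 4) : ℝ) := Real.rpow_le_rpow_of_nonpos (by linarith) n2 (by norm_num)
  have k3 : V⁻¹ = V ^ (-(1 / 4) : ℝ) * V ^ (-(3 / 4) : ℝ) := by
    rw [← Real.rpow_add hV]; norm_num [Real.rpow_neg_one]
  rw [div_eq_mul_inv, k3]
  have k4 : 0 < 1 - t := by linarith
  calc _ ≤ Real.exp (-(γ * s)) * (σ ^ (-(1 / 4) : ℝ) * (1 - t) ^ (-(3 / 4) : ℝ)) := by gcongr
    _ = _ := by ring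

lemma ampOK_gG {γ : ℝ} (hγ : 0 < γ) : ∃ K : ℝ, 0 < K ∧ ∀ x : ℝ, 0 < |Real.sin (x / 2)| →
    AmpOK (gG γ x) (5 / |Real.sin (x / 2)|) (K * |Real.sin (x / 2)| ^ (-(1 / 4) : ℝ)) := by
  refine ⟨(∫ s in Ioi (0 : ℝ), Real.exp (-(γ * s)) * (1 - Real.exp (-s)) ^ (-(3 / 4) : ℝ)) + 1, ?_, ?_⟩
  · have : 0 ≤ ∫ s in Ioi (0 : ℝ), Real.exp (-(γ * s)) * (1 - Real.exp (-s)) ^ (-(3 / 4) : ℝ) := by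
      refine setIntegral_nonneg measurableSet_Ioi fun s hs => ?_
      have hs' : (0 : ℝ) < s := hs
      have : Real.exp (-s) < 1 := Real.exp_lt_one_iff.2 (by linarith)
      have := Real.rpow_nonneg (by linarith : 0 ≤ 1 - Real.exp (-s)) (-(3 / 4) : ℝ)
      positivity
    linarith
  intro x hx
  set σ := |Real.sin (x / 2)| with hσ
  have hm : Measurable (gG γ x) := by
    have h : Measurable (fun s : ℝ => (x, s)) := by fun_prop
    have e : gG γ x = (fun z : ℝ × ℝ => gG γ z.1 z.2) ∘ (fun s : ℝ => (x, s)) := rfl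
    rw [e]
    exact Measurable.comp (gG_meas γ) h
  have hI := (majorant_integrable hγ).const_mul (σ ^ (-(1 / 4) : ℝ))
  have hle : ∀ᵐ s ∂(volume.restrict (Ioi (0 : ℝ))), ‖gG γ x s‖ ≤ σ ^ (-(1 / 4) : ℝ) * (Real.exp (-(γ * s)) * (1 - Real.exp (-s)) ^ (-(3 / 4) : ℝ)) := by
    filter_upwards [ae_restrict_mem measurableSet_Ioi] with s hs using gG_norm_le hs hx
  have hgi : IntegrableOn (gG γ x) (Ioi 0) := Integrable.mono' hI hm.aestronglyMeasurable hle
  set ζ := Complex.exp (x * Complex.I) with hζ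
  have hζn : ‖ζ‖ = 1 := Complex.norm_exp_ofReal_mul_I x
  have hde : ∀ s : ℝ, HasDerivAt (fun s => Real.exp (-(γ * s))) (Real.exp (-(γ * s)) * (-(γ * 1))) s := fun s =>
    (((hasDerivAt_id s).const_mul γ).neg).exp
  have hdt : ∀ s : ℝ, HasDerivAt (fun s => Real.exp (-s)) (Real.exp (-s) * (-1)) s := fun s =>
    ((hasDerivAt_id s).neg).exp
  have hV : ∀ s > 0, 0 < ‖1 - ζ * ((Real.exp (-s) : ℝ) : ℂ)‖ := fun s hs =>
    lt_of_lt_of_le hx (one_sub_ge_sig x (Real.exp_pos _).le)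
  refine ⟨hgi, ?_, fun s => ((((Real.exp (-(γ * s)) * (-(γ * 1)) : ℝ) : ℂ) * ζ) * (1 - ζ * ((Real.exp (-s) : ℝ) : ℂ)) -
      (((Real.exp (-(γ * s)) : ℝ) : ℂ) * ζ) * (-(ζ * ((Real.exp (-s) * (-1) : ℝ) : ℂ)))) / (1 - ζ * ((Real.exp (-s) : ℝ) : ℂ)) ^ 2,
    fun s => Real.exp (-(γ * s)) / σ + 4 / ((1 - Real.exp (-s)) + σ),
    fun s => Real.exp (-(γ * s)) * (-(γ * 1)) / σ + 4 * (-(-(Real.exp (-s) * (-1))) / ((1 - Real.exp (-s)) + σ) ^ 2), ?_, ?_, ?_, ?_, ?_⟩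
  · calc _ ≤ ∫ s in Ioi (0 : ℝ), σ ^ (-(1 / 4) : ℝ) * (Real.exp (-(γ * s)) * (1 - Real.exp (-s)) ^ (-(3 / 4) : ℝ)) :=
          integral_mono_ae hgi.norm hI hle
      _ = σ ^ (-(1 / 4) : ℝ) * _ := integral_const_mul _ _
      _ ≤ _ := by
          rw [mul_comm]
          gcongr
          linarith
  · intro s hs
    have h1 := ((hde s).ofReal_comp).mul_const ζ
    have h2 := (((hdt s).ofReal_comp).const_mul ζ).const_sub 1
    exact h1.div h2 (norm_pos_iff.1 (hV s hs))
  · intro s hs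
    have t1 : Real.exp (-s) < 1 := Real.exp_lt_one_iff.2 (by linarith)
    have h2 := (((hdt s).const_sub 1).add_const σ).inv (by linarith)
    have h3 := ((hde s).div_const σ).add (h2.const_mul 4)
    exact h3
  · intro s hs
    have t1 : Real.exp (-s) < 1 := Real.exp_lt_one_iff.2 (by linarith)
    have n1 := one_sub_ge_sig x (Real.exp_pos (-s)).le
    unfold gG
    rw [norm_div, norm_mul, ← hζ, hζn, mul_one, Complex.norm_real, Real.norm_eq_abs, Real.abs_exp]
    have : 0 ≤ 4 / ((1 - Real.exp (-s)) + σ) := by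
      apply div_nonneg <;> linarith
    have : Real.exp (-(γ * s)) / ‖1 - ζ * ((Real.exp (-s) : ℝ) : ℂ)‖ ≤ Real.exp (-(γ * s)) / σ := by gcongr
    linarith
  · intro s hs
    beta_reduce
    have hVs := hV s hs
    have n1 := one_sub_ge_sig x (Real.exp_pos (-s)).le
    have t0 := Real.exp_pos (-s)
    have t1 : Real.exp (-s) < 1 := Real.exp_lt_one_iff.2 (by linarith)
    have n2 := one_sub_ge_t x t0.le t1.le
    have x0 := Real.exp_pos (-(γ * s))
    have x1 : Real.exp (-(γ * s)) ≤ 1 := Real.exp_le_one_iff.2 (by nlinarith [mul_pos hγ hs])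
    rw [← hζ, ← hσ] at n1
    rw [← hζ] at n2
    set w := 1 - ζ * ((Real.exp (-s) : ℝ) : ℂ) with hw
    have hw0 : w ≠ 0 := norm_pos_iff.1 hVs
    have e1 : ((((Real.exp (-(γ * s)) * (-(γ * 1)) : ℝ) : ℂ) * ζ) * w -
      (((Real.exp (-(γ * s)) : ℝ) : ℂ) * ζ) * (-(ζ * ((Real.exp (-s) * (-1) : ℝ) : ℂ)))) / w ^ 2
      = -(((Real.exp (-(γ * s)) : ℝ) : ℂ) * (γ : ℂ) * ζ / w) - ((Real.exp (-(γ * s)) : ℝ) : ℂ) * ζ * (ζ * ((Real.exp (-s) : ℝ) : ℂ)) / w ^ 2 := by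
      push_cast
      field_simp
    rw [e1]
    refine (norm_sub_le _ _).trans ?_
    simp only [norm_neg, norm_div, norm_mul, norm_pow, hζn, mul_one, one_mul, Complex.norm_real, Real.norm_eq_abs, Real.abs_exp]
    rw [abs_of_pos hγ]
    have k1 : Real.exp (-(γ * s)) * γ / ‖w‖ ≤ Real.exp (-(γ * s)) * γ / σ := by gcongr
    have k2 : Real.exp (-(γ * s)) * Real.exp (-s) / ‖w‖ ^ 2 ≤ 1 * Real.exp (-s) / (((1 - Real.exp (-s)) + σ) / 2) ^ 2 := by
      gcongr
      linarith
    have e2 : 1 * Real.exp (-s) / (((1 - Real.exp (-s)) + σ) / 2) ^ 2 = 4 * (Real.exp (-s) / ((1 - Real.exp (-s)) + σ) ^ 2) := by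
      have : (1 - Real.exp (-s)) + σ ≠ 0 := by linarith
      field_simp
      norm_num
    rw [e2] at k2
    refine (add_le_add k1 k2).trans (le_of_eq ?_)
    ring
  · intro s hs
    have t1 : Real.exp (-s) < 1 := Real.exp_lt_one_iff.2 (by linarith)
    have x1 : Real.exp (-(γ * s)) ≤ 1 := Real.exp_le_one_iff.2 (by nlinarith [mul_pos hγ hs])
    calc Real.exp (-(γ * s)) / σ + 4 / ((1 - Real.exp (-s)) + σ) ≤ 1 / σ + 4 / σ := by
          gcongr
          linarith
      _ = _ := by ring

end

section
lemma eN_integral {n : ℤ} (hn : n ≠ 0) : ∫ φ, eN n φ ∂nuC = 0 := by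
  have h := per_int_sub_right (eN n) (eN_per n) (π / n)
  have hn' : (n : ℂ) ≠ 0 := by exact_mod_cast hn
  have e : ∀ x : ℝ, eN n (x - π / n) = eN n x * (-1) := by
    intro x
    rw [sub_eq_add_neg, eN_add]
    congr 1
    unfold eN
    push_cast
    rw [show -((n : ℂ) * -(π / n) * Complex.I) = π * Complex.I by field_simp]
    exact Complex.exp_pi_mul_I
  simp only [e] at h
  rw [integral_mul_const] at h
  have h2 : (2 : ℂ) * ∫ φ, eN n φ ∂nuC = 0 := by linear_combination -h
  simpa using h2

lemma eN_mul (n k : ℤ) (φ : ℝ) : eN n φ * eN k φ = eN (n + k) φ := by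
  unfold eN
  rw [← Complex.exp_add]
  congr 1
  push_cast
  ring

lemma nuC_univ : nuC.real univ = 2 * π := by
  have : (0 : ℝ) ≤ 2 * π := by positivity
  simp [nuC, measureReal_def, pi_pos.le]

lemma eN_integral_norm (n : ℤ) : ‖∫ φ, eN n φ ∂nuC‖ ≤ 2 * π := by
  have := norm_integral_le_of_norm_le_const (μ := nuC) (f := eN n) (C := 1) (Filter.Eventually.of_forall fun x => (eN_norm n x).le)
  rwa [nuC_univ, one_mul] at this

lemma eN_integrable (n : ℤ) : Integrable (eN n) nuC := by
  have : Integrable (fun _ : ℝ => (1 : ℝ)) nuC := integrable_const _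
  exact this.mono' (eN_cont n).aestronglyMeasurable (Filter.Eventually.of_forall fun x => (eN_norm n x).le)

lemma gG_series {γ : ℝ} {e : ℤ} (he : e = 1 ∨ e = -1) {s : ℝ} (hs : 0 < s) (φ : ℝ) :
    HasSum (fun k : ℕ => (((-1) ^ (k + 1) * Real.exp (-((γ + k) * s)) : ℝ) : ℂ) * eN (-(e * (k + 1))) φ)
      (gG γ (e * (φ + π)) s) := by
  have t1 : Real.exp (-s) < 1 := Real.exp_lt_one_iff.2 (by linarith)
  have hζ : Complex.exp (((e * (φ + π) : ℝ) : ℂ) * Complex.I) = -eN (-e) φ := by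
    have h1 : (((e * (φ + π) : ℝ) : ℂ) * Complex.I) = -(((-e : ℤ) : ℂ) * φ * Complex.I) + e * (π * Complex.I) := by
      push_cast; ring
    rw [h1, Complex.exp_add, Complex.exp_int_mul, Complex.exp_pi_mul_I]
    unfold eN
    rcases he with h | h <;> simp [h]
  set ζ := Complex.exp (((e * (φ + π) : ℝ) : ℂ) * Complex.I) with hζd
  have hζn : ‖ζ‖ = 1 := Complex.norm_exp_ofReal_mul_I _
  have hg := hasSum_geometric_of_norm_lt_one (ξ := ζ * ((Real.exp (-s) : ℝ) : ℂ)) (by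
    rw [norm_mul, hζn, one_mul, Complex.norm_real, Real.norm_eq_abs, Real.abs_exp]; exact t1)
  have h2 := hg.mul_left (((Real.exp (-(γ * s)) : ℝ) : ℂ) * ζ)
  have e2 : ((Real.exp (-(γ * s)) : ℝ) : ℂ) * ζ * (1 - ζ * ((Real.exp (-s) : ℝ) : ℂ))⁻¹ = gG γ (e * (φ + π)) s := by
    unfold gG
    rw [← hζd, div_eq_mul_inv]
  rw [e2] at h2
  have hpow : ∀ k : ℕ, eN (-e) φ ^ (k + 1) = eN (-(e * (k + 1))) φ := by
    intro k
    unfold eN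
    rw [← Complex.exp_nat_mul]
    congr 1
    push_cast
    ring
  have e3 : (fun k : ℕ => (((-1) ^ (k + 1) * Real.exp (-((γ + k) * s)) : ℝ) : ℂ) * eN (-(e * (k + 1))) φ)
      = fun k : ℕ => ((Real.exp (-(γ * s)) : ℝ) : ℂ) * ζ * (ζ * ((Real.exp (-s) : ℝ) : ℂ)) ^ k := by
    funext k
    have e4 : Real.exp (-((γ + k) * s)) = Real.exp (-(γ * s)) * Real.exp (-s) ^ k := by
      rw [← Real.exp_nat_mul, ← Real.exp_add]
      congr 1
      ring
    rw [← hpow, e4, mul_pow, hζ, neg_pow (eN (-e) φ) k]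
    push_cast
    ring
  rw [e3]
  exact h2

lemma gG_fourier {γ : ℝ} {e : ℤ} (he : e = 1 ∨ e = -1) (n : ℤ) :
    ∃ (c : ℂ) (κ : ℝ), ‖c‖ ≤ 2 * π ∧ γ ≤ κ ∧ ∀ s > 0,
      ∫ φ, eN n φ * gG γ (e * (φ + π)) s ∂nuC = c * ((Real.exp (-(κ * s)) : ℝ) : ℂ) := by
  have hsum : ∀ s > 0, HasSum (fun k : ℕ => (((-1) ^ (k + 1) * Real.exp (-((γ + k) * s)) : ℝ) : ℂ) * ∫ φ, eN (n + -(e * (k + 1))) φ ∂nuC)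
      (∫ φ, eN n φ * gG γ (e * (φ + π)) s ∂nuC) := by
    intro s hs
    have t1 : Real.exp (-s) < 1 := Real.exp_lt_one_iff.2 (by linarith)
    set F : ℕ → ℝ → ℂ := fun k φ => (((-1) ^ (k + 1) * Real.exp (-((γ + k) * s)) : ℝ) : ℂ) * eN (n + -(e * (k + 1))) φ with hF
    have hn : ∀ k φ, ‖F k φ‖ = Real.exp (-(γ * s)) * Real.exp (-s) ^ k := by
      intro k φ
      simp only [hF]
      rw [norm_mul, eN_norm, mul_one, Complex.norm_real, Real.norm_eq_abs, abs_mul, abs_pow, abs_neg, abs_one, one_pow, one_mul,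
        Real.abs_exp, ← Real.exp_nat_mul, ← Real.exp_add]
      congr 1
      ring
    have h1 := hasSum_integral_of_summable_integral_norm (μ := nuC) (F := F) (fun k => (eN_integrable _).const_mul _) (by
      simp only [hn, integral_const, nuC_univ, smul_eq_mul]
      exact ((summable_geometric_of_lt_one (Real.exp_pos _).le t1).mul_left _).mul_left _)
    have e1 : ∀ φ, ∑' k, F k φ = eN n φ * gG γ (e * (φ + π)) s := by
      intro φ
      have h2 := (gG_series (γ := γ) he hs φ).mul_left (eN n φ)
      rw [← h2.tsum_eq]
      congr 1
      funext k
      simp only [hF]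
      rw [← eN_mul]
      ring
    simp only [e1] at h1
    have e2 : (fun k : ℕ => (((-1) ^ (k + 1) * Real.exp (-((γ + k) * s)) : ℝ) : ℂ) * ∫ φ, eN (n + -(e * (k + 1))) φ ∂nuC)
        = fun k => ∫ φ, F k φ ∂nuC := by
      funext k
      simp only [hF]
      rw [integral_const_mul]
    rw [e2]
    exact h1
  by_cases hk : ∃ k : ℕ, n + -(e * (k + 1)) = 0
  · obtain ⟨k0, hk0⟩ := hk
    refine ⟨(-1) ^ (k0 + 1) * ∫ φ, eN (n + -(e * (k0 + 1))) φ ∂nuC, γ + k0, ?_, by simp, ?_⟩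
    · rw [norm_mul]; simpa using eN_integral_norm _
    · intro s hs
      refine (hsum s hs).unique ?_
      have h3 := hasSum_single (f := fun k : ℕ => (((-1) ^ (k + 1) * Real.exp (-((γ + k) * s)) : ℝ) : ℂ) * ∫ φ, eN (n + -(e * (k + 1))) φ ∂nuC) k0 (by
        intro k hk
        have hne : n + -(e * (k + 1)) ≠ 0 := by
          intro h
          apply hk
          have : e * (k + 1) = e * (k0 + 1) := by linarith
          have he0 : e ≠ 0 := by rcases he with h | h <;> simp [h]
          have := mul_left_cancel₀ he0 this
          have : (k : ℤ) = k0 := by linarith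
          exact_mod_cast this
        rw [eN_integral hne, mul_zero])
      have e5 : (-1) ^ (k0 + 1) * (∫ φ, eN (n + -(e * (k0 + 1))) φ ∂nuC) * ((Real.exp (-((γ + k0) * s)) : ℝ) : ℂ)
        = (((-1) ^ (k0 + 1) * Real.exp (-((γ + k0) * s)) : ℝ) : ℂ) * ∫ φ, eN (n + -(e * (k0 + 1))) φ ∂nuC := by
        push_cast; ring
      rw [e5]
      exact h3
  · push Not at hk
    refine ⟨0, γ, by simp [pi_pos.le], le_rfl, ?_⟩
    intro s hs
    refine (hsum s hs).unique ?_
    have : (fun k : ℕ => (((-1) ^ (k + 1) * Real.exp (-((γ + k) * s)) : ℝ) : ℂ) * ∫ φ, eN (n + -(e * (k + 1))) φ ∂nuC) = fun _ => 0 := by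
      funext k
      rw [eN_integral (hk k), mul_zero]
    rw [this, zero_mul]
    exact hasSum_zero

end

section
/-- integrability, size and Fourier bounds for a kernel -/
structure KLin (δ : ℝ) (k : ℝ → ℝ → ℝ → ℂ) : Prop where
  int : ∀ r₁ > 0, ∀ r₂ > 0, Integrable (k r₁ r₂) nuC
  size : ∀ τ : ℝ, 0 ≤ τ → τ ≤ 1 → ∃ C : ℝ, 0 < C ∧ ∀ r₁ > 0, ∀ r₂ > 0, ∀ φ,
    ‖k r₁ r₂ φ‖ₑ ≤ ENNReal.ofReal (C * (1 + r₁ + r₂) ^ (-(3 / 2 + δ)) * (1 + min r₁ r₂) ^ (-(τ / 2))) * SS ((1 + 3 * τ) / 4) φ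
  four : ∃ C : ℝ, 0 < C ∧ ∀ r₁ > 0, ∀ r₂ > 0, ∀ n : ℤ,
    ‖∫ φ, eN n φ * k r₁ r₂ φ ∂nuC‖ ≤ C * (1 + r₁ + r₂) ^ (-(3 / 2 + δ)) * (1 + min r₁ r₂) ^ (-(1 / 2 : ℝ))

lemma sg_pos_ae : ∀ᵐ φ ∂nuC, 0 < sg φ := by
  have h := ae_lt_top (SS_meas (1 / 4)) (SS_int (1 / 4) (by norm_num) (by norm_num))
  filter_upwards [h] with φ hφ
  rcases (sg_nonneg φ).eq_or_lt with h0 | h0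
  · exfalso
    unfold SS at hφ
    rw [← h0, ENNReal.ofReal_zero, ENNReal.zero_rpow_of_neg (by norm_num)] at hφ
    exact lt_irrefl _ hφ
  · exact h0

lemma SS_top {κ φ : ℝ} (hκ : 0 < κ) (h : ¬ 0 < sg φ) : SS κ φ = ⊤ := by
  have : sg φ = 0 := le_antisymm (not_lt.1 h) (sg_nonneg φ)
  unfold SS
  rw [this, ENNReal.ofReal_zero, ENNReal.zero_rpow_of_neg (by linarith)]

lemma SS_pos_eq {κ φ : ℝ} (h : 0 < sg φ) : SS κ φ = ENNReal.ofReal (sg φ ^ (-κ)) := by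
  unfold SS
  rw [ENNReal.ofReal_rpow_of_pos h]

lemma sg_le_one (φ : ℝ) : sg φ ≤ 1 := Real.abs_sin_le_one _

lemma sg_int : Integrable (fun φ => sg φ ^ (-(1 / 4) : ℝ)) nuC := by
  refine ⟨(sg_cont.measurable.pow_const _).aestronglyMeasurable, ?_⟩
  unfold HasFiniteIntegral
  have : ∫⁻ φ, ‖sg φ ^ (-(1 / 4) : ℝ)‖ₑ ∂nuC = ∫⁻ φ, SS (1 / 4) φ ∂nuC := by
    apply lintegral_congr_ae
    filter_upwards [sg_pos_ae] with φ hφ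
    rw [SS_pos_eq hφ, ← ofReal_norm, Real.norm_of_nonneg (by positivity)]
  rw [this]
  exact (SS_int (1 / 4) (by norm_num) (by norm_num)).lt_top

namespace KLin

variable {δ : ℝ} {k k' : ℝ → ℝ → ℝ → ℂ}

lemma add (h : KLin δ k) (h' : KLin δ k') : KLin δ (fun r₁ r₂ φ => k r₁ r₂ φ + k' r₁ r₂ φ) := by
  refine ⟨fun r₁ h1 r₂ h2 => (h.int r₁ h1 r₂ h2).add (h'.int r₁ h1 r₂ h2), ?_, ?_⟩
  · intro τ h0 h1
    obtain ⟨C, hC, hk⟩ := h.size τ h0 h1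
    obtain ⟨C', hC', hk'⟩ := h'.size τ h0 h1
    refine ⟨C + C', by positivity, ?_⟩
    intro r₁ p1 r₂ p2 φ
    have hρ : 0 < min r₁ r₂ := lt_min p1 p2
    refine (enorm_add_le _ _).trans ((add_le_add (hk r₁ p1 r₂ p2 φ) (hk' r₁ p1 r₂ p2 φ)).trans (le_of_eq ?_))
    rw [← add_mul, ← ENNReal.ofReal_add (by positivity) (by positivity)]
    congr 2
    ring
  · obtain ⟨C, hC, hk⟩ := h.four
    obtain ⟨C', hC', hk'⟩ := h'.four
    refine ⟨C + C', by positivity, ?_⟩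
    intro r₁ p1 r₂ p2 n
    have i1 : Integrable (fun φ => eN n φ * k r₁ r₂ φ) nuC :=
      (h.int r₁ p1 r₂ p2).bdd_mul (c := 1) (eN_cont n).aestronglyMeasurable (Filter.Eventually.of_forall fun x => (eN_norm n x).le)
    have i2 : Integrable (fun φ => eN n φ * k' r₁ r₂ φ) nuC :=
      (h'.int r₁ p1 r₂ p2).bdd_mul (c := 1) (eN_cont n).aestronglyMeasurable (Filter.Eventually.of_forall fun x => (eN_norm n x).le)
    simp only [mul_add]
    rw [integral_add i1 i2]
    refine (norm_add_le _ _).trans ((add_le_add (hk r₁ p1 r₂ p2 n) (hk' r₁ p1 r₂ p2 n)).trans (le_of_eq ?_))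
    ring

lemma smul (h : KLin δ k) (c : ℂ) : KLin δ (fun r₁ r₂ φ => c * k r₁ r₂ φ) := by
  refine ⟨fun r₁ h1 r₂ h2 => (h.int r₁ h1 r₂ h2).const_mul c, ?_, ?_⟩
  · intro τ h0 h1
    obtain ⟨C, hC, hk⟩ := h.size τ h0 h1
    refine ⟨(‖c‖ + 1) * C, by positivity, ?_⟩
    intro r₁ p1 r₂ p2 φ
    have hρ : 0 < min r₁ r₂ := lt_min p1 p2
    rw [enorm_mul, ← ofReal_norm c]
    calc _ ≤ ENNReal.ofReal ‖c‖ * (ENNReal.ofReal (C * (1 + r₁ + r₂) ^ (-(3 / 2 + δ)) * (1 + min r₁ r₂) ^ (-(τ / 2))) * SS ((1 + 3 * τ) / 4) φ) := by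
          gcongr; exact hk r₁ p1 r₂ p2 φ
      _ = ENNReal.ofReal (‖c‖ * (C * (1 + r₁ + r₂) ^ (-(3 / 2 + δ)) * (1 + min r₁ r₂) ^ (-(τ / 2)))) * SS ((1 + 3 * τ) / 4) φ := by
          rw [← mul_assoc, ← ENNReal.ofReal_mul (norm_nonneg _)]
      _ ≤ ENNReal.ofReal ((‖c‖ + 1) * (C * (1 + r₁ + r₂) ^ (-(3 / 2 + δ)) * (1 + min r₁ r₂) ^ (-(τ / 2)))) * SS ((1 + 3 * τ) / 4) φ := by
          gcongr
          linarith
      _ = _ := by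
          congr 2
          ring
  · obtain ⟨C, hC, hk⟩ := h.four
    refine ⟨(‖c‖ + 1) * C, by positivity, ?_⟩
    intro r₁ p1 r₂ p2 n
    have hρ : 0 < min r₁ r₂ := lt_min p1 p2
    have e : ∀ φ, eN n φ * (c * k r₁ r₂ φ) = c * (eN n φ * k r₁ r₂ φ) := fun φ => by ring
    simp only [e]
    rw [integral_const_mul, norm_mul]
    calc _ ≤ ‖c‖ * (C * (1 + r₁ + r₂) ^ (-(3 / 2 + δ)) * (1 + min r₁ r₂) ^ (-(1 / 2 : ℝ))) := by
          gcongr; exact hk r₁ p1 r₂ p2 n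
      _ ≤ (‖c‖ + 1) * (C * (1 + r₁ + r₂) ^ (-(3 / 2 + δ)) * (1 + min r₁ r₂) ^ (-(1 / 2 : ℝ))) := by
          gcongr
          linarith
      _ = _ := by ring

lemma congr (h : KLin δ k) (he : ∀ r₁ > 0, ∀ r₂ > 0, ∀ φ, 0 < sg φ → k' r₁ r₂ φ = k r₁ r₂ φ) : KLin δ k' := by
  have hae : ∀ r₁ > 0, ∀ r₂ > 0, k r₁ r₂ =ᵐ[nuC] k' r₁ r₂ := by
    intro r₁ p1 r₂ p2
    filter_upwards [sg_pos_ae] with φ hφ using (he r₁ p1 r₂ p2 φ hφ).symm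
  refine ⟨fun r₁ p1 r₂ p2 => (h.int r₁ p1 r₂ p2).congr (hae r₁ p1 r₂ p2), ?_, ?_⟩
  · intro τ h0 h1
    obtain ⟨C, hC, hk⟩ := h.size τ h0 h1
    refine ⟨C, hC, fun r₁ p1 r₂ p2 φ => ?_⟩
    have hρ : 0 < min r₁ r₂ := lt_min p1 p2
    by_cases hs : 0 < sg φ
    · rw [he r₁ p1 r₂ p2 φ hs]; exact hk r₁ p1 r₂ p2 φ
    · rw [SS_top (by linarith) hs, ENNReal.mul_top]
      · exact le_top
      · simp only [ne_eq, ENNReal.ofReal_eq_zero, not_le]; positivity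
  · obtain ⟨C, hC, hk⟩ := h.four
    refine ⟨C, hC, fun r₁ p1 r₂ p2 n => ?_⟩
    have : ∫ φ, eN n φ * k' r₁ r₂ φ ∂nuC = ∫ φ, eN n φ * k r₁ r₂ φ ∂nuC := by
      apply integral_congr_ae
      filter_upwards [hae r₁ p1 r₂ p2] with φ hφ
      rw [hφ]
    rw [this]
    exact hk r₁ p1 r₂ p2 n

end KLin

/-- kernel attached to an amplitude -/
noncomputable def kern (m : ℝ) (a : ℝ → ℂ) (G : ℝ → ℝ → ℂ) (r₁ r₂ φ : ℝ) : ℂ :=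
  ∫ s in Ioi (0 : ℝ), psi m a r₁ r₂ s * G φ s

lemma kern_meas {m : ℝ} {a : ℝ → ℂ} (ha : IsSymbol0 a) {G : ℝ → ℝ → ℂ} (hG : Measurable (fun z : ℝ × ℝ => G z.1 z.2)) (r₁ : ℝ) :
    Measurable (fun z : ℝ × ℝ => kern m a G r₁ z.1 z.2) := by
  unfold kern
  have h1 : Measurable (fun z : (ℝ × ℝ) × ℝ => psi m a r₁ z.1.1 z.2) := by
    have h : Measurable (fun z : (ℝ × ℝ) × ℝ => (r₁, z.1.1, z.2)) := by fun_prop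
    have e : (fun z : (ℝ × ℝ) × ℝ => psi m a r₁ z.1.1 z.2) = (fun z : ℝ × ℝ × ℝ => psi m a z.1 z.2.1 z.2.2) ∘ (fun z : (ℝ × ℝ) × ℝ => (r₁, z.1.1, z.2)) := rfl
    rw [e]
    exact Measurable.comp (psi_meas ha (m := m)) h
  have h2 : Measurable (fun z : (ℝ × ℝ) × ℝ => G z.1.2 z.2) := by
    have h : Measurable (fun z : (ℝ × ℝ) × ℝ => (z.1.2, z.2)) := by fun_prop
    have e : (fun z : (ℝ × ℝ) × ℝ => G z.1.2 z.2) = (fun z : ℝ × ℝ => G z.1 z.2) ∘ (fun z : (ℝ × ℝ) × ℝ => (z.1.2, z.2)) := rfl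
    rw [e]
    exact Measurable.comp hG h
  have h3 := (h1.mul h2).stronglyMeasurable
  exact (StronglyMeasurable.integral_prod_right (ν := volume.restrict (Ioi (0 : ℝ))) h3).measurable

/-- uniform amplitude condition -/
def AmpU (G : ℝ → ℝ → ℂ) : Prop := ∃ K : ℝ, 0 < K ∧ ∀ φ, 0 < sg φ → AmpOK (G φ) (K / sg φ) (K * sg φ ^ (-(1 / 4) : ℝ))

lemma kern_size {δ : ℝ} (hδ : 0 ≤ δ) {a : ℝ → ℂ} (ha : IsSymbol0 a) {G : ℝ → ℝ → ℂ} (hG : AmpU G) (τ : ℝ) (h0 : 0 ≤ τ) (h1 : τ ≤ 1) :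
    ∃ C : ℝ, 0 < C ∧ ∀ r₁ > 0, ∀ r₂ > 0, ∀ φ,
    ‖kern (3 / 2 + δ) a G r₁ r₂ φ‖ₑ ≤ ENNReal.ofReal (C * (1 + r₁ + r₂) ^ (-(3 / 2 + δ)) * (1 + min r₁ r₂) ^ (-(τ / 2))) * SS ((1 + 3 * τ) / 4) φ := by
  obtain ⟨C, hC, hb⟩ := amp_bound ha (m := 3 / 2 + δ) (by linarith)
  obtain ⟨K, hK, hA⟩ := hG
  refine ⟨C * (2 * K), by positivity, fun r₁ p1 r₂ p2 φ => ?_⟩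
  have hρ : 0 < min r₁ r₂ := lt_min p1 p2
  by_cases hs : 0 < sg φ
  · obtain ⟨b1, b2⟩ := hb (G φ) _ _ (hA φ hs) r₁ p1 r₂ p2
    have hle : sg φ ^ (-(1 / 4) : ℝ) ≤ sg φ ^ (-1 : ℝ) :=
      Real.rpow_le_rpow_of_exponent_ge hs (sg_le_one φ) (by norm_num)
    have h4 : 0 ≤ sg φ ^ (-(1 / 4) : ℝ) := by positivity
    have h := interp_bound (τ := τ) (K := 2 * K) (norm_nonneg _) (by positivity : 0 ≤ C * (1 + r₁ + r₂) ^ (-(3 / 2 + δ)))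
      (by positivity : 0 < (1 + min r₁ r₂) ^ (-(1 / 2) : ℝ)) hs (by positivity) h0 h1 b1 b2
      (by nlinarith) (by
        have : K / sg φ = K * sg φ ^ (-1 : ℝ) := by rw [Real.rpow_neg_one]; rfl
        rw [this]
        nlinarith)
    rw [SS_pos_eq hs, ← ENNReal.ofReal_mul (by positivity), ← ofReal_norm]
    apply ENNReal.ofReal_le_ofReal
    refine h.trans (le_of_eq ?_)
    rw [← Real.rpow_mul (by positivity)]
    rw [show -(1 / 2 : ℝ) * τ = -(τ / 2) by ring]
    ring
  · rw [SS_top (by linarith) hs, ENNReal.mul_top]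
    · exact le_top
    · simp only [ne_eq, ENNReal.ofReal_eq_zero, not_le]; positivity

lemma kern_int {δ : ℝ} (hδ : 0 ≤ δ) {a : ℝ → ℂ} (ha : IsSymbol0 a) {G : ℝ → ℝ → ℂ} (hG : AmpU G)
    (hGm : Measurable (fun z : ℝ × ℝ => G z.1 z.2)) {r₁ r₂ : ℝ} (p1 : 0 < r₁) (p2 : 0 < r₂) :
    Integrable (kern (3 / 2 + δ) a G r₁ r₂) nuC := by
  obtain ⟨C, hC, hk⟩ := kern_size hδ ha hG 0 le_rfl zero_le_one
  have hm : Measurable (kern (3 / 2 + δ) a G r₁ r₂) := by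
    have h : Measurable (fun φ : ℝ => (r₂, φ)) := by fun_prop
    have e : kern (3 / 2 + δ) a G r₁ r₂ = (fun z : ℝ × ℝ => kern (3 / 2 + δ) a G r₁ z.1 z.2) ∘ (fun φ : ℝ => (r₂, φ)) := rfl
    rw [e]
    exact Measurable.comp (kern_meas ha hGm r₁) h
  refine ⟨hm.aestronglyMeasurable, ?_⟩
  unfold HasFiniteIntegral
  refine lt_of_le_of_lt (lintegral_mono fun φ => hk r₁ p1 r₂ p2 φ) ?_
  rw [lintegral_const_mul' _ _ ENNReal.ofReal_ne_top]
  exact ENNReal.mul_lt_top ENNReal.ofReal_lt_top (SS_int _ (by norm_num) (by norm_num)).lt_top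

/-- the piece constant in the angle -/
lemma KLin_const {δ : ℝ} (hδ : 0 ≤ δ) {a : ℝ → ℂ} (ha : IsSymbol0 a) {c : ℝ} (hc : 0 < c) :
    KLin δ (kern (3 / 2 + δ) a (fun _ s => ((Real.exp (-(c * s)) : ℝ) : ℂ))) := by
  have hA : AmpU (fun _ s => ((Real.exp (-(c * s)) : ℝ) : ℂ)) := by
    refine ⟨1 + 1 / c, by positivity, fun φ hφ => ?_⟩
    obtain ⟨i1, i2, g', P, P', q1, q2, q3, q4, q5⟩ := ampOK_exp hc
    have h1c : 0 < 1 / c := by positivity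
    have hs1 := sg_le_one φ
    have hr : 1 ≤ sg φ ^ (-(1 / 4) : ℝ) := Real.one_le_rpow_of_pos_of_le_one_of_nonpos hφ hs1 (by norm_num)
    refine ⟨i1, i2.trans ?_, g', P, P', q1, q2, q3, q4, fun s hs => (q5 s hs).trans ?_⟩
    · nlinarith
    · rw [le_div_iff₀ hφ]; nlinarith
  refine ⟨fun r₁ p1 r₂ p2 => kern_int hδ ha hA (Continuous.measurable (by fun_prop)) p1 p2, kern_size hδ ha hA, ?_⟩
  obtain ⟨C, hC, hb⟩ := amp_bound ha (m := 3 / 2 + δ) (by linarith)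
  refine ⟨2 * π * (C * (1 + 1 / c)), by positivity, fun r₁ p1 r₂ p2 n => ?_⟩
  have hρ : 0 < min r₁ r₂ := lt_min p1 p2
  obtain ⟨b1, b2⟩ := hb _ _ _ (ampOK_exp hc) r₁ p1 r₂ p2
  unfold kern
  rw [integral_mul_const, norm_mul]
  calc _ ≤ 2 * π * (C * (1 + r₁ + r₂) ^ (-(3 / 2 + δ)) * ((1 + min r₁ r₂) ^ (-(1 / 2) : ℝ) * (1 + 1 / c))) := by
        gcongr
        exact eN_integral_norm n
    _ = _ := by ring

/-- the basic angular pieces -/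
lemma KLin_gG {δ : ℝ} (hδ : 0 ≤ δ) {a : ℝ → ℂ} (ha : IsSymbol0 a) {γ : ℝ} (hγ : 0 < γ) {e : ℤ} (he : e = 1 ∨ e = -1) :
    KLin δ (kern (3 / 2 + δ) a (fun φ s => gG γ (e * (φ + π)) s)) := by
  have hsg : ∀ φ : ℝ, |Real.sin ((e * (φ + π)) / 2)| = sg φ := by
    intro φ
    unfold sg
    rcases he with h | h
    · simp [h]
    · rw [h]
      push_cast
      rw [show (-1 * (φ + π)) / 2 = -((φ + π) / 2) by ring, Real.sin_neg, abs_neg]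
  have hA : AmpU (fun φ s => gG γ (e * (φ + π)) s) := by
    obtain ⟨K, hK, h⟩ := ampOK_gG hγ
    refine ⟨K + 5, by positivity, fun φ hφ => ?_⟩
    have h' := h (e * (φ + π)) (by rw [hsg]; exact hφ)
    rw [hsg] at h'
    obtain ⟨i1, i2, g', P, P', q1, q2, q3, q4, q5⟩ := h'
    refine ⟨i1, i2.trans ?_, g', P, P', q1, q2, q3, q4, fun s hs => (q5 s hs).trans ?_⟩
    · gcongr; linarith
    · gcongr; linarith
  have hGm : Measurable (fun z : ℝ × ℝ => gG γ (e * (z.1 + π)) z.2) := by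
    have h : Measurable (fun z : ℝ × ℝ => ((e : ℝ) * (z.1 + π), z.2)) := by fun_prop
    have e1 : (fun z : ℝ × ℝ => gG γ (e * (z.1 + π)) z.2) = (fun z : ℝ × ℝ => gG γ z.1 z.2) ∘ (fun z : ℝ × ℝ => ((e : ℝ) * (z.1 + π), z.2)) := rfl
    rw [e1]
    exact Measurable.comp (gG_meas γ) h
  refine ⟨fun r₁ p1 r₂ p2 => kern_int hδ ha hA hGm p1 p2, kern_size hδ ha hA, ?_⟩
  obtain ⟨C, hC, hb⟩ := amp_bound ha (m := 3 / 2 + δ) (by linarith)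
  refine ⟨2 * π * (C * (1 + 1 / γ)), by positivity, fun r₁ p1 r₂ p2 n => ?_⟩
  have hρ : 0 < min r₁ r₂ := lt_min p1 p2
  obtain ⟨c, κ, hc, hκ, hf⟩ := gG_fourier (γ := γ) he n
  have hκ0 : 0 < κ := by linarith
  -- Fubini
  have hI : Integrable (Function.uncurry fun φ s => eN n φ * (psi (3 / 2 + δ) a r₁ r₂ s * gG γ (e * (φ + π)) s))
      (nuC.prod (volume.restrict (Ioi (0 : ℝ)))) := by
    obtain ⟨c0, b', hc0, hb0, hbd, hb'⟩ := symbol_bounds ha (m := 3 / 2 + δ) (by linarith)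
    have hmaj := (sg_int.mul_prod (majorant_integrable hγ)).const_mul (c0 * (1 + r₁ + r₂) ^ (-(3 / 2 + δ)))
    refine Integrable.mono' hmaj ?_ ?_
    · refine Measurable.aestronglyMeasurable ?_
      refine Measurable.mul ((eN_cont n).measurable.comp measurable_fst) (Measurable.mul ?_ hGm)
      exact (psi_meas1 ha r₁ r₂).comp measurable_snd
    · have a1 := Measure.quasiMeasurePreserving_fst (μ := nuC) (ν := volume.restrict (Ioi (0 : ℝ))) |>.ae sg_pos_ae
      have a2 := Measure.quasiMeasurePreserving_snd (μ := nuC) (ν := volume.restrict (Ioi (0 : ℝ))) |>.ae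
        (ae_restrict_mem (μ := volume) (s := Ioi (0 : ℝ)) measurableSet_Ioi)
      filter_upwards [a1, a2] with z z1 z2
      have hn := gG_norm_le (γ := γ) (x := e * (z.1 + π)) (s := z.2) z2 (by rw [hsg]; exact z1)
      rw [hsg] at hn
      simp only [Function.uncurry, norm_mul, eN_norm, one_mul]
      have hp := psi_norm (by linarith) hc0 hb0 p1 p2 z.2
      gcongr
  unfold kern
  have e1 : ∀ φ, eN n φ * (∫ s in Ioi (0 : ℝ), psi (3 / 2 + δ) a r₁ r₂ s * gG γ (e * (φ + π)) s)
      = ∫ s in Ioi (0 : ℝ), eN n φ * (psi (3 / 2 + δ) a r₁ r₂ s * gG γ (e * (φ + π)) s) := fun φ =>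
    (integral_const_mul _ _).symm
  simp only [e1]
  rw [integral_integral_swap hI]
  have e2 : ∫ s in Ioi (0 : ℝ), ∫ φ, eN n φ * (psi (3 / 2 + δ) a r₁ r₂ s * gG γ (e * (φ + π)) s) ∂nuC
      = ∫ s in Ioi (0 : ℝ), c * (psi (3 / 2 + δ) a r₁ r₂ s * ((Real.exp (-(κ * s)) : ℝ) : ℂ)) := by
    refine setIntegral_congr_fun measurableSet_Ioi fun s hs => ?_
    have e3 : ∀ φ, eN n φ * (psi (3 / 2 + δ) a r₁ r₂ s * gG γ (e * (φ + π)) s) = psi (3 / 2 + δ) a r₁ r₂ s * (eN n φ * gG γ (e * (φ + π)) s) :=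
      fun φ => by ring
    simp only [e3]
    rw [integral_const_mul, hf s hs]
    ring
  rw [e2, integral_const_mul, norm_mul]
  obtain ⟨b1, b2⟩ := hb _ _ _ (ampOK_exp hκ0) r₁ p1 r₂ p2
  calc _ ≤ 2 * π * (C * (1 + r₁ + r₂) ^ (-(3 / 2 + δ)) * ((1 + min r₁ r₂) ^ (-(1 / 2) : ℝ) * (1 + 1 / κ))) := by gcongr
    _ ≤ 2 * π * (C * (1 + r₁ + r₂) ^ (-(3 / 2 + δ)) * ((1 + min r₁ r₂) ^ (-(1 / 2) : ℝ) * (1 + 1 / γ))) := by gcongr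
    _ = _ := by ring

end

section
lemma sg_neg_arg {φ : ℝ} {e : ℤ} (he : e = 1 ∨ e = -1) : |Real.sin (((e : ℝ) * (φ + π)) / 2)| = sg φ := by
  unfold sg
  rcases he with rfl | rfl
  · simp
  · rw [show (((-1 : ℤ) : ℝ) * (φ + π)) / 2 = -((φ + π) / 2) by push_cast; ring, Real.sin_neg, abs_neg]

lemma psi_gG_int {δ : ℝ} (hδ : 0 ≤ δ) {a : ℝ → ℂ} (ha : IsSymbol0 a) {γ : ℝ} (hγ : 0 < γ) {e : ℤ} (he : e = 1 ∨ e = -1)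
    {r₁ r₂ φ : ℝ} (h1 : 0 < r₁) (h2 : 0 < r₂) (hs : 0 < sg φ) :
    IntegrableOn (fun s => psi (3 / 2 + δ) a r₁ r₂ s * gG γ (e * (φ + π)) s) (Ioi 0) := by
  obtain ⟨K, hK, h⟩ := ampOK_gG hγ
  exact psi_int ha (by linarith) h1 h2 (h _ (by rw [sg_neg_arg he]; exact hs)).1

lemma den_pos {s : ℝ} (hs : 0 < s) (x : ℝ) : 0 < Real.cosh s - Real.cos x := by
  have := Real.one_lt_cosh.2 hs.ne'
  linarith [Real.cos_le_one x]

lemma gG_sum {γ x s : ℝ} (hs : 0 < s) : gG γ x s + gG γ (-x) s =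
    (((Real.exp ((1 - γ) * s) * (Real.cos x - Real.exp (-s)) / (Real.cosh s - Real.cos x) : ℝ)) : ℂ) ∧
    gG γ x s - gG γ (-x) s =
    Complex.I * (((Real.exp ((1 - γ) * s) * Real.sin x / (Real.cosh s - Real.cos x) : ℝ)) : ℂ) := by
  have hd := den_pos hs x
  set t := Real.exp (-s) with ht
  have t0 : 0 < t := Real.exp_pos _
  have t1 : t < 1 := Real.exp_lt_one_iff.2 (by linarith)
  have e1 : Real.exp (-(γ * s)) = Real.exp ((1 - γ) * s) * t := by
    rw [ht, ← Real.exp_add]; congr 1; ring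
  have e2 : Real.cosh s = (t⁻¹ + t) / 2 := by
    rw [Real.cosh_eq, ht, Real.exp_neg, inv_inv]
  set E := Real.exp ((1 - γ) * s)
  have c1 : Complex.exp (x * Complex.I) = (Real.cos x : ℂ) + (Real.sin x : ℂ) * Complex.I := by
    rw [Complex.exp_mul_I]; push_cast; ring
  have c2 : Complex.exp (((-x : ℝ) : ℂ) * Complex.I) = (Real.cos x : ℂ) - (Real.sin x : ℂ) * Complex.I := by
    rw [Complex.exp_mul_I]; push_cast; rw [Complex.cos_neg, Complex.sin_neg]; ring
  have hsc := Real.sin_sq_add_cos_sq x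
  unfold gG
  rw [c1, c2, e1, ← ht]
  rw [e2] at hd ⊢
  set C := Real.cos x
  set S := Real.sin x
  have hprod : (1 - ((C : ℂ) + S * Complex.I) * t) * (1 - ((C : ℂ) - S * Complex.I) * t) = ((2 * t * ((t⁻¹ + t) / 2 - C) : ℝ) : ℂ) := by
    have : 2 * t * ((t⁻¹ + t) / 2 - C) = 1 + t ^ 2 * (S ^ 2 + C ^ 2) - 2 * t * C := by
      rw [hsc]; field_simp
    rw [this]
    push_cast
    linear_combination (-(S : ℂ) ^ 2 * t ^ 2) * Complex.I_sq
  have hne : ((2 * t * ((t⁻¹ + t) / 2 - C) : ℝ) : ℂ) ≠ 0 := by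
    rw [Complex.ofReal_ne_zero]; positivity
  have hA : (1 - ((C : ℂ) + S * Complex.I) * t) ≠ 0 := by
    intro h; rw [h, zero_mul] at hprod; exact hne hprod.symm
  have hB : (1 - ((C : ℂ) - S * Complex.I) * t) ≠ 0 := by
    intro h; rw [h, mul_zero] at hprod; exact hne hprod.symm
  have hd' : (((t⁻¹ + t) / 2 - C : ℝ) : ℂ) ≠ 0 := by
    rw [Complex.ofReal_ne_zero]; exact hd.ne'
  have ht' : (t : ℂ) ≠ 0 := by rw [Complex.ofReal_ne_zero]; exact t0.ne'
  have hscc : (S : ℂ) ^ 2 + (C : ℂ) ^ 2 = 1 := by exact_mod_cast hsc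
  constructor
  · rw [div_add_div _ _ hA hB, hprod, Complex.ofReal_div, div_eq_div_iff hne hd']
    push_cast
    field_simp
    have := Complex.I_sq
    grind
  · rw [div_sub_div _ _ hA hB, hprod, Complex.ofReal_div, ← mul_div_assoc, div_eq_div_iff hne hd']
    push_cast
    field_simp
    ring

end

section
lemma integral_add4 {f g h k : ℝ → ℂ} (hf : IntegrableOn f (Ioi 0)) (hg : IntegrableOn g (Ioi 0)) (hh : IntegrableOn h (Ioi 0))
    (hk : IntegrableOn k (Ioi 0)) : ∫ s in Ioi (0 : ℝ), (f s + g s + h s + k s) =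
    (∫ s in Ioi (0 : ℝ), f s) + (∫ s in Ioi (0 : ℝ), g s) + (∫ s in Ioi (0 : ℝ), h s) + (∫ s in Ioi (0 : ℝ), k s) := by
  have i2 : IntegrableOn (fun s => f s + g s) (Ioi 0) := hf.add hg
  have i3 : IntegrableOn (fun s => f s + g s + h s) (Ioi 0) := i2.add hh
  rw [integral_add i3 hk, integral_add i2 hh, integral_add hf hg]

lemma KLin_KD {δ : ℝ} (hδ : 0 ≤ δ) {a : ℝ → ℂ} (ha : IsSymbol0 a) {α : ℝ} (hα : α ∈ Set.Ioo (-1 : ℝ) 1) (hα0 : α ≠ 0)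
    (ℓ : Fin 3) : KLin δ (KD δ α a ℓ) := by
  have g1 : 0 < 1 - α := by linarith [hα.2]
  have g2 : 0 < 1 + α := by linarith [hα.1]
  have p1 := KLin_gG hδ ha g1 (e := 1) (Or.inl rfl)
  have p2 := KLin_gG hδ ha g1 (e := -1) (Or.inr rfl)
  have p3 := KLin_gG hδ ha g2 (e := 1) (Or.inl rfl)
  have p4 := KLin_gG hδ ha g2 (e := -1) (Or.inr rfl)
  have key : ∀ (c1 c2 c3 c4 : ℂ), (∀ φ s, 0 < s → ((wD α φ s ℓ : ℝ) : ℂ) =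
      c1 * gG (1 - α) (((1 : ℤ) : ℝ) * (φ + π)) s + c2 * gG (1 - α) (((-1 : ℤ) : ℝ) * (φ + π)) s
      + c3 * gG (1 + α) (((1 : ℤ) : ℝ) * (φ + π)) s + c4 * gG (1 + α) (((-1 : ℤ) : ℝ) * (φ + π)) s) → KLin δ (KD δ α a ℓ) := by
    intro c1 c2 c3 c4 hw
    refine ((((p1.smul c1).add (p2.smul c2)).add (p3.smul c3)).add (p4.smul c4)).congr ?_
    intro r₁ h1 r₂ h2 φ hs
    rw [KD_eq δ α a ℓ h1 h2 φ]
    have i1 := (psi_gG_int hδ ha g1 (e := 1) (Or.inl rfl) h1 h2 hs).const_mul c1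
    have i2 := (psi_gG_int hδ ha g1 (e := -1) (Or.inr rfl) h1 h2 hs).const_mul c2
    have i3 := (psi_gG_int hδ ha g2 (e := 1) (Or.inl rfl) h1 h2 hs).const_mul c3
    have i4 := (psi_gG_int hδ ha g2 (e := -1) (Or.inr rfl) h1 h2 hs).const_mul c4
    unfold kern
    rw [← integral_const_mul, ← integral_const_mul, ← integral_const_mul, ← integral_const_mul,
      ← integral_add4 i1 i2 i3 i4]
    refine setIntegral_congr_fun measurableSet_Ioi fun s hs0 => ?_
    beta_reduce
    rw [hw φ s hs0]
    ring
  have hg : ∀ φ s : ℝ, 0 < s → _ := fun φ s hs => (gG_sum (γ := 1 - α) (x := φ + π) (s := s) hs)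
  have hg' : ∀ φ s : ℝ, 0 < s → _ := fun φ s hs => (gG_sum (γ := 1 + α) (x := φ + π) (s := s) hs)
  fin_cases ℓ
  · refine (KLin_const hδ ha (abs_pos.2 hα0)).congr ?_
    intro r₁ h1 r₂ h2 φ hs
    rw [KD_eq δ α a _ h1 h2 φ]
    unfold kern
    simp [wD]
  · refine key (-(1 / 2)) (-(1 / 2)) (1 / 2) (1 / 2) fun φ s hs => ?_
    have a1 := (hg φ s hs).1
    have a2 := (hg' φ s hs).1
    have hd := den_pos hs (φ + π)
    have e1 : ((wD α φ s 1 : ℝ) : ℂ) = ((-(1 / 2) * (Real.exp ((1 - (1 - α)) * s) * (Real.cos (φ + π) - Real.exp (-s)) / (Real.cosh s - Real.cos (φ + π))) + (1 / 2) * (Real.exp ((1 - (1 + α)) * s) * (Real.cos (φ + π) - Real.exp (-s)) / (Real.cosh s - Real.cos (φ + π))) : ℝ) : ℂ) := by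
      congr 1
      simp only [wD, Matrix.cons_val_one, Matrix.cons_val_zero]
      rw [Real.sinh_eq, show (1 - (1 - α)) * s = α * s by ring, show (1 - (1 + α)) * s = -(α * s) by ring]
      ring
    rw [Complex.ofReal_add, Complex.ofReal_mul, Complex.ofReal_mul, ← a1, ← a2] at e1
    refine e1.trans ?_
    push_cast
    simp only [one_mul, neg_mul]
    ring
  · refine key (-(Complex.I / 2)) (Complex.I / 2) (-(Complex.I / 2)) (Complex.I / 2) fun φ s hs => ?_
    have a1 := (hg φ s hs).2
    have a2 := (hg' φ s hs).2
    have hd := den_pos hs (φ + π)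
    have e1 : ((wD α φ s 2 : ℝ) : ℂ) = ((1 / 2 * (Real.exp ((1 - (1 - α)) * s) * Real.sin (φ + π) / (Real.cosh s - Real.cos (φ + π))) + (1 / 2) * (Real.exp ((1 - (1 + α)) * s) * Real.sin (φ + π) / (Real.cosh s - Real.cos (φ + π))) : ℝ) : ℂ) := by
      congr 1
      simp only [wD, Matrix.cons_val]
      rw [Real.cosh_eq (α * s), show (1 - (1 - α)) * s = α * s by ring, show (1 - (1 + α)) * s = -(α * s) by ring]
      ring
    rw [Complex.ofReal_add, Complex.ofReal_mul, Complex.ofReal_mul] at e1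
    refine e1.trans ?_
    have q1 : ∀ z w : ℂ, z = Complex.I * w → w = -Complex.I * z := by
      intro z w h; rw [h, ← mul_assoc, neg_mul, Complex.I_mul_I]; ring
    rw [q1 _ _ a1, q1 _ _ a2]
    push_cast
    simp only [one_mul, neg_mul]
    ring

lemma wD_meas (α : ℝ) (ℓ : Fin 3) : Measurable (fun z : ℝ × ℝ => ((wD α z.1 z.2 ℓ : ℝ) : ℂ)) := by
  refine Complex.measurable_ofReal.comp ?_
  fin_cases ℓ
  · simp only [wD, Fin.zero_eta, Matrix.cons_val_zero]
    exact Continuous.measurable (by fun_prop)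
  · simp only [wD, Fin.mk_one, Matrix.cons_val_one, Matrix.cons_val_zero]
    exact Measurable.div (Continuous.measurable (by fun_prop)) (Continuous.measurable (by fun_prop))
  · simp only [wD, Fin.reduceFinMk, Matrix.cons_val]
    exact Measurable.div (Continuous.measurable (by fun_prop)) (Continuous.measurable (by fun_prop))

lemma KD_meas {δ : ℝ} {a : ℝ → ℂ} (ha : IsSymbol0 a) (α : ℝ) (ℓ : Fin 3) (r₁ : ℝ) (h1 : 0 < r₁) :
    Measurable (fun z : ℝ × ℝ => if 0 < z.1 then KD δ α a ℓ r₁ z.1 z.2 else 0) := by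
  have e : (fun z : ℝ × ℝ => if 0 < z.1 then KD δ α a ℓ r₁ z.1 z.2 else 0) =
      (fun z : ℝ × ℝ => if 0 < z.1 then kern (3 / 2 + δ) a (fun φ s => ((wD α φ s ℓ : ℝ) : ℂ)) r₁ z.1 z.2 else 0) := by
    funext z
    split_ifs with h
    · rw [KD_eq δ α a ℓ h1 h]; rfl
    · rfl
  rw [e]
  exact Measurable.ite (measurableSet_lt measurable_const measurable_fst) (kern_meas ha (wD_meas α ℓ) r₁) measurable_const

lemma KD_per (δ α : ℝ) (a : ℝ → ℂ) (ℓ : Fin 3) (r₁ r₂ φ : ℝ) : KD δ α a ℓ r₁ r₂ (φ + 2 * π) = KD δ α a ℓ r₁ r₂ φ := by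
  have : ∀ s, wD α (φ + 2 * π) s = wD α φ s := by
    intro s
    unfold wD
    rw [show φ + 2 * π + π = φ + π + 2 * π by ring, Real.cos_add_two_pi, Real.sin_add_two_pi]
  unfold KD
  simp only [this]

end

section
/-- the kernel as a holomorphic function of the cosine -/
noncomputable def HH (P A B : ℝ → ℂ) (c : ℂ) : ℂ :=
  ∫ s in Ioi (0 : ℝ), P s * ((A s + c * B s) / (((Real.cosh s : ℝ) : ℂ) - c))

lemma HH_diff {P A B : ℝ → ℂ} {M κ : ℝ} (hP : Measurable P) (hA : Measurable A) (hB : Measurable B)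
    (hPM : ∀ s, ‖P s‖ ≤ M) (hAe : ∀ s, 0 < s → ‖A s‖ ≤ Real.exp (κ * s)) (hBe : ∀ s, 0 < s → ‖B s‖ ≤ Real.exp (κ * s)) (hκ : κ < 1) :
    DifferentiableOn ℂ (HH P A B) (Metric.ball 0 1) := by
  intro c0 hc0
  rw [Metric.mem_ball, dist_zero_right] at hc0
  apply DifferentiableAt.differentiableWithinAt
  have hM : 0 ≤ M := (norm_nonneg _).trans (hPM 0)
  obtain ⟨ρ, h1, h2⟩ := exists_between hc0
  have hcm : Measurable (fun s : ℝ => ((Real.cosh s : ℝ) : ℂ)) := Complex.measurable_ofReal.comp Real.measurable_cosh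
  have hcosh : ∀ s : ℝ, Real.exp s / 2 ≤ Real.cosh s := by
    intro s; rw [Real.cosh_eq]; linarith [Real.exp_pos (-s)]
  have hden : ∀ c : ℂ, ‖c‖ < ρ → ∀ s : ℝ, (1 - ρ) * Real.cosh s ≤ ‖((Real.cosh s : ℝ) : ℂ) - c‖ := by
    intro c hc s
    have := norm_sub_norm_le (((Real.cosh s : ℝ) : ℂ)) c
    rw [Complex.norm_real, Real.norm_of_nonneg (Real.cosh_pos s).le] at this
    have h3 := Real.one_le_cosh s
    have : 0 ≤ ρ := (norm_nonneg _).trans h1.le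
    nlinarith
  have hd0 : 0 < 1 - ρ := by linarith
  have hIe : IntegrableOn (fun s : ℝ => Real.exp (-((1 - κ) * s))) (Ioi 0) := exp_real_integrable (by linarith)
  have hex : ∀ s, Real.exp (κ * s) = Real.exp (-((1 - κ) * s)) * Real.exp s := by
    intro s; rw [← Real.exp_add]; congr 1; ring
  have hmem : Metric.ball (0 : ℂ) ρ ∈ nhds c0 := Metric.isOpen_ball.mem_nhds (by simpa using h1)
  have hFm : ∀ c : ℂ, Measurable (fun s => P s * ((A s + c * B s) / (((Real.cosh s : ℝ) : ℂ) - c))) := by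
    intro c
    exact hP.mul ((hA.add (hB.const_mul c)).div (hcm.sub_const c))
  refine (hasDerivAt_integral_of_dominated_loc_of_deriv_le (𝕜 := ℂ) (μ := volume.restrict (Ioi (0 : ℝ)))
    (F := fun c s => P s * ((A s + c * B s) / (((Real.cosh s : ℝ) : ℂ) - c)))
    (F' := fun c s => P s * ((B s * ((Real.cosh s : ℝ) : ℂ) + A s) / (((Real.cosh s : ℝ) : ℂ) - c) ^ 2))
    (bound := fun s => (M * 4 / (1 - ρ) ^ 2) * Real.exp (-((1 - κ) * s))) hmem
    (Filter.Eventually.of_forall fun c => (hFm c).aestronglyMeasurable) ?_ ?_ ?_ (hIe.const_mul _) ?_).2.differentiableAt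
  · refine Integrable.mono' (hIe.const_mul (M * 4 / (1 - ρ))) (hFm c0).aestronglyMeasurable ?_
    filter_upwards [ae_restrict_mem measurableSet_Ioi] with s hs
    have hs' : (0 : ℝ) < s := hs
    have q := hden c0 h1 s
    have qp : 0 < (1 - ρ) * (Real.exp s / 2) := by positivity
    rw [norm_mul, norm_div]
    have n1 : ‖A s + c0 * B s‖ ≤ 2 * Real.exp (κ * s) := by
      refine (norm_add_le _ _).trans ?_
      rw [norm_mul]
      nlinarith [hAe s hs', hBe s hs', norm_nonneg c0, norm_nonneg (B s)]
    calc ‖P s‖ * (‖A s + c0 * B s‖ / ‖((Real.cosh s : ℝ) : ℂ) - c0‖) ≤ M * ((2 * Real.exp (κ * s)) / ((1 - ρ) * (Real.exp s / 2))) := by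
          gcongr
          · exact hPM s
          · refine le_trans ?_ q
            gcongr
            exact hcosh s
      _ = _ := by
          rw [hex]; field_simp; ring
  · exact (hP.mul (((hB.mul hcm).add hA).div ((hcm.sub_const c0).pow_const 2))).aestronglyMeasurable
  · filter_upwards [ae_restrict_mem measurableSet_Ioi] with s hs c hc
    have hs' : (0 : ℝ) < s := hs
    have hc' : ‖c‖ < ρ := by simpa using hc
    have q := hden c hc' s
    have hcp := Real.cosh_pos s
    rw [norm_mul, norm_div, norm_pow]
    have n1 : ‖B s * ((Real.cosh s : ℝ) : ℂ) + A s‖ ≤ 2 * Real.exp (κ * s) * Real.cosh s := by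
      refine (norm_add_le _ _).trans ?_
      rw [norm_mul, Complex.norm_real, Real.norm_of_nonneg hcp.le]
      nlinarith [hAe s hs', hBe s hs', Real.one_le_cosh s, Real.exp_pos (κ * s)]
    have e3 : Real.cosh s ≠ 0 := hcp.ne'
    calc ‖P s‖ * (‖B s * ((Real.cosh s : ℝ) : ℂ) + A s‖ / ‖((Real.cosh s : ℝ) : ℂ) - c‖ ^ 2)
        ≤ M * ((2 * Real.exp (κ * s) * Real.cosh s) / ((1 - ρ) * Real.cosh s) ^ 2) := by
          gcongr
          exact hPM s
      _ = M * (2 / (1 - ρ) ^ 2) * Real.exp (κ * s) / Real.cosh s := by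
          field_simp
      _ ≤ M * (2 / (1 - ρ) ^ 2) * Real.exp (κ * s) / (Real.exp s / 2) := by
          gcongr
          exact hcosh s
      _ = _ := by
          rw [hex]; field_simp; ring
  · filter_upwards [ae_restrict_mem measurableSet_Ioi] with s hs c hc
    have hc' : ‖c‖ < ρ := by simpa using hc
    have q := hden c hc' s
    have hcp := Real.cosh_pos s
    have hne : ((Real.cosh s : ℝ) : ℂ) - c ≠ 0 := by
      rw [← norm_pos_iff]
      refine lt_of_lt_of_le ?_ q
      positivity
    have d1 : HasDerivAt (fun c : ℂ => A s + c * B s) (B s) c := by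
      simpa using ((hasDerivAt_id c).mul_const (B s)).const_add (A s)
    have d2 : HasDerivAt (fun c : ℂ => ((Real.cosh s : ℝ) : ℂ) - c) (-1) c := by
      simpa using (hasDerivAt_id c).const_sub (((Real.cosh s : ℝ) : ℂ))
    refine ((d1.div d2 hne).const_mul (P s)).congr_deriv ?_
    congr 2
    ring

lemma cos_preimage_countable (c : ℝ) : {φ : ℝ | Real.cos (φ + π) = c}.Countable := by
  rcases Set.eq_empty_or_nonempty {φ : ℝ | Real.cos (φ + π) = c} with h | ⟨y, hy⟩
  · rw [h]; exact countable_empty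
  · have : {φ : ℝ | Real.cos (φ + π) = c} ⊆ (range fun k : ℤ => y - 2 * k * π) ∪ (range fun k : ℤ => 2 * k * π - (y + π) - π) := by
      intro φ hφ
      have e : Real.cos (φ + π) = Real.cos (y + π) := by
        rw [mem_setOf_eq] at hφ hy; rw [hφ, hy]
      obtain ⟨k, hk | hk⟩ := Real.cos_eq_cos_iff.1 e
      · left; exact ⟨k, by dsimp only; linarith⟩
      · right; exact ⟨k, by dsimp only; linarith⟩
    exact ((countable_range _).union (countable_range _)).mono this

lemma cos_ae {S : Set ℝ} (hS : S.Countable) : ∀ᵐ φ : ℝ, Real.cos (φ + π) ∉ S := by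
  have : {φ : ℝ | Real.cos (φ + π) ∈ S}.Countable := by
    have e : {φ : ℝ | Real.cos (φ + π) ∈ S} = ⋃ c ∈ S, {φ : ℝ | Real.cos (φ + π) = c} := by
      ext φ; simp
    rw [e]
    exact hS.biUnion fun c _ => cos_preimage_countable c
  have h0 := this.measure_zero volume
  rw [ae_iff]
  simpa using h0

lemma HH_zero {H : ℂ → ℂ} (hH : DifferentiableOn ℂ H (Metric.ball 0 1)) :
    (∀ᵐ φ : ℝ, H ((Real.cos (φ + π) : ℝ) : ℂ) = 0) ∨ (∀ᵐ φ : ℝ, H ((Real.cos (φ + π) : ℝ) : ℂ) ≠ 0) := by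
  have hball : ∀ᵐ φ : ℝ, ((Real.cos (φ + π) : ℝ) : ℂ) ∈ Metric.ball (0 : ℂ) 1 := by
    filter_upwards [cos_ae (S := {1, -1}) (by simp)] with φ hφ
    rw [Metric.mem_ball, dist_zero_right, Complex.norm_real, Real.norm_eq_abs]
    refine lt_of_le_of_ne (Real.abs_cos_le_one _) fun h => hφ ?_
    rcases eq_or_eq_neg_of_abs_eq h with h | h <;> simp [h]
  by_cases hz : ∀ z ∈ Metric.ball (0 : ℂ) 1, H z = 0
  · left
    filter_upwards [hball] with φ hφ using hz _ hφ
  · right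
    push Not at hz
    obtain ⟨z, hz, hne⟩ := hz
    have han : AnalyticOnNhd ℂ H (Metric.ball 0 1) := hH.analyticOnNhd Metric.isOpen_ball
    have hcon : IsConnected (Metric.ball (0 : ℂ) 1) := (convex_ball _ _).isConnected ⟨z, hz⟩
    have hcd := han.preimage_zero_mem_codiscreteWithin hne hz hcon
    rw [preimage_compl] at hcd
    have hct : (H ⁻¹' {0} ∩ Metric.ball 0 1).Countable :=
      (HereditarilyLindelofSpace.isLindelof _).countable_of_isDiscrete (isDiscrete_of_codiscreteWithin hcd)
    have hct' : {c : ℝ | (c : ℂ) ∈ H ⁻¹' {0} ∩ Metric.ball 0 1}.Countable :=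
      hct.preimage Complex.ofReal_injective
    filter_upwards [hball, cos_ae hct'] with φ h1 h2 h3
    exact h2 ⟨h3, h1⟩

lemma sinh_bd (α s : ℝ) (hs : 0 < s) : Real.cosh (α * s) ≤ Real.exp (|α| * s) ∧ |Real.sinh (α * s)| ≤ Real.exp (|α| * s) := by
  have e1 : Real.exp (α * s) ≤ Real.exp (|α| * s) := by
    apply Real.exp_le_exp.2; nlinarith [le_abs_self α]
  have e2 : Real.exp (-(α * s)) ≤ Real.exp (|α| * s) := by
    apply Real.exp_le_exp.2; nlinarith [neg_le_abs α]
  have p1 := Real.exp_pos (α * s)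
  have p2 := Real.exp_pos (-(α * s))
  constructor
  · rw [Real.cosh_eq]; linarith
  · rw [Real.sinh_eq, abs_le]; constructor <;> linarith

lemma KD_zero {δ : ℝ} (hδ : 0 ≤ δ) {a : ℝ → ℂ} (ha : IsSymbol0 a) {α : ℝ} (hα : α ∈ Set.Ioo (-1 : ℝ) 1)
    (ℓ : Fin 3) {r₁ r₂ : ℝ} (h1 : 0 < r₁) (h2 : 0 < r₂) :
    (∀ᵐ φ : ℝ, KD δ α a ℓ r₁ r₂ φ = 0) ∨ (∀ᵐ φ : ℝ, KD δ α a ℓ r₁ r₂ φ ≠ 0) := by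
  obtain ⟨c, b', hc, hb, -⟩ := symbol_bounds ha (m := 3 / 2 + δ) (by linarith)
  have hPM := fun s => psi_norm (a := a) (m := 3 / 2 + δ) (by linarith) hc hb h1 h2 s
  have hPm := psi_meas1 (m := 3 / 2 + δ) ha r₁ r₂
  have hκ : |α| < 1 := abs_lt.2 ⟨hα.1, hα.2⟩
  have hsm : Measurable (fun s : ℝ => ((Real.sinh (α * s) : ℝ) : ℂ)) := Continuous.measurable (by fun_prop)
  have hcm : Measurable (fun s : ℝ => ((Real.cosh (α * s) : ℝ) : ℂ)) := Continuous.measurable (by fun_prop)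
  have hem : Measurable (fun s : ℝ => ((Real.exp (-s) : ℝ) : ℂ)) := Continuous.measurable (by fun_prop)
  fin_cases ℓ
  · by_cases h0 : KD δ α a 0 r₁ r₂ 0 = 0
    · left
      exact Filter.Eventually.of_forall fun φ => h0
    · right
      exact Filter.Eventually.of_forall fun φ => h0
  · have hd := HH_diff (P := psi (3 / 2 + δ) a r₁ r₂) (A := fun s => ((Real.exp (-s) : ℝ) : ℂ) * ((Real.sinh (α * s) : ℝ) : ℂ))
      (B := fun s => -((Real.sinh (α * s) : ℝ) : ℂ)) (κ := |α|) hPm (hem.mul hsm) hsm.neg hPM ?_ ?_ hκ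
    · have e : ∀ φ, KD δ α a 1 r₁ r₂ φ = HH (psi (3 / 2 + δ) a r₁ r₂) (fun s => ((Real.exp (-s) : ℝ) : ℂ) * ((Real.sinh (α * s) : ℝ) : ℂ))
          (fun s => -((Real.sinh (α * s) : ℝ) : ℂ)) ((Real.cos (φ + π) : ℝ) : ℂ) := by
        intro φ
        rw [KD_eq δ α a 1 h1 h2 φ]
        unfold HH
        refine setIntegral_congr_fun measurableSet_Ioi fun s hs => ?_
        beta_reduce
        congr 1
        simp only [wD, Matrix.cons_val_one, Matrix.cons_val_zero]
        push_cast
        ring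
      have := HH_zero hd
      simp only [← e] at this
      exact this
    · intro s hs
      rw [norm_mul, Complex.norm_real, Complex.norm_real, Real.norm_eq_abs, Real.norm_eq_abs, Real.abs_exp]
      have := (sinh_bd α s hs).2
      have h3 : Real.exp (-s) ≤ 1 := (Real.exp_lt_one_iff.2 (by linarith)).le
      nlinarith [abs_nonneg (Real.sinh (α * s))]
    · intro s hs
      rw [norm_neg, Complex.norm_real, Real.norm_eq_abs]
      exact (sinh_bd α s hs).2
  · have hd := HH_diff (P := psi (3 / 2 + δ) a r₁ r₂) (A := fun s => ((Real.cosh (α * s) : ℝ) : ℂ))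
      (B := fun s => 0) (κ := |α|) hPm hcm measurable_const hPM ?_ ?_ hκ
    · have e : ∀ φ, KD δ α a 2 r₁ r₂ φ = ((Real.sin (φ + π) : ℝ) : ℂ) * HH (psi (3 / 2 + δ) a r₁ r₂) (fun s => ((Real.cosh (α * s) : ℝ) : ℂ))
          (fun s => 0) ((Real.cos (φ + π) : ℝ) : ℂ) := by
        intro φ
        rw [KD_eq δ α a 2 h1 h2 φ]
        unfold HH
        rw [← integral_const_mul]
        refine setIntegral_congr_fun measurableSet_Ioi fun s hs => ?_
        beta_reduce
        simp only [wD, Matrix.cons_val]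
        push_cast
        ring
      show (∀ᵐ φ : ℝ, KD δ α a 2 r₁ r₂ φ = 0) ∨ (∀ᵐ φ : ℝ, KD δ α a 2 r₁ r₂ φ ≠ 0)
      simp only [e]
      rcases HH_zero hd with h | h
      · left
        filter_upwards [h] with φ hφ
        rw [hφ, mul_zero]
      · right
        filter_upwards [h, cos_ae (S := {1, -1}) (by simp)] with φ hφ hc
        refine mul_ne_zero ?_ hφ
        rw [Complex.ofReal_ne_zero]
        intro h0
        apply hc
        rcases Real.sin_eq_zero_iff_cos_eq.1 h0 with h | h <;> simp [h]
    · intro s hs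
      rw [Complex.norm_real, Real.norm_of_nonneg (Real.cosh_pos _).le]
      exact (sinh_bd α s hs).1
    · intro s hs
      rw [norm_zero]; positivity

lemma KFacts_KD {δ : ℝ} (hδ : 0 ≤ δ) {a : ℝ → ℂ} (ha : IsSymbol0 a) {α : ℝ} (hα : α ∈ Set.Ioo (-1 : ℝ) 1) (hα0 : α ≠ 0)
    (ℓ : Fin 3) : KFacts δ (KD δ α a ℓ) where
  meas := KD_meas ha α ℓ
  per := KD_per δ α a ℓ
  size := (KLin_KD hδ ha hα hα0 ℓ).size
  four := (KLin_KD hδ ha hα hα0 ℓ).four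
  zero := fun _ h1 _ h2 => KD_zero hδ ha hα ℓ h1 h2

end

theorem stmt1 (δ : ℝ) (hδ : 0 ≤ δ) (a : ℝ → ℂ) (ha : IsSymbol0 a)
    (β β₀ : ℝ → ℝ) (hβ : ContDiff ℝ (⊤ : ℕ∞) β)
    (hβs : Function.support β ⊆ Set.Icc (3 / 8) (4 / 3))
    (hβ₀ : ContDiff ℝ (⊤ : ℕ∞) β₀) (hβ₀s : Function.support β₀ ⊆ Set.Icc 0 1)
    (α : ℝ) (hα : α ∈ Set.Ioo (-1 : ℝ) 1) (hα0 : α ≠ 0) :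
    ∀ ℓ : Fin 3,
      (∃ C : ℝ≥0, ∀ (j : ℕ) (f : ℝ → ℝ → ℂ),
          polarLp 2 (TD δ α a β β₀ ℓ j f) ≤
            (C : ℝ≥0∞) * (2 : ℝ≥0∞) ^ (-(j : ℝ) * δ) * polarLp 2 f) ∧
      (∀ p : ℝ, 6 ≤ p → ∃ C : ℝ≥0, ∀ (j : ℕ) (f : ℝ → ℝ → ℂ),
          polarLp p (TD δ α a β β₀ ℓ j f) ≤
            (C : ℝ≥0∞) * (2 : ℝ≥0∞) ^ ((j : ℝ) * (deltaC p - δ)) * polarLp p f) ∧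
      (∀ p : ℝ, 4 ≤ p → p < 6 → ∀ ε' : ℝ, 0 < ε' → ε' < 1 →
          ∃ C : ℝ≥0, ∀ (j : ℕ) (f : ℝ → ℝ → ℂ),
            polarLp p (TD δ α a β β₀ ℓ j f) ≤
              (C : ℝ≥0∞) * (2 : ℝ≥0∞) ^ ((j : ℝ) * (deltaC p - δ)) *
                (2 : ℝ≥0∞) ^ ((j : ℝ) * ε') * polarLp p f) := by
  intro ℓ
  exact stmt_of_facts δ hδ a β β₀ hβ.continuous hβs hβ₀.continuous hβ₀s α ℓ (KFacts_KD hδ ha hα hα0 ℓ)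

end
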